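/- arXiv:2509.07541 — 8 statements merged into one kernel-verified Lean document; each statement's English description precedes it below -/
import Mathlib

section
/- Let D = {(x,y,z) ∈ ℝ³ : x·y = 0}. For every finite set K ⊆ ℝ³, the D-convex hull conv_D K is a semialgebraic subset of ℝ³; moreover, there exist finitely many real polynomials p₁, …, p_m in the variables x, y, z, each of total degree at most 2, such that conv_D K is a finite union of finite intersections of sets of the form {v ∈ ℝ³ : p_i(v) > 0}, {v ∈ ℝ³ : p_i(v) = 0}, {v ∈ ℝ³ : p_i(v) < 0}. -/
/-- A function `f` is `D`-convex if it is convex along every direction in the cone `D`. -/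
def DConvex {E : Type*} [AddCommGroup E] [Module ℝ E] (D : Set E) (f : E → ℝ) : Prop :=
  ∀ A : E, ∀ B ∈ D, ConvexOn ℝ Set.univ (fun t : ℝ => f (A + t • B))

/-- The `D`-convex hull of a set `K`. -/
def DConvexHull {E : Type*} [AddCommGroup E] [Module ℝ E] (D : Set E) (K : Set E) : Set E :=
  {A | ∀ f : E → ℝ, DConvex D f → f A ≤ sSup (f '' K)}

/-- The cone of rank-one directions for upper triangular `2×2` matrices,
identified with `ℝ³` via `(x, y, z) ↦ [[x, z], [0, y]]`. -/
def D3 : Set (ℝ × ℝ × ℝ) := {v | v.1 * v.2.1 = 0}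

namespace TriHull

lemma dconv_of {f : ℝ × ℝ × ℝ → ℝ}
    (h : ∀ x1 y1 z1 x2 y2 z2 s t : ℝ, (x1 = x2 ∨ y1 = y2) → 0 ≤ s → 0 ≤ t → s + t = 1 →
      f (s * x1 + t * x2, s * y1 + t * y2, s * z1 + t * z2) ≤
        s * f (x1, y1, z1) + t * f (x2, y2, z2)) : DConvex D3 f := by
  rintro ⟨x, y, z⟩ ⟨u, v, w⟩ hB
  refine ⟨convex_univ, ?_⟩
  intro p _ q _ s t hs ht hst
  have hB' : u * v = 0 := hB
  have hc : x + p * u = x + q * u ∨ y + p * v = y + q * v := by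
    rcases mul_eq_zero.1 hB' with h | h <;> simp [h]
  have := h (x + p * u) (y + p * v) (z + p * w) (x + q * u) (y + q * v) (z + q * w) s t hc hs ht hst
  simp only [Prod.smul_mk, Prod.mk_add_mk, smul_eq_mul]
  have e : ∀ a b : ℝ, s * (a + p * b) + t * (a + q * b) = a + (s * p + t * q) * b := by
    intro a b
    have : s = 1 - t := by linarith
    subst this; ring
  rw [e, e, e] at this
  exact this

lemma dconv_ineq {f : ℝ × ℝ × ℝ → ℝ} (hf : DConvex D3 f) (x1 y1 z1 x2 y2 z2 s t : ℝ)
    (hc : x1 = x2 ∨ y1 = y2) (hs : 0 ≤ s) (ht : 0 ≤ t) (hst : s + t = 1) :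
      f (s * x1 + t * x2, s * y1 + t * y2, s * z1 + t * z2) ≤
        s * f (x1, y1, z1) + t * f (x2, y2, z2) := by
  have hD : ((x2 - x1, y2 - y1, z2 - z1) : ℝ × ℝ × ℝ) ∈ D3 := by
    change (x2 - x1) * (y2 - y1) = 0
    rcases hc with h | h <;> simp [h]
  have := (hf (x1, y1, z1) _ hD).2 (Set.mem_univ 0) (Set.mem_univ 1) hs ht hst
  simp only [Prod.smul_mk, Prod.mk_add_mk, smul_eq_mul] at this
  have e : ∀ a b : ℝ, a + (s * 0 + t * 1) * (b - a) = s * a + t * b := by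
    intro a b
    have : s = 1 - t := by linarith
    subst this; ring
  rw [e, e, e] at this
  simpa using this

lemma mem_hull_iff {K : Set (ℝ × ℝ × ℝ)} (hK : K.Finite) (hne : K.Nonempty) (A : ℝ × ℝ × ℝ) :
    A ∈ DConvexHull D3 K ↔ ∀ f, DConvex D3 f → (∀ k ∈ K, f k ≤ 0) → f A ≤ 0 := by
  constructor
  · intro h f hf hk
    refine (h f hf).trans (csSup_le (hne.image f) ?_)
    rintro _ ⟨k, hk', rfl⟩
    exact hk k hk'
  · intro h f hf
    have := h (fun v => f v - sSup (f '' K)) ?_ ?_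
    · linarith
    · apply dconv_of
      intro x1 y1 z1 x2 y2 z2 s t hc hs ht hst
      have := dconv_ineq hf x1 y1 z1 x2 y2 z2 s t hc hs ht hst
      have h2 : s = 1 - t := by linarith
      subst h2
      linarith
    · intro k hk
      have := le_csSup (hK.image f).bddAbove (Set.mem_image_of_mem f hk)
      linarith

lemma hull_lam {K : Set (ℝ × ℝ × ℝ)} (hK : K.Finite) (hne : K.Nonempty)
    {x1 y1 z1 x2 y2 z2 s t : ℝ} (h1 : (x1, y1, z1) ∈ DConvexHull D3 K)
    (h2 : (x2, y2, z2) ∈ DConvexHull D3 K)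
    (hc : x1 = x2 ∨ y1 = y2) (hs : 0 ≤ s) (ht : 0 ≤ t) (hst : s + t = 1) :
    (s * x1 + t * x2, s * y1 + t * y2, s * z1 + t * z2) ∈ DConvexHull D3 K := by
  rw [mem_hull_iff hK hne] at *
  intro f hf hk
  have a := dconv_ineq hf x1 y1 z1 x2 y2 z2 s t hc hs ht hst
  have b := h1 f hf hk
  have c := h2 f hf hk
  nlinarith

lemma subset_hull {K : Set (ℝ × ℝ × ℝ)} (hK : K.Finite) (hne : K.Nonempty) {A : ℝ × ℝ × ℝ}
    (h : A ∈ K) : A ∈ DConvexHull D3 K := by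
  rw [mem_hull_iff hK hne]
  intro f _ hk
  exact hk A h

lemma fiber_cont {f : ℝ × ℝ × ℝ → ℝ} (hf : DConvex D3 f) (x y : ℝ) :
    Continuous (fun z : ℝ => f (x, y, z)) := by
  have h : ConvexOn ℝ Set.univ (fun z : ℝ => f (x, y, z)) := by
    have := hf (x, y, 0) (0, 0, 1) (by simp [D3])
    simpa using this
  have := h.continuousOn isOpen_univ
  rwa [← continuousOn_univ]

/-- Separate convexity on the plane. -/
def SepConv (h : ℝ → ℝ → ℝ) : Prop :=
  (∀ x y1 y2 s t : ℝ, 0 ≤ s → 0 ≤ t → s + t = 1 →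
    h x (s * y1 + t * y2) ≤ s * h x y1 + t * h x y2) ∧
  (∀ y x1 x2 s t : ℝ, 0 ≤ s → 0 ≤ t → s + t = 1 →
    h (s * x1 + t * x2) y ≤ s * h x1 y + t * h x2 y)

lemma comb_self {s t : ℝ} (hst : s + t = 1) (x : ℝ) : s * x + t * x = x := by
  rw [← add_mul, hst, one_mul]

lemma dconv_sep {h : ℝ → ℝ → ℝ} (hh : SepConv h) (c : ℝ) :
    DConvex D3 (fun v => c * v.2.2 + h v.1 v.2.1) := by
  apply dconv_of
  intro x1 y1 z1 x2 y2 z2 s t hc hs ht hst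
  rcases hc with rfl | rfl
  · have := hh.1 x1 y1 y2 s t hs ht hst
    simp only [comb_self hst]
    linarith
  · have := hh.2 y1 x1 x2 s t hs ht hst
    simp only [comb_self hst]
    linarith

lemma dconv_max {f g : ℝ × ℝ × ℝ → ℝ} (hf : DConvex D3 f) (hg : DConvex D3 g) :
    DConvex D3 (fun v => max (f v) (g v)) := by
  apply dconv_of
  intro x1 y1 z1 x2 y2 z2 s t hc hs ht hst
  have a := dconv_ineq hf x1 y1 z1 x2 y2 z2 s t hc hs ht hst
  have b := dconv_ineq hg x1 y1 z1 x2 y2 z2 s t hc hs ht hst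
  have := mul_le_mul_of_nonneg_left (le_max_left (f (x1, y1, z1)) (g (x1, y1, z1))) hs
  have := mul_le_mul_of_nonneg_left (le_max_right (f (x1, y1, z1)) (g (x1, y1, z1))) hs
  have := mul_le_mul_of_nonneg_left (le_max_left (f (x2, y2, z2)) (g (x2, y2, z2))) ht
  have := mul_le_mul_of_nonneg_left (le_max_right (f (x2, y2, z2)) (g (x2, y2, z2))) ht
  apply max_le <;> linarith

lemma dconv_abs (M : ℝ) : DConvex D3 (fun v => |v.2.2| - M) := by
  apply dconv_of
  intro x1 y1 z1 x2 y2 z2 s t hc hs ht hst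
  have : |s * z1 + t * z2| ≤ s * |z1| + t * |z2| := by
    refine (abs_add_le _ _).trans ?_
    rw [abs_mul, abs_mul, abs_of_nonneg hs, abs_of_nonneg ht]
  have h2 := comb_self hst M
  simp only
  linarith

lemma exists_bound {K : Set (ℝ × ℝ × ℝ)} (hK : K.Finite) : ∃ M : ℝ, 0 ≤ M ∧ ∀ k ∈ K, |k.2.2| ≤ M := by
  obtain ⟨M, hM⟩ := (hK.image (fun k => |k.2.2|)).bddAbove
  refine ⟨max M 0, le_max_right _ _, fun k hk => ?_⟩
  exact (hM (Set.mem_image_of_mem _ hk)).trans (le_max_left _ _)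

lemma fiber_compact {K : Set (ℝ × ℝ × ℝ)} (hK : K.Finite) (hne : K.Nonempty) (x y : ℝ) :
    IsCompact {z : ℝ | (x, y, z) ∈ DConvexHull D3 K} := by
  obtain ⟨M, hM0, hM⟩ := exists_bound hK
  refine IsCompact.of_isClosed_subset (isCompact_Icc (a := -M) (b := M)) ?_ ?_
  · have : {z : ℝ | (x, y, z) ∈ DConvexHull D3 K} =
        ⋂ (f : ℝ × ℝ × ℝ → ℝ) (_ : DConvex D3 f) (_ : ∀ k ∈ K, f k ≤ 0),
          {z : ℝ | f (x, y, z) ≤ 0} := by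
      ext z
      simp [mem_hull_iff hK hne]
    rw [this]
    refine isClosed_iInter fun f => isClosed_iInter fun hf => isClosed_iInter fun _ => ?_
    exact isClosed_le (fiber_cont hf x y) continuous_const
  · intro z hz
    have := (mem_hull_iff hK hne _).1 hz _ (dconv_abs M) (fun k hk => by linarith [hM k hk])
    simp only at this
    exact abs_le.1 (by linarith)

lemma exists_single {K : Set (ℝ × ℝ × ℝ)} (hK : K.Finite) (hne : K.Nonempty) (x y : ℝ)
    (hxy : ∀ z, (x, y, z) ∉ DConvexHull D3 K) (M : ℝ) :
    ∃ f, DConvex D3 f ∧ (∀ k ∈ K, f k ≤ 0) ∧ ∀ z ∈ Set.Icc (-M) M, 0 < f (x, y, z) := by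
  let ι := {f : ℝ × ℝ × ℝ → ℝ // DConvex D3 f ∧ ∀ k ∈ K, f k ≤ 0}
  have : Nonempty ι := ⟨⟨fun v => 0 * v.2.2 + 0,
    dconv_sep (h := fun _ _ => 0) ⟨by intros; simp, by intros; simp⟩ 0, by simp⟩⟩
  have he : Set.Icc (-M) M ∩ ⋂ f : ι, {z : ℝ | f.1 (x, y, z) ≤ 0} = ∅ := by
    ext z
    simp only [Set.mem_inter_iff, Set.mem_iInter, Set.mem_empty_iff_false, iff_false]
    rintro ⟨_, h⟩
    apply hxy z
    rw [mem_hull_iff hK hne]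
    exact fun f hf hk => h ⟨f, hf, hk⟩
  have hd : Directed (· ⊇ ·) (fun f : ι => {z : ℝ | f.1 (x, y, z) ≤ 0}) := by
    intro f g
    refine ⟨⟨fun v => max (f.1 v) (g.1 v), dconv_max f.2.1 g.2.1,
      fun k hk => max_le (f.2.2 k hk) (g.2.2 k hk)⟩, ?_, ?_⟩
    · intro z hz
      exact (le_max_left _ _).trans (show max (f.1 (x, y, z)) (g.1 (x, y, z)) ≤ 0 from hz)
    · intro z hz
      exact (le_max_right _ _).trans (show max (f.1 (x, y, z)) (g.1 (x, y, z)) ≤ 0 from hz)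
  obtain ⟨f, hf⟩ := (isCompact_Icc (a := -M) (b := M)).elim_directed_family_closed
    (fun f : ι => {z : ℝ | f.1 (x, y, z) ≤ 0})
    (fun f => isClosed_le (fiber_cont f.2.1 x y) continuous_const) he hd
  refine ⟨f.1, f.2.1, f.2.2, fun z hz => ?_⟩
  by_contra hcon
  have : z ∈ Set.Icc (-M) M ∩ {z : ℝ | f.1 (x, y, z) ≤ 0} := ⟨hz, not_lt.1 hcon⟩
  rw [hf] at this
  exact this

lemma exists_sep {K : Set (ℝ × ℝ × ℝ)} (hK : K.Finite) (hne : K.Nonempty) (x y : ℝ)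
    (hxy : ∀ z, (x, y, z) ∉ DConvexHull D3 K) :
    ∃ h, SepConv h ∧ (∀ k ∈ K, h k.1 k.2.1 ≤ 0) ∧ 0 < h x y := by
  obtain ⟨M, hM0, hM⟩ := exists_bound hK
  obtain ⟨f, hf, hfK, hfz⟩ := exists_single hK hne x y hxy (M + 1)
  set F : ℝ × ℝ × ℝ → ℝ := fun v => max (f v) (|v.2.2| - M) with hF
  have hFd : DConvex D3 F := dconv_max hf (dconv_abs M)
  have hlow : ∀ s t z, -M ≤ F (s, t, z) := fun s t z =>
    le_trans (by simp) (le_max_right _ _)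
  have hbdd : ∀ s t, BddBelow (Set.range fun z => F (s, t, z)) := fun s t =>
    ⟨-M, by rintro _ ⟨z, rfl⟩; exact hlow s t z⟩
  have key : ∀ x1 y1 x2 y2 s t : ℝ, (x1 = x2 ∨ y1 = y2) → 0 ≤ s → 0 ≤ t → s + t = 1 →
      (⨅ z, F (s * x1 + t * x2, s * y1 + t * y2, z)) ≤
        s * (⨅ z, F (x1, y1, z)) + t * (⨅ z, F (x2, y2, z)) := by
    intro x1 y1 x2 y2 s t hc hs ht hst
    refine le_of_forall_pos_le_add fun ε hε => ?_
    obtain ⟨z1, h1⟩ := exists_lt_of_ciInf_lt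
      (show (⨅ z, F (x1, y1, z)) < (⨅ z, F (x1, y1, z)) + ε by linarith)
    obtain ⟨z2, h2⟩ := exists_lt_of_ciInf_lt
      (show (⨅ z, F (x2, y2, z)) < (⨅ z, F (x2, y2, z)) + ε by linarith)
    have h3 := dconv_ineq hFd x1 y1 z1 x2 y2 z2 s t hc hs ht hst
    have h4 := ciInf_le (hbdd (s * x1 + t * x2) (s * y1 + t * y2)) (s * z1 + t * z2)
    have h5 := mul_le_mul_of_nonneg_left h1.le hs
    have h6 := mul_le_mul_of_nonneg_left h2.le ht
    have h7 := comb_self hst ε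
    linarith
  refine ⟨fun s t => ⨅ z, F (s, t, z), ⟨?_, ?_⟩, ?_, ?_⟩
  · intro x y1 y2 s t hs ht hst
    have := key x y1 x y2 s t (Or.inl rfl) hs ht hst
    simpa only [comb_self hst] using this
  · intro y x1 x2 s t hs ht hst
    have := key x1 y x2 y s t (Or.inr rfl) hs ht hst
    simpa only [comb_self hst] using this
  · intro k hk
    refine (ciInf_le (hbdd k.1 k.2.1) k.2.2).trans (max_le (hfK k hk) ?_)
    linarith [hM k hk]
  · obtain ⟨z0, hz0, hmin⟩ := (isCompact_Icc (a := -(M + 1)) (b := M + 1)).exists_isMinOn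
      ⟨0, by constructor <;> linarith⟩ (fiber_cont hf x y).continuousOn
    refine lt_of_lt_of_le (lt_min (hfz z0 hz0) one_pos) (le_ciInf fun z => ?_)
    by_cases hz : z ∈ Set.Icc (-(M + 1)) (M + 1)
    · exact (min_le_left _ _).trans ((hmin hz).trans (le_max_left _ _))
    · refine (min_le_right _ _).trans (le_trans ?_ (le_max_right _ _))
      have : M + 1 < |z| := by
        by_contra hcon
        exact hz (abs_le.1 (not_lt.1 hcon))
      simp only
      linarith

/-- Discrete convexity on a finite set of reals. -/
def DC (X : Finset ℝ) (v : ℝ → ℝ) : Prop :=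
  ∀ a ∈ X, ∀ b ∈ X, ∀ c ∈ X, a < b → b < c → (c - a) * v b ≤ (c - b) * v a + (b - a) * v c

/-- `l`, `h` are the neighbours of `s` in `X`. -/
def IsCell (X : Finset ℝ) (s l h : ℝ) : Prop :=
  l ∈ X ∧ h ∈ X ∧ ((l = s ∧ h = s) ∨ (l < s ∧ s < h ∧ ∀ x ∈ X, x ≤ l ∨ h ≤ x) ∨
    (s < l ∧ h = l ∧ ∀ x ∈ X, l ≤ x) ∨ (h < s ∧ l = h ∧ ∀ x ∈ X, x ≤ h))

lemma exists_cell (X : Finset ℝ) (hX : X.Nonempty) (s : ℝ) : ∃ l h, IsCell X s l h := by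
  by_cases hs : s ∈ X
  · exact ⟨s, s, hs, hs, Or.inl ⟨rfl, rfl⟩⟩
  by_cases h1 : (X.filter (· < s)).Nonempty
  · have m1 := Finset.max'_mem _ h1
    set l := (X.filter (· < s)).max' h1 with hl
    rw [Finset.mem_filter] at m1
    have hl' : ∀ x ∈ X, x < s → x ≤ l := fun x hx hxs =>
      Finset.le_max' _ _ (Finset.mem_filter.2 ⟨hx, hxs⟩)
    by_cases h2 : (X.filter (s < ·)).Nonempty
    · have m2 := Finset.min'_mem _ h2
      set h := (X.filter (s < ·)).min' h2 with hh
      rw [Finset.mem_filter] at m2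
      refine ⟨l, h, m1.1, m2.1, Or.inr (Or.inl ⟨m1.2, m2.2, fun x hx => ?_⟩)⟩
      rcases lt_trichotomy x s with h3 | h3 | h3
      · exact Or.inl (hl' x hx h3)
      · exact absurd (h3 ▸ hx) hs
      · exact Or.inr (Finset.min'_le _ _ (Finset.mem_filter.2 ⟨hx, h3⟩))
    · refine ⟨l, l, m1.1, m1.1, Or.inr (Or.inr (Or.inr ⟨m1.2, rfl, fun x hx => ?_⟩))⟩
      rcases lt_trichotomy x s with h3 | h3 | h3
      · exact hl' x hx h3
      · exact absurd (h3 ▸ hx) hs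
      · exact absurd ⟨x, Finset.mem_filter.2 ⟨hx, h3⟩⟩ h2
  · have m := Finset.min'_mem X hX
    refine ⟨X.min' hX, X.min' hX, m, m, Or.inr (Or.inr (Or.inl ⟨?_, rfl, fun x hx => ?_⟩))⟩
    · by_contra hcon
      rcases (not_lt.1 hcon).lt_or_eq with h | h
      · exact h1 ⟨_, Finset.mem_filter.2 ⟨m, h⟩⟩
      · exact hs (h ▸ m)
    · exact Finset.min'_le _ _ hx

/-- Relative position. -/
noncomputable def th (s l h : ℝ) : ℝ := (s - l) / (h - l)

/-- Distance to the cell. -/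
noncomputable def dst (s l h : ℝ) : ℝ := max (max (l - s) (s - h)) 0

lemma th_self (s l : ℝ) : th s l l = 0 := by simp [th]

lemma th_spec {s l h : ℝ} (h1 : l < h) : s = (1 - th s l h) * l + th s l h * h := by
  have : h - l ≠ 0 := by linarith
  unfold th
  field_simp
  ring

lemma cell_th {X : Finset ℝ} {s l r : ℝ} (hc : IsCell X s l r) :
    0 ≤ th s l r ∧ th s l r < 1 ∧ (th s l r = 0 → r = l) := by
  obtain ⟨_, _, h | h | h | h⟩ := hc
  · obtain ⟨rfl, rfl⟩ := h
    simp [th_self]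
  · have : 0 < r - l := by linarith
    unfold th
    refine ⟨div_nonneg (by linarith) this.le, (div_lt_one this).2 (by linarith), fun h0 => ?_⟩
    rcases div_eq_zero_iff.1 h0 with h | h <;> linarith
  · obtain ⟨_, rfl, _⟩ := h
    simp [th_self]
  · obtain ⟨_, rfl, _⟩ := h
    simp [th_self]

lemma dst_nonneg (s l h : ℝ) : 0 ≤ dst s l h := le_max_right _ _

/-- Interpolation, with linear growth outside. -/
noncomputable def itp (M : ℝ) (v : ℝ → ℝ) (s l h : ℝ) : ℝ :=
  (1 - th s l h) * v l + th s l h * v h + M * dst s l h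

lemma itp_self (M : ℝ) (v : ℝ → ℝ) (s : ℝ) : itp M v s s s = v s := by
  simp [itp, th_self, dst]

lemma itp_in (M : ℝ) (v : ℝ → ℝ) {s l h : ℝ} (h1 : l < s) (h2 : s < h) :
    itp M v s l h = (1 - th s l h) * v l + th s l h * v h := by
  have : dst s l h = 0 := by
    unfold dst
    exact max_eq_right (max_le (by linarith) (by linarith))
  simp [itp, this]

lemma itp_left (M : ℝ) (v : ℝ → ℝ) {s l : ℝ} (h1 : s < l) :
    itp M v s l l = v l + M * (l - s) := by
  have : dst s l l = l - s := by
    unfold dst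
    rw [max_eq_left (show s - l ≤ l - s by linarith), max_eq_left (by linarith)]
  simp [itp, this, th_self]

lemma itp_right (M : ℝ) (v : ℝ → ℝ) {s l : ℝ} (h1 : l < s) :
    itp M v s l l = v l + M * (s - l) := by
  have : dst s l l = s - l := by
    unfold dst
    rw [max_eq_right (show l - s ≤ s - l by linarith), max_eq_left (by linarith)]
  simp [itp, this, th_self]

lemma line_below {X : Finset ℝ} {v : ℝ → ℝ} {M α k : ℝ} (hk : |k| ≤ M)
    (hv : ∀ x ∈ X, α + k * x ≤ v x) {s l r : ℝ} (hc : IsCell X s l r) :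
    α + k * s ≤ itp M v s l r := by
  have ⟨hk1, hk2⟩ := abs_le.1 hk
  obtain ⟨t0, t1, _⟩ := cell_th hc
  obtain ⟨hl, hh, h | h | h | h⟩ := hc
  · obtain ⟨rfl, rfl⟩ := h
    rw [itp_self]
    exact hv _ hl
  · rw [itp_in M v h.1 h.2.1]
    have e := th_spec (s := s) (h.1.trans h.2.1)
    have a := mul_le_mul_of_nonneg_left (hv _ hl) (show 0 ≤ 1 - th s l r by linarith)
    have b := mul_le_mul_of_nonneg_left (hv _ hh) t0
    have : α + k * s = (1 - th s l r) * (α + k * l) + th s l r * (α + k * r) := by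
      linear_combination k * e
    linarith
  · obtain ⟨h1, rfl, _⟩ := h
    rw [itp_left M v h1]
    nlinarith [hv _ hl]
  · obtain ⟨h1, rfl, _⟩ := h
    rw [itp_right M v h1]
    nlinarith [hv _ hl]

lemma chord_below {X : Finset ℝ} {v : ℝ → ℝ} (hv : DC X v) {M : ℝ}
    (hM : ∀ a ∈ X, ∀ b ∈ X, |v a - v b| ≤ M * |a - b|) {a b : ℝ} (ha : a ∈ X) (hb : b ∈ X)
    (hab : a < b) (hadj : ∀ x ∈ X, x ≤ a ∨ b ≤ x) :
    ∃ α k, |k| ≤ M ∧ (∀ x ∈ X, α + k * x ≤ v x) ∧ α + k * a = v a ∧ α + k * b = v b := by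
  have hpos : 0 < b - a := by linarith
  set k := (v b - v a) / (b - a) with hk
  have hkm : k * (b - a) = v b - v a := by
    rw [hk]; field_simp
  refine ⟨v a - k * a, k, ?_, ?_, by ring, by linarith⟩
  · have := hM b hb a ha
    rw [abs_of_pos hpos] at this
    rw [hk, abs_div, abs_of_pos hpos]
    rwa [div_le_iff₀ hpos]
  · intro x hx
    rcases hadj x hx with h | h
    · rcases h.lt_or_eq with h | rfl
      · have := hv x hx a ha b hb h hab
        have h2 : (b - a) * (v a - k * a + k * x) ≤ (b - a) * v x := by
          have : (b - a) * (v a - k * a + k * x) = (b - a) * v a + (x - a) * (v b - v a) := by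
            rw [← hkm]; ring
          linarith
        exact le_of_mul_le_mul_left h2 hpos
      · linarith
    · rcases h.lt_or_eq with h | rfl
      · have := hv a ha b hb x hx hab h
        have h2 : (b - a) * (v a - k * a + k * x) ≤ (b - a) * v x := by
          have : (b - a) * (v a - k * a + k * x) = (b - a) * v a + (x - a) * (v b - v a) := by
            rw [← hkm]; ring
          linarith
        exact le_of_mul_le_mul_left h2 hpos
      · linarith

lemma support {X : Finset ℝ} {v : ℝ → ℝ} (hv : DC X v) {M : ℝ} (hM0 : 0 ≤ M)
    (hM : ∀ a ∈ X, ∀ b ∈ X, |v a - v b| ≤ M * |a - b|) {s l r : ℝ} (hc : IsCell X s l r) :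
    ∃ α k, |k| ≤ M ∧ (∀ x ∈ X, α + k * x ≤ v x) ∧ α + k * s = itp M v s l r := by
  have top : ∀ m ∈ X, (∀ x ∈ X, x ≤ m) → ∀ x ∈ X, (v m - M * m) + M * x ≤ v x := by
    intro m hm hmax x hx
    have h1 := (abs_le.1 (hM m hm x hx)).2
    rw [abs_of_nonneg (by linarith [hmax x hx])] at h1
    linarith
  obtain ⟨hl, hh, h | h | h | h⟩ := hc
  · obtain ⟨h, h'⟩ := h
    rw [h] at hl
    rw [h, h', itp_self]
    by_cases hn : (X.filter (s < ·)).Nonempty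
    · have m2 := Finset.min'_mem _ hn
      set b := (X.filter (s < ·)).min' hn with hb
      rw [Finset.mem_filter] at m2
      obtain ⟨α, k, h1, h2, h3, _⟩ := chord_below hv hM hl m2.1 m2.2 (fun x hx => by
        rcases le_or_gt x s with h | h
        · exact Or.inl h
        · exact Or.inr (Finset.min'_le _ _ (Finset.mem_filter.2 ⟨hx, h⟩)))
      exact ⟨α, k, h1, h2, h3⟩
    · refine ⟨v s - M * s, M, (abs_of_nonneg hM0).le, top s hl fun x hx => ?_, by ring⟩
      by_contra hcon
      exact hn ⟨x, Finset.mem_filter.2 ⟨hx, not_le.1 hcon⟩⟩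
  · obtain ⟨α, k, h1, h2, h3, h4⟩ := chord_below hv hM hl hh (h.1.trans h.2.1) h.2.2
    refine ⟨α, k, h1, h2, ?_⟩
    rw [itp_in M v h.1 h.2.1, ← h3, ← h4]
    have e := th_spec (s := s) (h.1.trans h.2.1)
    linear_combination k * e
  · obtain ⟨h1, rfl, h2⟩ := h
    rw [itp_left M v h1]
    refine ⟨v r + M * r, -M, by rw [abs_neg, abs_of_nonneg hM0], fun x hx => ?_, by ring⟩
    have h3 := (abs_le.1 (hM r hl x hx)).2
    rw [abs_of_nonpos (by linarith [h2 x hx])] at h3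
    linarith
  · obtain ⟨h1, rfl, h2⟩ := h
    rw [itp_right M v h1]
    exact ⟨v l - M * l, M, (abs_of_nonneg hM0).le, top l hl h2, by ring⟩

lemma itp_convex {X : Finset ℝ} {lo hi : ℝ → ℝ} (hcell : ∀ s, IsCell X s (lo s) (hi s))
    {v : ℝ → ℝ} (hv : DC X v) {M : ℝ} (hM0 : 0 ≤ M)
    (hM : ∀ a ∈ X, ∀ b ∈ X, |v a - v b| ≤ M * |a - b|) (p q s t : ℝ) (hs : 0 ≤ s) (ht : 0 ≤ t)
    (hst : s + t = 1) :
    itp M v (s * p + t * q) (lo (s * p + t * q)) (hi (s * p + t * q)) ≤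
      s * itp M v p (lo p) (hi p) + t * itp M v q (lo q) (hi q) := by
  obtain ⟨α, k, h1, h2, h3⟩ := support hv hM0 hM (hcell (s * p + t * q))
  rw [← h3]
  have a := mul_le_mul_of_nonneg_left (line_below h1 h2 (hcell p)) hs
  have b := mul_le_mul_of_nonneg_left (line_below h1 h2 (hcell q)) ht
  have c := comb_self hst α
  linarith

lemma exists_lip (X Y : Finset ℝ) (w : ℝ → ℝ → ℝ) :
    ∃ M : ℝ, 1 ≤ M ∧ (∀ y ∈ Y, ∀ a ∈ X, ∀ b ∈ X, |w a y - w b y| ≤ M * |a - b|) ∧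
      (∀ x ∈ X, ∀ a ∈ Y, ∀ b ∈ Y, |w x a - w x b| ≤ M * |a - b|) := by
  have aux : ∀ (g : ℝ → ℝ) (a b : ℝ), ∀ᶠ M : ℝ in Filter.atTop, |g a - g b| ≤ M * |a - b| := by
    intro g a b
    by_cases h : a = b
    · subst h; simp
    · have : 0 < |a - b| := abs_pos.2 (sub_ne_zero.2 h)
      filter_upwards [Filter.eventually_ge_atTop (|g a - g b| / |a - b|)] with M hM
      rwa [div_le_iff₀ this] at hM
  have h1 : ∀ᶠ M : ℝ in Filter.atTop, ∀ y ∈ Y, ∀ a ∈ X, ∀ b ∈ X, |w a y - w b y| ≤ M * |a - b| := by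
    simp only [Filter.eventually_all_finset]
    exact fun y _ a _ b _ => aux (fun x => w x y) a b
  have h2 : ∀ᶠ M : ℝ in Filter.atTop, ∀ x ∈ X, ∀ a ∈ Y, ∀ b ∈ Y, |w x a - w x b| ≤ M * |a - b| := by
    simp only [Filter.eventually_all_finset]
    exact fun x _ a _ b _ => aux (fun y => w x y) a b
  obtain ⟨M, hM1, hM2, hM3⟩ := ((Filter.eventually_ge_atTop (1 : ℝ)).and (h1.and h2)).exists
  exact ⟨M, hM1, hM2, hM3⟩

/-- Bilinear interpolation. -/
noncomputable def bil (w : ℝ → ℝ → ℝ) (a b c d x y : ℝ) : ℝ :=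
  (1 - th x a b) * ((1 - th y c d) * w a c + th y c d * w a d) +
    th x a b * ((1 - th y c d) * w b c + th y c d * w b d)

lemma DC_comb {X : Finset ℝ} {v v' : ℝ → ℝ} (h : DC X v) (h' : DC X v') {s t : ℝ} (hs : 0 ≤ s)
    (ht : 0 ≤ t) : DC X (fun x => s * v x + t * v' x) := by
  intro a ha b hb c hc hab hbc
  have := mul_le_mul_of_nonneg_left (h a ha b hb c hc hab hbc) hs
  have := mul_le_mul_of_nonneg_left (h' a ha b hb c hc hab hbc) ht
  simp only
  linarith

lemma lip_comb {X : Finset ℝ} {v v' : ℝ → ℝ} {M : ℝ}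
    (h : ∀ a ∈ X, ∀ b ∈ X, |v a - v b| ≤ M * |a - b|)
    (h' : ∀ a ∈ X, ∀ b ∈ X, |v' a - v' b| ≤ M * |a - b|) {s t : ℝ} (hs : 0 ≤ s)
    (ht : 0 ≤ t) (hst : s + t = 1) : ∀ a ∈ X, ∀ b ∈ X,
      |(fun x => s * v x + t * v' x) a - (fun x => s * v x + t * v' x) b| ≤ M * |a - b| := by
  intro a ha b hb
  have h1 := abs_le.1 (h a ha b hb)
  have h2 := abs_le.1 (h' a ha b hb)
  have h3 := comb_self hst (M * |a - b|)
  simp only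
  apply abs_le.2
  constructor <;> nlinarith

lemma interp2 (X Y : Finset ℝ) {lo hi lo' hi' : ℝ → ℝ} (hX : ∀ s, IsCell X s (lo s) (hi s))
    (hY : ∀ s, IsCell Y s (lo' s) (hi' s)) (w : ℝ → ℝ → ℝ)
    (h1 : ∀ y ∈ Y, DC X (fun x => w x y)) (h2 : ∀ x ∈ X, DC Y (fun y => w x y)) :
    ∃ M : ℝ, 1 ≤ M ∧ SepConv (fun x y => bil w (lo x) (hi x) (lo' y) (hi' y) x y +
      M * (dst x (lo x) (hi x) + dst y (lo' y) (hi' y))) := by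
  obtain ⟨M, hM1, hMX, hMY⟩ := exists_lip X Y w
  refine ⟨M, hM1, ?_, ?_⟩
  · intro x y1 y2 s t hs ht hst
    obtain ⟨t0, t1, _⟩ := cell_th (hX x)
    have hl := (hX x).1
    have hh := (hX x).2.1
    have t1' : 0 ≤ 1 - th x (lo x) (hi x) := by linarith
    have := itp_convex hY (DC_comb (h2 _ hl) (h2 _ hh) t1' t0) (by linarith)
      (lip_comb (hMY _ hl) (hMY _ hh) t1' t0 (by ring)) y1 y2 s t hs ht hst
    unfold itp at this
    unfold bil
    have c := comb_self hst (M * dst x (lo x) (hi x))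
    linarith
  · intro y y1 y2 s t hs ht hst
    obtain ⟨t0, t1, _⟩ := cell_th (hY y)
    have hl := (hY y).1
    have hh := (hY y).2.1
    have t1' : 0 ≤ 1 - th y (lo' y) (hi' y) := by linarith
    have := itp_convex hX (DC_comb (h1 _ hl) (h1 _ hh) t1' t0) (by linarith)
      (lip_comb (hMX _ hl) (hMX _ hh) t1' t0 (by ring)) y1 y2 s t hs ht hst
    unfold itp at this
    unfold bil
    have c := comb_self hst (M * dst y (lo' y) (hi' y))
    linarith

/-- The projection of the hull. -/
def Sp (K : Set (ℝ × ℝ × ℝ)) (x y : ℝ) : Prop := ∃ z, (x, y, z) ∈ DConvexHull D3 K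

lemma sep_le {K : Set (ℝ × ℝ × ℝ)} (hK : K.Finite) (hne : K.Nonempty) {h : ℝ → ℝ → ℝ}
    (hh : SepConv h) (hk : ∀ k ∈ K, h k.1 k.2.1 ≤ 0) {x y : ℝ} (hS : Sp K x y) : h x y ≤ 0 := by
  obtain ⟨z, hz⟩ := hS
  have := (mem_hull_iff hK hne _).1 hz _ (dconv_sep hh 0) (fun k hk' => by simpa using hk k hk')
  simpa using this

lemma conv_triple {g : ℝ → ℝ} (hg : ∀ p q s t : ℝ, 0 ≤ s → 0 ≤ t → s + t = 1 →
      g (s * p + t * q) ≤ s * g p + t * g q) {a b c : ℝ} (hab : a < b) (hbc : b < c) :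
    (c - a) * g b ≤ (c - b) * g a + (b - a) * g c := by
  have hca : 0 < c - a := by linarith
  have := hg a c ((c - b) / (c - a)) ((b - a) / (c - a)) (div_nonneg (by linarith) hca.le)
    (div_nonneg (by linarith) hca.le) (by field_simp; ring)
  have e : (c - b) / (c - a) * a + (b - a) / (c - a) * c = b := by field_simp; ring
  rw [e] at this
  have h2 := mul_le_mul_of_nonneg_left this hca.le
  have e2 : (c - a) * ((c - b) / (c - a) * g a + (b - a) / (c - a) * g c) =
    (c - b) * g a + (b - a) * g c := by field_simp
  linarith

lemma SepConv.max0 {h : ℝ → ℝ → ℝ} (hh : SepConv h) : SepConv (fun x y => max 0 (h x y)) := by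
  have aux : ∀ p q r s t : ℝ, 0 ≤ s → 0 ≤ t → r ≤ s * p + t * q →
      max 0 r ≤ s * max 0 p + t * max 0 q := by
    intro p q r s t hs ht h
    have h1 := mul_le_mul_of_nonneg_left (le_max_right 0 p) hs
    have h2 := mul_le_mul_of_nonneg_left (le_max_right 0 q) ht
    have h3 := mul_nonneg hs (le_max_left 0 p)
    have h4 := mul_nonneg ht (le_max_left 0 q)
    apply max_le <;> linarith
  exact ⟨fun x y1 y2 s t hs ht hst => aux _ _ _ s t hs ht (hh.1 x y1 y2 s t hs ht hst),
    fun x y1 y2 s t hs ht hst => aux _ _ _ s t hs ht (hh.2 x y1 y2 s t hs ht hst)⟩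

lemma sq_conv {p q s t : ℝ} (hs : 0 ≤ s) (ht : 0 ≤ t) (hst : s + t = 1) :
    (s * p + t * q) ^ 2 ≤ s * p ^ 2 + t * q ^ 2 := by
  have : s = 1 - t := by linarith
  subst this
  nlinarith [mul_nonneg (mul_nonneg hs ht) (sq_nonneg (p - q))]

lemma SepConv.addq {h : ℝ → ℝ → ℝ} (hh : SepConv h) {ε Q : ℝ} (hε : 0 ≤ ε) :
    SepConv (fun x y => h x y + ε * (x ^ 2 + y ^ 2 - Q)) := by
  constructor
  · intro x y1 y2 s t hs ht hst
    have h1 := hh.1 x y1 y2 s t hs ht hst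
    have h2 := mul_le_mul_of_nonneg_left (sq_conv (p := y1) (q := y2) hs ht hst) hε
    have h3 := comb_self hst (ε * (x ^ 2 - Q))
    simp only
    linarith
  · intro y y1 y2 s t hs ht hst
    have h1 := hh.2 y y1 y2 s t hs ht hst
    have h2 := mul_le_mul_of_nonneg_left (sq_conv (p := y1) (q := y2) hs ht hst) hε
    have h3 := comb_self hst (ε * (y ^ 2 - Q))
    simp only
    linarith

lemma pen1 {K : Set (ℝ × ℝ × ℝ)} (hK : K.Finite) (hne : K.Nonempty) (X Y : Finset ℝ)
    {x0 y0 : ℝ} (hxy : ¬ Sp K x0 y0) :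
    ∃ h : ℝ → ℝ → ℝ, SepConv h ∧ (∀ x y, 0 ≤ h x y) ∧
      (∀ x ∈ X, ∀ y ∈ Y, Sp K x y → h x y = 0) ∧ 0 < h x0 y0 ∧
      (∀ a c, a < x0 → x0 < c → (c - a) * h x0 y0 < (c - x0) * h a y0 + (x0 - a) * h c y0) ∧
      (∀ a c, a < y0 → y0 < c → (c - a) * h x0 y0 < (c - y0) * h x0 a + (y0 - a) * h x0 c) := by
  obtain ⟨h, hh, hhK, hpos⟩ := exists_sep hK hne x0 y0 (fun z hz => hxy ⟨z, hz⟩)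
  obtain ⟨Q, hQ0, hQ⟩ : ∃ Q : ℝ, 0 ≤ Q ∧ ∀ x ∈ X, ∀ y ∈ Y, x ^ 2 + y ^ 2 ≤ Q := by
    have h1 : ∀ᶠ Q : ℝ in Filter.atTop, ∀ x ∈ X, ∀ y ∈ Y, x ^ 2 + y ^ 2 ≤ Q := by
      simp only [Filter.eventually_all_finset]
      exact fun x _ y _ => Filter.eventually_ge_atTop _
    obtain ⟨Q, h2, h3⟩ := ((Filter.eventually_ge_atTop (0 : ℝ)).and h1).exists
    exact ⟨Q, h2, h3⟩
  set ε := h x0 y0 / (Q + 1) with hεd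
  have hε : 0 < ε := div_pos hpos (by linarith)
  have hεQ : ε * (Q + 1) = h x0 y0 := by rw [hεd]; field_simp
  have hG := hh.addq (Q := Q) hε.le
  have hval : 0 < h x0 y0 + ε * (x0 ^ 2 + y0 ^ 2 - Q) := by
    nlinarith [sq_nonneg x0, sq_nonneg y0]
  refine ⟨_, hG.max0, fun x y => le_max_left _ _, ?_, lt_max_of_lt_right hval, ?_, ?_⟩
  · intro x hx y hy hS
    have h1 := sep_le hK hne hh hhK hS
    have h2 := hQ x hx y hy
    apply max_eq_left
    nlinarith
  · intro a c ha hc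
    rw [max_eq_right hval.le]
    have h1 := conv_triple (g := fun x => h x y0) (fun p q s t => hh.2 y0 p q s t) ha hc
    have h2 := mul_le_mul_of_nonneg_left
      (le_max_right 0 (h a y0 + ε * (a ^ 2 + y0 ^ 2 - Q))) (show 0 ≤ c - x0 by linarith)
    have h3 := mul_le_mul_of_nonneg_left
      (le_max_right 0 (h c y0 + ε * (c ^ 2 + y0 ^ 2 - Q))) (show 0 ≤ x0 - a by linarith)
    have h4 : 0 < ε * ((c - a) * ((c - x0) * (x0 - a))) :=
      mul_pos hε (mul_pos (by linarith) (mul_pos (by linarith) (by linarith)))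
    nlinarith
  · intro a c ha hc
    rw [max_eq_right hval.le]
    have h1 := conv_triple (g := fun y => h x0 y) (fun p q s t => hh.1 x0 p q s t) ha hc
    have h2 := mul_le_mul_of_nonneg_left
      (le_max_right 0 (h x0 a + ε * (x0 ^ 2 + a ^ 2 - Q))) (show 0 ≤ c - y0 by linarith)
    have h3 := mul_le_mul_of_nonneg_left
      (le_max_right 0 (h x0 c + ε * (x0 ^ 2 + c ^ 2 - Q))) (show 0 ≤ y0 - a by linarith)
    have h4 : 0 < ε * ((c - a) * ((c - y0) * (y0 - a))) :=
      mul_pos hε (mul_pos (by linarith) (mul_pos (by linarith) (by linarith)))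
    nlinarith

lemma pen {K : Set (ℝ × ℝ × ℝ)} (hK : K.Finite) (hne : K.Nonempty) (X Y : Finset ℝ) :
    ∃ h : ℝ → ℝ → ℝ, (∀ x y, 0 ≤ h x y) ∧
      (∀ x ∈ X, ∀ y ∈ Y, Sp K x y → h x y = 0) ∧
      (∀ x ∈ X, ∀ y ∈ Y, ¬ Sp K x y → 0 < h x y) ∧
      (∀ y ∈ Y, ∀ a ∈ X, ∀ b ∈ X, ∀ c ∈ X, a < b → b < c → ¬ (Sp K a y ∧ Sp K b y ∧ Sp K c y) →
        (c - a) * h b y < (c - b) * h a y + (b - a) * h c y) ∧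
      (∀ x ∈ X, ∀ a ∈ Y, ∀ b ∈ Y, ∀ c ∈ Y, a < b → b < c → ¬ (Sp K x a ∧ Sp K x b ∧ Sp K x c) →
        (c - a) * h x b < (c - b) * h x a + (b - a) * h x c) := by
  classical
  have hex : ∀ g : ℝ × ℝ, ∃ h : ℝ → ℝ → ℝ, ¬ Sp K g.1 g.2 → (SepConv h ∧ (∀ x y, 0 ≤ h x y) ∧
      (∀ x ∈ X, ∀ y ∈ Y, Sp K x y → h x y = 0) ∧ 0 < h g.1 g.2 ∧
      (∀ a c, a < g.1 → g.1 < c →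
        (c - a) * h g.1 g.2 < (c - g.1) * h a g.2 + (g.1 - a) * h c g.2) ∧
      (∀ a c, a < g.2 → g.2 < c →
        (c - a) * h g.1 g.2 < (c - g.2) * h g.1 a + (g.2 - a) * h g.1 c)) := by
    intro g
    by_cases hg : Sp K g.1 g.2
    · exact ⟨fun _ _ => 0, fun h => absurd hg h⟩
    · obtain ⟨h, hh⟩ := pen1 hK hne X Y hg
      exact ⟨h, fun _ => hh⟩
  choose H hH using hex
  set G := (X ×ˢ Y).filter (fun g => ¬ Sp K g.1 g.2) with hG
  have hGm : ∀ g ∈ G, ¬ Sp K g.1 g.2 := fun g hg => (Finset.mem_filter.1 hg).2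
  have hGi : ∀ x ∈ X, ∀ y ∈ Y, ¬ Sp K x y → (x, y) ∈ G := fun x hx y hy h =>
    Finset.mem_filter.2 ⟨Finset.mem_product.2 ⟨hx, hy⟩, h⟩
  have h0 : ∀ x y, 0 ≤ ∑ g ∈ G, H g x y := fun x y =>
    Finset.sum_nonneg fun g hg => (hH g (hGm g hg)).2.1 x y
  have hz : ∀ x ∈ X, ∀ y ∈ Y, Sp K x y → ∑ g ∈ G, H g x y = 0 := fun x hx y hy hS =>
    Finset.sum_eq_zero fun g hg => (hH g (hGm g hg)).2.2.1 x hx y hy hS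
  have hp : ∀ x ∈ X, ∀ y ∈ Y, ¬ Sp K x y → 0 < ∑ g ∈ G, H g x y := fun x hx y hy hS =>
    Finset.sum_pos' (fun g hg => (hH g (hGm g hg)).2.1 x y)
      ⟨(x, y), hGi x hx y hy hS, (hH (x, y) hS).2.2.2.1⟩
  refine ⟨fun x y => ∑ g ∈ G, H g x y, h0, hz, hp, ?_, ?_⟩
  · intro y hy a ha b hb c hc hab hbc hn
    simp only
    by_cases hSb : Sp K b y
    · rw [hz b hb y hy hSb, mul_zero]
      have h1 : 0 < c - b := by linarith
      have h2 : 0 < b - a := by linarith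
      by_cases hSa : Sp K a y
      · have hSc : ¬ Sp K c y := fun h => hn ⟨hSa, hSb, h⟩
        have := mul_pos h2 (hp c hc y hy hSc)
        have := mul_nonneg h1.le (h0 a y)
        linarith
      · have := mul_pos h1 (hp a ha y hy hSa)
        have := mul_nonneg h2.le (h0 c y)
        linarith
    · rw [Finset.mul_sum, Finset.mul_sum, Finset.mul_sum, ← Finset.sum_add_distrib]
      refine Finset.sum_lt_sum (fun g hg => ?_) ⟨(b, y), hGi b hb y hy hSb, ?_⟩
      · exact conv_triple (g := fun x => H g x y) (fun p q s t => (hH g (hGm g hg)).1.2 y p q s t) hab hbc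
      · exact (hH (b, y) hSb).2.2.2.2.1 a c hab hbc
  · intro x hx a ha b hb c hc hab hbc hn
    simp only
    by_cases hSb : Sp K x b
    · rw [hz x hx b hb hSb, mul_zero]
      have h1 : 0 < c - b := by linarith
      have h2 : 0 < b - a := by linarith
      by_cases hSa : Sp K x a
      · have hSc : ¬ Sp K x c := fun h => hn ⟨hSa, hSb, h⟩
        have := mul_pos h2 (hp x hx c hc hSc)
        have := mul_nonneg h1.le (h0 x a)
        linarith
      · have := mul_pos h1 (hp x hx a ha hSa)
        have := mul_nonneg h2.le (h0 x c)
        linarith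
    · rw [Finset.mul_sum, Finset.mul_sum, Finset.mul_sum, ← Finset.sum_add_distrib]
      refine Finset.sum_lt_sum (fun g hg => ?_) ⟨(x, b), hGi x hx b hb hSb, ?_⟩
      · exact conv_triple (g := fun y => H g x y) (fun p q s t => (hH g (hGm g hg)).1.1 x p q s t) hab hbc
      · exact (hH (x, b) hSb).2.2.2.2.2 a c hab hbc

/-- Discrete separate convexity within the projected hull. -/
def SDC (K : Set (ℝ × ℝ × ℝ)) (V : ℝ → ℝ → ℝ) : Prop :=
  (∀ y a b c, a < b → b < c → Sp K a y → Sp K b y → Sp K c y →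
    (c - a) * V b y ≤ (c - b) * V a y + (b - a) * V c y) ∧
  (∀ x a b c, a < b → b < c → Sp K x a → Sp K x b → Sp K x c →
    (c - a) * V x b ≤ (c - b) * V x a + (b - a) * V x c)

lemma extend {K : Set (ℝ × ℝ × ℝ)} (hK : K.Finite) (hne : K.Nonempty) (X Y : Finset ℝ)
    {V : ℝ → ℝ → ℝ} (hV : SDC K V) :
    ∃ h : ℝ → ℝ → ℝ, (∀ x y, 0 ≤ h x y) ∧ (∀ x ∈ X, ∀ y ∈ Y, Sp K x y → h x y = 0) ∧
      (∀ x ∈ X, ∀ y ∈ Y, ¬ Sp K x y → 0 < h x y) ∧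
      (∀ y ∈ Y, DC X (fun x => V x y + h x y)) ∧ (∀ x ∈ X, DC Y (fun y => V x y + h x y)) := by
  obtain ⟨h, h0, hz, hp, h1, h2⟩ := pen hK hne X Y
  have aux : ∀ p q r s : ℝ, r < s → ∀ᶠ C : ℝ in Filter.atTop, p + C * r ≤ q + C * s := by
    intro p q r s hrs
    have : 0 < s - r := by linarith
    filter_upwards [Filter.eventually_ge_atTop ((p - q) / (s - r))] with C hC
    rw [div_le_iff₀ this] at hC
    linarith
  have e1 : ∀ᶠ C : ℝ in Filter.atTop, ∀ y ∈ Y, DC X (fun x => V x y + C * h x y) := by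
    unfold DC
    simp only [Filter.eventually_all_finset, Filter.eventually_all]
    intro y hy a ha b hb c hc hab hbc
    by_cases hS : Sp K a y ∧ Sp K b y ∧ Sp K c y
    · refine Filter.Eventually.of_forall fun C => ?_
      rw [hz a ha y hy hS.1, hz b hb y hy hS.2.1, hz c hc y hy hS.2.2]
      have := hV.1 y a b c hab hbc hS.1 hS.2.1 hS.2.2
      linarith
    · filter_upwards [aux ((c - a) * V b y) ((c - b) * V a y + (b - a) * V c y) _ _
        (h1 y hy a ha b hb c hc hab hbc hS)] with C hC
      linarith
  have e2 : ∀ᶠ C : ℝ in Filter.atTop, ∀ x ∈ X, DC Y (fun y => V x y + C * h x y) := by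
    unfold DC
    simp only [Filter.eventually_all_finset, Filter.eventually_all]
    intro x hx a ha b hb c hc hab hbc
    by_cases hS : Sp K x a ∧ Sp K x b ∧ Sp K x c
    · refine Filter.Eventually.of_forall fun C => ?_
      rw [hz x hx a ha hS.1, hz x hx b hb hS.2.1, hz x hx c hc hS.2.2]
      have := hV.2 x a b c hab hbc hS.1 hS.2.1 hS.2.2
      linarith
    · filter_upwards [aux ((c - a) * V x b) ((c - b) * V x a + (b - a) * V x c) _ _
        (h2 x hx a ha b hb c hc hab hbc hS)] with C hC
      linarith
  obtain ⟨C, hC0, hC1, hC2⟩ := ((Filter.eventually_gt_atTop (0 : ℝ)).and (e1.and e2)).exists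
  refine ⟨fun x y => C * h x y, fun x y => mul_nonneg hC0.le (h0 x y), ?_, ?_, hC1, hC2⟩
  · intro x hx y hy hS
    simp [hz x hx y hy hS]
  · intro x hx y hy hS
    exact mul_pos hC0 (hp x hx y hy hS)

lemma cell_self {X : Finset ℝ} {s l h : ℝ} (hs : s ∈ X) (hc : IsCell X s l h) : l = s ∧ h = s := by
  obtain ⟨_, _, h | h | h | h⟩ := hc
  · exact h
  · rcases h.2.2 s hs with h' | h' <;> linarith
  · linarith [h.2.2 s hs]
  · linarith [h.2.2 s hs]

lemma bil_self (w : ℝ → ℝ → ℝ) (x y : ℝ) : bil w x x y y x y = w x y := by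
  simp [bil, th_self]

lemma key {K : Set (ℝ × ℝ × ℝ)} (hK : K.Finite) (hne : K.Nonempty) (X Y : Finset ℝ)
    (hKX : ∀ k ∈ K, k.1 ∈ X) (hKY : ∀ k ∈ K, k.2.1 ∈ Y)
    {lo hi lo' hi' : ℝ → ℝ} (hX : ∀ s, IsCell X s (lo s) (hi s))
    (hY : ∀ s, IsCell Y s (lo' s) (hi' s)) {V : ℝ → ℝ → ℝ} (hV : SDC K V) (σ : ℝ)
    (hVK : ∀ k ∈ K, σ * k.2.2 + V k.1 k.2.1 ≤ 0) :
    ∃ h : ℝ → ℝ → ℝ, (∀ x y, 0 ≤ h x y) ∧ (∀ x ∈ X, ∀ y ∈ Y, Sp K x y → h x y = 0) ∧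
      (∀ x ∈ X, ∀ y ∈ Y, ¬ Sp K x y → 0 < h x y) ∧
      ∀ x y z, (x, y, z) ∈ DConvexHull D3 K →
        σ * z + bil (fun x y => V x y + h x y) (lo x) (hi x) (lo' y) (hi' y) x y
          + (dst x (lo x) (hi x) + dst y (lo' y) (hi' y)) ≤ 0 := by
  obtain ⟨h, h0, hz, hp, h1, h2⟩ := extend hK hne X Y hV
  obtain ⟨M, hM, hE⟩ := interp2 X Y hX hY _ h1 h2
  refine ⟨h, h0, hz, hp, fun x y z hA => ?_⟩
  have := (mem_hull_iff hK hne _).1 hA _ (dconv_sep hE σ) ?_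
  · simp only at this
    have d0 : 0 ≤ dst x (lo x) (hi x) + dst y (lo' y) (hi' y) :=
      add_nonneg (dst_nonneg _ _ _) (dst_nonneg _ _ _)
    nlinarith
  · intro k hk
    obtain ⟨e1, e2⟩ := cell_self (hKX k hk) (hX k.1)
    obtain ⟨e3, e4⟩ := cell_self (hKY k hk) (hY k.2.1)
    rw [e1, e2, e3, e4, bil_self, hz _ (hKX k hk) _ (hKY k hk) ⟨k.2.2, subset_hull hK hne hk⟩]
    have := hVK k hk
    simp [dst]
    linarith

lemma corners {K : Set (ℝ × ℝ × ℝ)} (hK : K.Finite) (hne : K.Nonempty) (X Y : Finset ℝ)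
    (hKX : ∀ k ∈ K, k.1 ∈ X) (hKY : ∀ k ∈ K, k.2.1 ∈ Y)
    {lo hi lo' hi' : ℝ → ℝ} (hX : ∀ s, IsCell X s (lo s) (hi s))
    (hY : ∀ s, IsCell Y s (lo' s) (hi' s)) {x y z : ℝ} (hA : (x, y, z) ∈ DConvexHull D3 K) :
    (Sp K (lo x) (lo' y) ∧ Sp K (hi x) (lo' y) ∧ Sp K (lo x) (hi' y) ∧ Sp K (hi x) (hi' y)) ∧
      dst x (lo x) (hi x) = 0 ∧ dst y (lo' y) (hi' y) = 0 := by
  obtain ⟨h, h0, hz, hp, hb⟩ := key hK hne X Y hKX hKY hX hY (V := fun _ _ => 0)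
    ⟨by intros; simp, by intros; simp⟩ 0 (by simp)
  have hb := hb x y z hA
  have d1 := dst_nonneg x (lo x) (hi x)
  have d2 := dst_nonneg y (lo' y) (hi' y)
  simp only [bil, zero_mul, zero_add] at hb
  obtain ⟨t0, t1, t2⟩ := cell_th (hX x)
  obtain ⟨u0, u1, u2⟩ := cell_th (hY y)
  have hx1 := (hX x).1
  have hx2 := (hX x).2.1
  have hy1 := (hY y).1
  have hy2 := (hY y).2.1
  generalize lo x = a at *
  generalize hi x = b at *
  generalize lo' y = c at *
  generalize hi' y = d at *
  generalize th x a b = t at *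
  generalize th y c d = u at *
  have t1' : 0 < 1 - t := by linarith
  have u1' : 0 < 1 - u := by linarith
  have n1 := mul_nonneg t1'.le (mul_nonneg u1'.le (h0 a c))
  have n2 := mul_nonneg t1'.le (mul_nonneg u0 (h0 a d))
  have n3 := mul_nonneg t0 (mul_nonneg u1'.le (h0 b c))
  have n4 := mul_nonneg t0 (mul_nonneg u0 (h0 b d))
  have s1 : Sp K a c := by
    by_contra hcon
    have := mul_pos t1' (mul_pos u1' (hp a hx1 c hy1 hcon))
    linarith
  have s2 : Sp K a d := by
    rcases u0.eq_or_lt with hu | hu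
    · rw [u2 hu.symm]; exact s1
    by_contra hcon
    have := mul_pos t1' (mul_pos hu (hp a hx1 d hy2 hcon))
    linarith
  have s3 : Sp K b c := by
    rcases t0.eq_or_lt with ht | ht
    · rw [t2 ht.symm]; exact s1
    by_contra hcon
    have := mul_pos ht (mul_pos u1' (hp b hx2 c hy1 hcon))
    linarith
  have s4 : Sp K b d := by
    rcases t0.eq_or_lt with ht | ht
    · rw [t2 ht.symm]; exact s2
    rcases u0.eq_or_lt with hu | hu
    · rw [u2 hu.symm]; exact s3
    by_contra hcon
    have := mul_pos ht (mul_pos hu (hp b hx2 d hy2 hcon))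
    linarith
  exact ⟨⟨s1, s3, s2, s4⟩, by linarith, by linarith⟩

lemma bound {K : Set (ℝ × ℝ × ℝ)} (hK : K.Finite) (hne : K.Nonempty) (X Y : Finset ℝ)
    (hKX : ∀ k ∈ K, k.1 ∈ X) (hKY : ∀ k ∈ K, k.2.1 ∈ Y)
    {lo hi lo' hi' : ℝ → ℝ} (hX : ∀ s, IsCell X s (lo s) (hi s))
    (hY : ∀ s, IsCell Y s (lo' s) (hi' s)) {V : ℝ → ℝ → ℝ} (hV : SDC K V) (σ : ℝ)
    (hVK : ∀ k ∈ K, σ * k.2.2 + V k.1 k.2.1 ≤ 0) {x y z : ℝ}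
    (hA : (x, y, z) ∈ DConvexHull D3 K) :
    σ * z + bil V (lo x) (hi x) (lo' y) (hi' y) x y ≤ 0 := by
  obtain ⟨⟨s1, s2, s3, s4⟩, d1, d2⟩ := corners hK hne X Y hKX hKY hX hY hA
  obtain ⟨h, h0, hz, hp, hb⟩ := key hK hne X Y hKX hKY hX hY hV σ hVK
  have hb := hb x y z hA
  have hx1 := (hX x).1
  have hx2 := (hX x).2.1
  have hy1 := (hY y).1
  have hy2 := (hY y).2.1
  simp only [bil, d1, d2, hz _ hx1 _ hy1 s1, hz _ hx2 _ hy1 s2, hz _ hx1 _ hy2 s3,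
    hz _ hx2 _ hy2 s4, add_zero] at hb
  exact hb

/-- Upper boundary. -/
noncomputable def Up (K : Set (ℝ × ℝ × ℝ)) (x y : ℝ) : ℝ :=
  sSup {z : ℝ | (x, y, z) ∈ DConvexHull D3 K}

/-- Lower boundary. -/
noncomputable def Lw (K : Set (ℝ × ℝ × ℝ)) (x y : ℝ) : ℝ :=
  sInf {z : ℝ | (x, y, z) ∈ DConvexHull D3 K}

lemma Up_mem {K : Set (ℝ × ℝ × ℝ)} (hK : K.Finite) (hne : K.Nonempty)
    {x y : ℝ} (h : Sp K x y) : (x, y, Up K x y) ∈ DConvexHull D3 K :=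
  (fiber_compact hK hne x y).sSup_mem h

lemma Lw_mem {K : Set (ℝ × ℝ × ℝ)} (hK : K.Finite) (hne : K.Nonempty)
    {x y : ℝ} (h : Sp K x y) : (x, y, Lw K x y) ∈ DConvexHull D3 K :=
  (fiber_compact hK hne x y).sInf_mem h

lemma le_Up {K : Set (ℝ × ℝ × ℝ)} (hK : K.Finite) (hne : K.Nonempty)
    {x y z : ℝ} (h : (x, y, z) ∈ DConvexHull D3 K) : z ≤ Up K x y :=
  le_csSup (fiber_compact hK hne x y).bddAbove h

lemma Lw_le {K : Set (ℝ × ℝ × ℝ)} (hK : K.Finite) (hne : K.Nonempty)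
    {x y z : ℝ} (h : (x, y, z) ∈ DConvexHull D3 K) : Lw K x y ≤ z :=
  csInf_le (fiber_compact hK hne x y).bddBelow h

lemma lam_x {K : Set (ℝ × ℝ × ℝ)} (hK : K.Finite) (hne : K.Nonempty)
    {a b c y z1 z2 : ℝ} (hab : a < b) (hbc : b < c)
    (h1 : (a, y, z1) ∈ DConvexHull D3 K) (h2 : (c, y, z2) ∈ DConvexHull D3 K) :
    (b, y, ((c - b) * z1 + (b - a) * z2) / (c - a)) ∈ DConvexHull D3 K := by
  have hca : 0 < c - a := by linarith
  have hst : (c - b) / (c - a) + (b - a) / (c - a) = 1 := by field_simp; ring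
  have := hull_lam hK hne h1 h2 (Or.inr rfl) (div_nonneg (by linarith : 0 ≤ c - b) hca.le)
    (div_nonneg (by linarith : 0 ≤ b - a) hca.le) hst
  rw [comb_self hst] at this
  convert this using 3
  · field_simp; ring
  · field_simp

lemma lam_y {K : Set (ℝ × ℝ × ℝ)} (hK : K.Finite) (hne : K.Nonempty)
    {a b c x z1 z2 : ℝ} (hab : a < b) (hbc : b < c)
    (h1 : (x, a, z1) ∈ DConvexHull D3 K) (h2 : (x, c, z2) ∈ DConvexHull D3 K) :
    (x, b, ((c - b) * z1 + (b - a) * z2) / (c - a)) ∈ DConvexHull D3 K := by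
  have hca : 0 < c - a := by linarith
  have hst : (c - b) / (c - a) + (b - a) / (c - a) = 1 := by field_simp; ring
  have := hull_lam hK hne h1 h2 (Or.inl rfl) (div_nonneg (by linarith : 0 ≤ c - b) hca.le)
    (div_nonneg (by linarith : 0 ≤ b - a) hca.le) hst
  rw [comb_self hst] at this
  convert this using 3
  · field_simp; ring
  · field_simp

lemma SDC_Up {K : Set (ℝ × ℝ × ℝ)} (hK : K.Finite) (hne : K.Nonempty)
    : SDC K (fun x y => - Up K x y) := by
  constructor
  · intro y a b c hab hbc ha _ hc
    have h1 := le_Up hK hne (lam_x hK hne hab hbc (Up_mem hK hne ha) (Up_mem hK hne hc))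
    rw [div_le_iff₀ (by linarith)] at h1
    simp only
    linarith
  · intro y a b c hab hbc ha _ hc
    have h1 := le_Up hK hne (lam_y hK hne hab hbc (Up_mem hK hne ha) (Up_mem hK hne hc))
    rw [div_le_iff₀ (by linarith)] at h1
    simp only
    linarith

lemma SDC_Lw {K : Set (ℝ × ℝ × ℝ)} (hK : K.Finite) (hne : K.Nonempty)
    : SDC K (Lw K) := by
  constructor
  · intro y a b c hab hbc ha _ hc
    have h1 := Lw_le hK hne (lam_x hK hne hab hbc (Lw_mem hK hne ha) (Lw_mem hK hne hc))
    rw [le_div_iff₀ (by linarith)] at h1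
    linarith
  · intro y a b c hab hbc ha _ hc
    have h1 := Lw_le hK hne (lam_y hK hne hab hbc (Lw_mem hK hne ha) (Lw_mem hK hne hc))
    rw [le_div_iff₀ (by linarith)] at h1
    linarith

lemma th_Icc {s l h : ℝ} (h1 : l ≤ s) (h2 : s ≤ h) :
    0 ≤ th s l h ∧ th s l h ≤ 1 ∧ s = (1 - th s l h) * l + th s l h * h := by
  rcases (h1.trans h2).eq_or_lt with h3 | h3
  · subst h3
    simp only [th_self]
    refine ⟨le_rfl, zero_le_one, by linarith⟩
  · refine ⟨div_nonneg (by linarith) (by linarith), ?_, th_spec h3⟩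
    exact (div_le_one (by linarith)).2 (by linarith)

lemma bil_mem {K : Set (ℝ × ℝ × ℝ)} (hK : K.Finite) (hne : K.Nonempty)
    {w : ℝ → ℝ → ℝ} {a b c d x y : ℝ} (h1 : a ≤ x) (h2 : x ≤ b) (h3 : c ≤ y) (h4 : y ≤ d)
    (m1 : (a, c, w a c) ∈ DConvexHull D3 K) (m2 : (b, c, w b c) ∈ DConvexHull D3 K)
    (m3 : (a, d, w a d) ∈ DConvexHull D3 K) (m4 : (b, d, w b d) ∈ DConvexHull D3 K) :
    (x, y, bil w a b c d x y) ∈ DConvexHull D3 K := by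
  obtain ⟨t0, t1, t2⟩ := th_Icc h1 h2
  obtain ⟨u0, u1, u2⟩ := th_Icc h3 h4
  have p := hull_lam hK hne m1 m3 (Or.inl rfl) (sub_nonneg.2 u1) u0 (by ring)
  have q := hull_lam hK hne m2 m4 (Or.inl rfl) (sub_nonneg.2 u1) u0 (by ring)
  rw [← u2, comb_self (by ring)] at p q
  have r := hull_lam hK hne p q (Or.inr rfl) (sub_nonneg.2 t1) t0 (by ring)
  rw [← t2, comb_self (by ring)] at r
  exact r

lemma vert_mem {K : Set (ℝ × ℝ × ℝ)} (hK : K.Finite) (hne : K.Nonempty)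
    {x y z1 z z2 : ℝ} (m1 : (x, y, z1) ∈ DConvexHull D3 K)
    (m2 : (x, y, z2) ∈ DConvexHull D3 K) (h1 : z1 ≤ z) (h2 : z ≤ z2) :
    (x, y, z) ∈ DConvexHull D3 K := by
  obtain ⟨t0, t1, t2⟩ := th_Icc h1 h2
  have p := hull_lam hK hne m1 m2 (Or.inl rfl) (sub_nonneg.2 t1) t0 (by ring)
  rw [← t2, comb_self (by ring), comb_self (by ring)] at p
  exact p

lemma hull_eq {K : Set (ℝ × ℝ × ℝ)} (hK : K.Finite) (hne : K.Nonempty)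
    (X Y : Finset ℝ) (hKX : ∀ k ∈ K, k.1 ∈ X) (hKY : ∀ k ∈ K, k.2.1 ∈ Y)
    (x y z : ℝ) :
    (x, y, z) ∈ DConvexHull D3 K ↔ ∃ a ∈ X, ∃ b ∈ X, ∃ c ∈ Y, ∃ d ∈ Y,
      (Sp K a c ∧ Sp K b c ∧ Sp K a d ∧ Sp K b d) ∧ a ≤ x ∧ x ≤ b ∧ c ≤ y ∧ y ≤ d ∧
        bil (Lw K) a b c d x y ≤ z ∧ z ≤ bil (Up K) a b c d x y := by
  constructor
  · intro hA
    obtain ⟨k0, hk0⟩ := hne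
    have hne : K.Nonempty := ⟨k0, hk0⟩
    choose lo hi hX using exists_cell X ⟨_, hKX k0 hk0⟩
    choose lo' hi' hY using exists_cell Y ⟨_, hKY k0 hk0⟩
    obtain ⟨hS, d1, d2⟩ := corners hK hne X Y hKX hKY hX hY hA
    have hL := bound hK hne X Y hKX hKY hX hY (SDC_Lw hK hne) (-1) (fun k hk => by
      have := Lw_le hK hne (subset_hull hK hne hk)
      linarith) hA
    have hU := bound hK hne X Y hKX hKY hX hY (SDC_Up hK hne) 1 (fun k hk => by
      have := le_Up hK hne (subset_hull hK hne hk)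
      linarith) hA
    have dd : ∀ s l h, dst s l h = 0 → l ≤ s ∧ s ≤ h := by
      intro s l h h0
      have h1 : max (l - s) (s - h) ≤ 0 := h0 ▸ le_max_left _ _
      have h2 := (le_max_left _ _).trans h1
      have h3 := (le_max_right _ _).trans h1
      constructor <;> linarith
    obtain ⟨x1, x2⟩ := dd _ _ _ d1
    obtain ⟨y1, y2⟩ := dd _ _ _ d2
    refine ⟨lo x, (hX x).1, hi x, (hX x).2.1, lo' y, (hY y).1, hi' y, (hY y).2.1, hS, x1, x2, y1, y2,
      by linarith, ?_⟩
    unfold bil at hU ⊢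
    linarith
  · rintro ⟨a, _, b, _, c, _, d, _, ⟨s1, s2, s3, s4⟩, x1, x2, y1, y2, z1, z2⟩
    exact vert_mem hK hne
      (bil_mem hK hne x1 x2 y1 y2 (Lw_mem hK hne s1) (Lw_mem hK hne s2) (Lw_mem hK hne s3)
        (Lw_mem hK hne s4))
      (bil_mem hK hne x1 x2 y1 y2 (Up_mem hK hne s1) (Up_mem hK hne s2) (Up_mem hK hne s3)
        (Up_mem hK hne s4)) z1 z2

/-- Evaluation of a polynomial at a point. -/
noncomputable def ev (v : ℝ × ℝ × ℝ) (p : MvPolynomial (Fin 3) ℝ) : ℝ :=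
  MvPolynomial.eval ![v.1, v.2.1, v.2.2] p

/-- Sets determined by the signs of finitely many polynomials of degree at most two. -/
def Good (T : Set (ℝ × ℝ × ℝ)) : Prop :=
  ∃ F : Finset (MvPolynomial (Fin 3) ℝ), (∀ p ∈ F, p.totalDegree ≤ 2) ∧
    ∀ v w, (∀ p ∈ F, compare (ev v p) 0 = compare (ev w p) 0) → v ∈ T → w ∈ T

lemma good_le {p : MvPolynomial (Fin 3) ℝ} (hp : p.totalDegree ≤ 2) : Good {v | ev v p ≤ 0} := by
  refine ⟨{p}, by simpa using hp, fun v w h hv => ?_⟩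
  have h := h p (Finset.mem_singleton_self p)
  simp only [Set.mem_ofPred_eq] at *
  rw [← compare_le_iff_le] at *
  rwa [← h]

lemma good_inter {S T : Set (ℝ × ℝ × ℝ)} (hS : Good S) (hT : Good T) : Good (S ∩ T) := by
  classical
  obtain ⟨F, h1, h2⟩ := hS
  obtain ⟨G, h3, h4⟩ := hT
  refine ⟨F ∪ G, ?_, fun v w h hv => ⟨h2 v w (fun p hp => h p ?_) hv.1,
    h4 v w (fun p hp => h p ?_) hv.2⟩⟩
  · intro p hp
    rcases Finset.mem_union.1 hp with h | h
    · exact h1 p h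
    · exact h3 p h
  · exact Finset.mem_union_left _ hp
  · exact Finset.mem_union_right _ hp

lemma good_iUnion {ι : Type*} (s : Finset ι) (T : ι → Set (ℝ × ℝ × ℝ)) (hT : ∀ i, Good (T i)) :
    Good {v | ∃ i ∈ s, v ∈ T i} := by
  classical
  choose F h1 h2 using hT
  refine ⟨s.biUnion F, ?_, ?_⟩
  · intro p hp
    obtain ⟨i, _, hi⟩ := Finset.mem_biUnion.1 hp
    exact h1 i p hi
  · rintro v w h ⟨i, hi, hv⟩
    exact ⟨i, hi, h2 i v w (fun p hp => h p (Finset.mem_biUnion.2 ⟨i, hi, hp⟩)) hv⟩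

lemma good_final {T : Set (ℝ × ℝ × ℝ)} (hT : Good T) :
    ∃ (m : ℕ) (p : Fin m → MvPolynomial (Fin 3) ℝ),
      (∀ i, (p i).totalDegree ≤ 2) ∧
      ∃ (N : ℕ) (σ : Fin N → Fin m → Ordering),
        T = ⋃ j, ⋂ i, {v : ℝ × ℝ × ℝ |
            compare (MvPolynomial.eval ![v.1, v.2.1, v.2.2] (p i)) 0 = σ j i} := by
  obtain ⟨F, h1, h2⟩ := hT
  let e := F.equivFin
  refine ⟨F.card, fun i => (e.symm i).1, fun i => h1 _ (e.symm i).2, ?_⟩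
  let SV := {σ : Fin F.card → Ordering // ∃ v ∈ T, ∀ i, compare (ev v (e.symm i).1) 0 = σ i}
  have : Finite Ordering := by
    refine Finite.of_injective (β := Fin 3)
      (fun o => match o with | .lt => 0 | .eq => 1 | .gt => 2) ?_
    intro a b
    cases a <;> cases b <;> simp
  have : Finite SV := inferInstance
  obtain ⟨N, ⟨E⟩⟩ := Finite.exists_equiv_fin SV
  refine ⟨N, fun j => (E.symm j).1, ?_⟩
  ext w
  simp only [Set.mem_iUnion, Set.mem_iInter, Set.mem_ofPred_eq]
  constructor
  · intro hw
    refine ⟨E ⟨fun i => compare (ev w (e.symm i).1) 0, w, hw, fun _ => rfl⟩, fun i => ?_⟩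
    rw [Equiv.symm_apply_apply]
    rfl
  · rintro ⟨j, hj⟩
    obtain ⟨v, hv, hvj⟩ := (E.symm j).2
    refine h2 v w (fun p hp => ?_) hv
    have a := hj (e ⟨p, hp⟩)
    have b := hvj (e ⟨p, hp⟩)
    rw [Equiv.symm_apply_apply] at a b
    exact b.trans a.symm

open MvPolynomial in
lemma deg_add {p q : MvPolynomial (Fin 3) ℝ} {n : ℕ} (hp : p.totalDegree ≤ n)
    (hq : q.totalDegree ≤ n) : (p + q).totalDegree ≤ n :=
  (totalDegree_add p q).trans (max_le hp hq)

open MvPolynomial in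
lemma deg_sub {p q : MvPolynomial (Fin 3) ℝ} {n : ℕ} (hp : p.totalDegree ≤ n)
    (hq : q.totalDegree ≤ n) : (p - q).totalDegree ≤ n :=
  (totalDegree_sub p q).trans (max_le hp hq)

open MvPolynomial in
lemma deg_mul {p q : MvPolynomial (Fin 3) ℝ} {n m k : ℕ} (hp : p.totalDegree ≤ n)
    (hq : q.totalDegree ≤ m) (h : n + m ≤ k) : (p * q).totalDegree ≤ k :=
  (totalDegree_mul p q).trans ((add_le_add hp hq).trans h)

open MvPolynomial in
lemma deg_C (a : ℝ) (n : ℕ) : (C a : MvPolynomial (Fin 3) ℝ).totalDegree ≤ n := by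
  simp

open MvPolynomial in
lemma deg_X (i : Fin 3) (n : ℕ) (hn : 1 ≤ n) : (X i : MvPolynomial (Fin 3) ℝ).totalDegree ≤ n := by
  simpa using hn

/-- Polynomial version of `th`. -/
noncomputable def thP (i : Fin 3) (a b : ℝ) : MvPolynomial (Fin 3) ℝ :=
  (MvPolynomial.X i - MvPolynomial.C a) * MvPolynomial.C ((b - a)⁻¹)

lemma deg_thP (i : Fin 3) (a b : ℝ) : (thP i a b).totalDegree ≤ 1 :=
  deg_mul (deg_sub (deg_X i 1 le_rfl) (deg_C a 1)) (deg_C _ 0) le_rfl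

/-- Polynomial version of `bil`. -/
noncomputable def bilP (w : ℝ → ℝ → ℝ) (a b c d : ℝ) : MvPolynomial (Fin 3) ℝ :=
  (MvPolynomial.C 1 - thP 0 a b) * ((MvPolynomial.C 1 - thP 1 c d) * MvPolynomial.C (w a c) +
      thP 1 c d * MvPolynomial.C (w a d)) +
    thP 0 a b * ((MvPolynomial.C 1 - thP 1 c d) * MvPolynomial.C (w b c) +
      thP 1 c d * MvPolynomial.C (w b d))

lemma deg_bilP (w : ℝ → ℝ → ℝ) (a b c d : ℝ) : (bilP w a b c d).totalDegree ≤ 2 := by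
  have h : ∀ p q, ((MvPolynomial.C 1 - thP 1 c d) * MvPolynomial.C p +
      thP 1 c d * MvPolynomial.C q).totalDegree ≤ 1 := fun p q =>
    deg_add (deg_mul (deg_sub (deg_C _ 1) (deg_thP _ _ _)) (deg_C _ 0) le_rfl)
      (deg_mul (deg_thP _ _ _) (deg_C _ 0) le_rfl)
  exact deg_add (deg_mul (deg_sub (deg_C _ 1) (deg_thP _ _ _)) (h _ _) le_rfl)
    (deg_mul (deg_thP _ _ _) (h _ _) le_rfl)

lemma ev_bilP (w : ℝ → ℝ → ℝ) (a b c d : ℝ) (v : ℝ × ℝ × ℝ) :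
    ev v (bilP w a b c d) = bil w a b c d v.1 v.2.1 := by
  simp [ev, bilP, thP, bil, th, div_eq_mul_inv]

lemma good_cell (w w' : ℝ → ℝ → ℝ) (a b c d : ℝ) :
    Good {v | a ≤ v.1 ∧ v.1 ≤ b ∧ c ≤ v.2.1 ∧ v.2.1 ≤ d ∧
      bil w a b c d v.1 v.2.1 ≤ v.2.2 ∧ v.2.2 ≤ bil w' a b c d v.1 v.2.1} := by
  have hX : ∀ i, (MvPolynomial.X i : MvPolynomial (Fin 3) ℝ).totalDegree ≤ 2 :=
    fun i => deg_X i 2 (by norm_num)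
  have hC := fun r => deg_C r 2
  have := good_inter (good_le (deg_sub (hC a) (hX 0))) (good_inter (good_le (deg_sub (hX 0) (hC b)))
    (good_inter (good_le (deg_sub (hC c) (hX 1))) (good_inter (good_le (deg_sub (hX 1) (hC d)))
    (good_inter (good_le (deg_sub (deg_bilP w a b c d) (hX 2)))
      (good_le (deg_sub (hX 2) (deg_bilP w' a b c d)))))))
  convert this using 1
  ext v
  have e : ∀ p q, ev v (p - q) = ev v p - ev v q := fun p q => by simp [ev]
  have e0 : ev v (MvPolynomial.X 0) = v.1 := by simp [ev]
  have e1 : ev v (MvPolynomial.X 1) = v.2.1 := by simp [ev]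
  have e2 : ev v (MvPolynomial.X 2) = v.2.2 := by simp [ev]
  have e3 : ∀ r, ev v (MvPolynomial.C r) = r := fun r => by simp [ev]
  simp only [Set.mem_ofPred_eq, Set.mem_inter_iff, e, e0, e1, e2, e3, ev_bilP, sub_nonpos]

lemma good_hull {K : Set (ℝ × ℝ × ℝ)} (hK : K.Finite) : Good (DConvexHull D3 K) := by
  classical
  rcases K.eq_empty_or_nonempty with rfl | hne
  · refine ⟨∅, by simp, fun v w _ hv => ?_⟩
    have hc : DConvex D3 (fun _ => (1 : ℝ)) := fun A B _ => convexOn_const _ convex_univ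
    have := hv _ hc
    simp at this
    linarith
  · set X := hK.toFinset.image (fun k => k.1) with hXd
    set Y := hK.toFinset.image (fun k => k.2.1) with hYd
    have hKX : ∀ k ∈ K, k.1 ∈ X := fun k hk =>
      Finset.mem_image_of_mem (fun k : ℝ × ℝ × ℝ => k.1) (hK.mem_toFinset.2 hk)
    have hKY : ∀ k ∈ K, k.2.1 ∈ Y := fun k hk =>
      Finset.mem_image_of_mem (fun k : ℝ × ℝ × ℝ => k.2.1) (hK.mem_toFinset.2 hk)
    have := good_iUnion (((X ×ˢ X) ×ˢ (Y ×ˢ Y)).filter (fun i =>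
        Sp K i.1.1 i.2.1 ∧ Sp K i.1.2 i.2.1 ∧ Sp K i.1.1 i.2.2 ∧ Sp K i.1.2 i.2.2)) _
      (fun i => good_cell (Lw K) (Up K) i.1.1 i.1.2 i.2.1 i.2.2)
    convert this using 1
    ext ⟨x, y, z⟩
    rw [hull_eq hK hne X Y hKX hKY]
    simp only [Set.mem_ofPred_eq, Finset.mem_filter, Finset.mem_product]
    constructor
    · rintro ⟨a, ha, b, hb, c, hc, d, hd, hS, h⟩
      exact ⟨((a, b), (c, d)), ⟨⟨⟨ha, hb⟩, hc, hd⟩, hS⟩, h⟩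
    · rintro ⟨⟨⟨a, b⟩, c, d⟩, ⟨⟨⟨ha, hb⟩, hc, hd⟩, hS⟩, h⟩
      exact ⟨a, ha, b, hb, c, hc, d, hd, hS, h⟩

end TriHull

/-- The rank-one convex hull of a finite set of triangular `2×2` matrices is a
semialgebraic set: it is a finite union of finite intersections of sign conditions
(`> 0`, `= 0`, `< 0`) on finitely many polynomials of total degree at most `2`
in the variables `x, y, z`. -/
theorem semialg_triangular_hull (K : Set (ℝ × ℝ × ℝ)) (hK : K.Finite) :
    ∃ (m : ℕ) (p : Fin m → MvPolynomial (Fin 3) ℝ),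
      (∀ i, (p i).totalDegree ≤ 2) ∧
      ∃ (N : ℕ) (σ : Fin N → Fin m → Ordering),
        DConvexHull D3 K =
          ⋃ j, ⋂ i, {v : ℝ × ℝ × ℝ |
            compare (MvPolynomial.eval ![v.1, v.2.1, v.2.2] (p i)) 0 = σ j i} :=
  TriHull.good_final (TriHull.good_hull hK)
end

section
/- Let D = {(x,y,z) ∈ ℝ³ : x·y = 0}, let π : ℝ³ → ℝ² be the projection (x,y,z) ↦ (x,y), let K ⊆ ℝ³ be finite, and let M > 0 be such that conv_D K ⊆ ℝ² × (−M, M). Let P₁, P₂ ∈ ℝ² be two distinct points of the grid associated with π(K) such that the segment [P₁, P₂] is horizontal or vertical, is contained in a line of the grid, and contains no grid vertex in its relative interior. Set ■ = [P₁,P₂] × [−M, M] ⊆ ℝ³ and let ∂_rel ■ = ({P₁, P₂} × [−M, M]) ∪ ([P₁,P₂] × {−M, M}) denote its relative boundary. Then conv_D K ∩ ■ = conv(conv_D K ∩ ∂_rel ■), where conv denotes the ordinary convex hull. -/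
/-- The projection `π : ℝ³ → ℝ²`, `(x, y, z) ↦ (x, y)`. -/
def pr (v : ℝ × ℝ × ℝ) : ℝ × ℝ := (v.1, v.2.1)

/-- `p` belongs to the grid associated with `F ⊆ ℝ²`: it lies on a horizontal or
a vertical line through some point of `F`. -/
def GridPoint (F : Set (ℝ × ℝ)) (p : ℝ × ℝ) : Prop :=
  (∃ q ∈ F, p.1 = q.1) ∨ (∃ q ∈ F, p.2 = q.2)

/-- `p` is a vertex of the grid associated with `F ⊆ ℝ²`: it lies simultaneously on a
vertical and on a horizontal line of the grid. -/
def GridVertex (F : Set (ℝ × ℝ)) (p : ℝ × ℝ) : Prop :=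
  (∃ q ∈ F, p.1 = q.1) ∧ (∃ q ∈ F, p.2 = q.2)


/-- Separate convexity in `(y,z)` and in `(x,z)`, as plain inequalities. -/
structure TC (f : ℝ × ℝ × ℝ → ℝ) : Prop where
  yz : ∀ x y z y' z' l m : ℝ, 0 ≤ l → 0 ≤ m → l + m = 1 →
    f (x, l * y + m * y', l * z + m * z') ≤ l * f (x, y, z) + m * f (x, y', z')
  xz : ∀ y x z x' z' l m : ℝ, 0 ≤ l → 0 ≤ m → l + m = 1 →
    f (l * x + m * x', y, l * z + m * z') ≤ l * f (x, y, z) + m * f (x', y, z')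

lemma pt_congr (f : ℝ × ℝ × ℝ → ℝ) {x y z x' y' z' : ℝ} (h1 : x = x') (h2 : y = y')
    (h3 : z = z') : f (x, y, z) = f (x', y', z') := by rw [h1, h2, h3]

lemma dconvex_iff_tc (f : ℝ × ℝ × ℝ → ℝ) : DConvex D3 f ↔ TC f := by
  constructor
  · intro h
    constructor
    · intro x y z y' z' l m hl hm hlm
      have h1 := (h (x, y, z) (0, y' - y, z' - z) (by simp [D3])).2 (Set.mem_univ 0)
        (Set.mem_univ 1) hl hm hlm
      have hl' : l = 1 - m := by linarith
      subst hl'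
      simp only [smul_eq_mul, Prod.smul_mk, Prod.mk_add_mk] at h1
      refine le_of_eq_of_le (pt_congr f ?_ ?_ ?_) (h1.trans_eq (congrArg₂ _
        (congrArg₂ _ rfl (pt_congr f ?_ ?_ ?_)) (congrArg₂ _ rfl (pt_congr f ?_ ?_ ?_)))) <;> ring
    · intro y x z x' z' l m hl hm hlm
      have h1 := (h (x, y, z) (x' - x, 0, z' - z) (by simp [D3])).2 (Set.mem_univ 0)
        (Set.mem_univ 1) hl hm hlm
      have hl' : l = 1 - m := by linarith
      subst hl'
      simp only [smul_eq_mul, Prod.smul_mk, Prod.mk_add_mk] at h1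
      refine le_of_eq_of_le (pt_congr f ?_ ?_ ?_) (h1.trans_eq (congrArg₂ _
        (congrArg₂ _ rfl (pt_congr f ?_ ?_ ?_)) (congrArg₂ _ rfl (pt_congr f ?_ ?_ ?_)))) <;> ring
  · rintro h ⟨x, y, z⟩ ⟨p, q, r⟩ hB
    refine ⟨convex_univ, ?_⟩
    intro s _ t _ l m hl hm hlm
    have hl' : l = 1 - m := by linarith
    have hB' : p = 0 ∨ q = 0 := by simpa [D3] using hB
    rcases hB' with rfl | rfl
    · have h1 := h.yz x (y + s * q) (z + s * r) (y + t * q) (z + t * r) l m hl hm hlm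
      subst hl'
      simp only [smul_eq_mul, Prod.smul_mk, Prod.mk_add_mk, mul_zero, add_zero]
      exact le_of_eq_of_le (pt_congr f (by ring) (by ring) (by ring)) h1
    · have h1 := h.xz y (x + s * p) (z + s * r) (x + t * p) (z + t * r) l m hl hm hlm
      subst hl'
      simp only [smul_eq_mul, Prod.smul_mk, Prod.mk_add_mk, mul_zero, add_zero]
      exact le_of_eq_of_le (pt_congr f (by ring) (by ring) (by ring)) h1

lemma TC.max {f g : ℝ × ℝ × ℝ → ℝ} (hf : TC f) (hg : TC g) : TC (fun v => max (f v) (g v)) := by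
  constructor
  · intro x y z y' z' l m hl hm hlm
    apply max_le
    · exact (hf.yz x y z y' z' l m hl hm hlm).trans (add_le_add
        (mul_le_mul_of_nonneg_left (le_max_left _ _) hl)
        (mul_le_mul_of_nonneg_left (le_max_left _ _) hm))
    · exact (hg.yz x y z y' z' l m hl hm hlm).trans (add_le_add
        (mul_le_mul_of_nonneg_left (le_max_right _ _) hl)
        (mul_le_mul_of_nonneg_left (le_max_right _ _) hm))
  · intro y x z x' z' l m hl hm hlm
    apply max_le
    · exact (hf.xz y x z x' z' l m hl hm hlm).trans (add_le_add
        (mul_le_mul_of_nonneg_left (le_max_left _ _) hl)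
        (mul_le_mul_of_nonneg_left (le_max_left _ _) hm))
    · exact (hg.xz y x z x' z' l m hl hm hlm).trans (add_le_add
        (mul_le_mul_of_nonneg_left (le_max_right _ _) hl)
        (mul_le_mul_of_nonneg_left (le_max_right _ _) hm))

lemma TC.sub_const {f : ℝ × ℝ × ℝ → ℝ} (hf : TC f) (k : ℝ) : TC (fun v => f v - k) := by
  constructor
  · intro x y z y' z' l m hl hm hlm
    have := hf.yz x y z y' z' l m hl hm hlm
    have hl' : l = 1 - m := by linarith
    subst hl'
    linarith
  · intro y x z x' z' l m hl hm hlm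
    have := hf.xz y x z x' z' l m hl hm hlm
    have hl' : l = 1 - m := by linarith
    subst hl'
    linarith

lemma tc_abs (R : ℝ) : TC (fun v => |v.2.2| - R) := by
  have key : ∀ z z' l m : ℝ, 0 ≤ l → 0 ≤ m → |l * z + m * z'| ≤ l * |z| + m * |z'| := by
    intro z z' l m hl hm
    refine (abs_add_le _ _).trans ?_
    rw [abs_mul, abs_mul, abs_of_nonneg hl, abs_of_nonneg hm]
  have : TC (fun v => |v.2.2|) :=
    ⟨fun x y z y' z' l m hl hm _ => key z z' l m hl hm,
     fun x y z y' z' l m hl hm _ => key z _ l m hl hm⟩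
  exact this.sub_const R

lemma tc_zero : TC (fun _ => 0) := ⟨by intros; simp, by intros; simp⟩

lemma TC.swap {f : ℝ × ℝ × ℝ → ℝ} (hf : TC f) : TC (fun v => f (v.2.1, v.1, v.2.2)) :=
  ⟨fun x y z y' z' l m hl hm h => hf.xz x y z y' z' l m hl hm h,
   fun x y z y' z' l m hl hm h => hf.yz x y z y' z' l m hl hm h⟩

lemma TC.cont {f : ℝ × ℝ × ℝ → ℝ} (hf : TC f) (x y : ℝ) : Continuous (fun z => f (x, y, z)) := by
  have hc : ConvexOn ℝ Set.univ (fun z => f (x, y, z)) := by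
    refine ⟨convex_univ, ?_⟩
    intro z _ z' _ l m hl hm hlm
    have := hf.yz x y z y z' l m hl hm hlm
    rw [← add_mul, hlm, one_mul] at this
    exact this
  exact continuousOn_univ.1 (hc.continuousOn isOpen_univ)

lemma mem_hull_iff {K : Set (ℝ × ℝ × ℝ)} (hK : K.Finite) (hne : K.Nonempty) (A : ℝ × ℝ × ℝ) :
    A ∈ DConvexHull D3 K ↔ ∀ f, TC f → (∀ v ∈ K, f v ≤ 0) → f A ≤ 0 := by
  constructor
  · intro h f hf hfK
    refine (h f ((dconvex_iff_tc f).2 hf)).trans ?_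
    apply csSup_le (hne.image f)
    rintro _ ⟨v, hv, rfl⟩
    exact hfK v hv
  · intro h f hf
    have := h (fun v => f v - sSup (f '' K)) (((dconvex_iff_tc f).1 hf).sub_const _) (by
      intro v hv
      have := le_csSup (hK.image f).bddAbove (Set.mem_image_of_mem f hv)
      linarith)
    linarith

/-- Clip a parameter to a slab. -/
lemma clip {a b y0 y1 t : ℝ} (ht : 0 ≤ t) (h : a < (1 - t) * y0 + t * y1)
    (h' : (1 - t) * y0 + t * y1 < b) :
    ∃ r, 0 ≤ r ∧ r ≤ t ∧ a ≤ (1 - r) * y0 + r * y1 ∧ (1 - r) * y0 + r * y1 ≤ b ∧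
      (r = 0 ∨ ¬ (a < (1 - r) * y0 + r * y1 ∧ (1 - r) * y0 + r * y1 < b)) := by
  have hcont : Continuous (fun r : ℝ => (1 - r) * y0 + r * y1) := by fun_prop
  by_cases h1 : y0 < a
  · obtain ⟨r, hr, hre⟩ := intermediate_value_Icc ht hcont.continuousOn
      (show a ∈ Set.Icc _ _ from ⟨by simp; linarith, h.le⟩)
    have hre : (1 - r) * y0 + r * y1 = a := hre
    exact ⟨r, hr.1, hr.2, hre.ge, by linarith, Or.inr (by rw [hre]; simp)⟩
  · by_cases h2 : b < y0
    · obtain ⟨r, hr, hre⟩ := intermediate_value_Icc' ht hcont.continuousOn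
        (show b ∈ Set.Icc _ _ from ⟨h'.le, by simp; linarith⟩)
      have hre : (1 - r) * y0 + r * y1 = b := hre
      exact ⟨r, hr.1, hr.2, by linarith, hre.le, Or.inr (by rw [hre]; simp)⟩
    · exact ⟨0, le_rfl, ht, by linarith, by linarith, Or.inl rfl⟩

/-- Gluing convex functions over a slab. -/
lemma glue {a b : ℝ} {φ G : ℝ → ℝ → ℝ}
    (hφ : ∀ y z y' z' l m : ℝ, 0 ≤ l → 0 ≤ m → l + m = 1 →
      φ (l * y + m * y') (l * z + m * z') ≤ l * φ y z + m * φ y' z')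
    (hle : ∀ y z, φ y z ≤ G y z)
    (heq : ∀ y z, ¬ (a < y ∧ y < b) → G y z = φ y z)
    (hG : ∀ y z y' z' l m : ℝ, a ≤ y → y ≤ b → a ≤ y' → y' ≤ b →
      0 ≤ l → 0 ≤ m → l + m = 1 → a < l * y + m * y' → l * y + m * y' < b →
      G (l * y + m * y') (l * z + m * z') ≤ l * G y z + m * G y' z')
    (y z y' z' l m : ℝ) (hl : 0 ≤ l) (hm : 0 ≤ m) (hlm : l + m = 1) :
    G (l * y + m * y') (l * z + m * z') ≤ l * G y z + m * G y' z' := by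
  have hchord : ∀ l m : ℝ, 0 ≤ l → 0 ≤ m → l + m = 1 →
      ¬ (a < l * y + m * y' ∧ l * y + m * y' < b) →
      G (l * y + m * y') (l * z + m * z') ≤ l * G y z + m * G y' z' := by
    intro l m hl hm hlm hn
    rw [heq _ _ hn]
    exact (hφ y z y' z' l m hl hm hlm).trans (add_le_add
      (mul_le_mul_of_nonneg_left (hle _ _) hl) (mul_le_mul_of_nonneg_left (hle _ _) hm))
  by_cases hin : a < l * y + m * y' ∧ l * y + m * y' < b
  swap
  · exact hchord l m hl hm hlm hin
  obtain ⟨h1, h2⟩ := hin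
  have hl' : l = 1 - m := by linarith
  obtain ⟨r, hr0, hrm, hra, hrb, hr⟩ := clip (y0 := y) (y1 := y') hm (by rwa [← hl'])
    (by rwa [← hl'])
  obtain ⟨q, hq0, hql, hqa, hqb, hq⟩ := clip (a := a) (b := b) (y0 := y') (y1 := y) (t := l) hl
    (by rw [show 1 - l = m by linarith]; linarith)
    (by rw [show 1 - l = m by linarith]; linarith)
  have e1 : G ((1 - r) * y + r * y') ((1 - r) * z + r * z') ≤ (1 - r) * G y z + r * G y' z' := by
    rcases hr with rfl | hr
    · simp
    · exact hchord (1 - r) r (by linarith) hr0 (by ring) hr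
  have e2 : G ((1 - q) * y' + q * y) ((1 - q) * z' + q * z) ≤ (1 - q) * G y' z' + q * G y z := by
    rcases hq with rfl | hq
    · simp
    · have := hchord q (1 - q) hq0 (by linarith) (by ring) (by
        rwa [add_comm])
      rw [add_comm ((1 - q) * y'), add_comm ((1 - q) * z')]
      linarith
  by_cases hd : 1 - q - r = 0
  · -- then `r = m`, `q = l`
    have : r = m := by linarith
    subst this
    rw [hl']
    exact e1
  have hd' : 0 < 1 - q - r := lt_of_le_of_ne (by linarith) (Ne.symm hd)
  -- weights
  have hA : 0 ≤ (1 - q - m) / (1 - q - r) := div_nonneg (by linarith) hd'.le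
  have hB : 0 ≤ (m - r) / (1 - q - r) := div_nonneg (by linarith) hd'.le
  have hAB : (1 - q - m) / (1 - q - r) + (m - r) / (1 - q - r) = 1 := by
    field_simp; ring
  have comb : ∀ u u' : ℝ, (1 - q - m) / (1 - q - r) * ((1 - r) * u + r * u') +
      (m - r) / (1 - q - r) * ((1 - q) * u' + q * u) = l * u + m * u' := by
    intro u u'
    rw [hl']
    field_simp
    ring
  have h3 := hG ((1 - r) * y + r * y') ((1 - r) * z + r * z') ((1 - q) * y' + q * y)
    ((1 - q) * z' + q * z) _ _ hra hrb hqa hqb hA hB hAB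
    (by rw [comb]; exact h1) (by rw [comb]; exact h2)
  rw [comb, comb] at h3
  refine h3.trans ?_
  rw [← comb (G y z) (G y' z')]
  exact add_le_add (mul_le_mul_of_nonneg_left e1 hA) (mul_le_mul_of_nonneg_left e2 hB)

/-- Replace `f` in the slab `a < y < b` by the envelope of its boundary values. -/
noncomputable def slabEnv (a b : ℝ) (f : ℝ × ℝ × ℝ → ℝ) (v : ℝ × ℝ × ℝ) : ℝ :=
  if a < v.2.1 ∧ v.2.1 < b then
    ⨅ t : ℝ, (1 - (v.2.1 - a) / (b - a)) * f (v.1, a, v.2.2 - (v.2.1 - a) / (b - a) * t) +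
      (v.2.1 - a) / (b - a) * f (v.1, b, v.2.2 + (1 - (v.2.1 - a) / (b - a)) * t)
  else f v

section
variable {a b : ℝ} {f : ℝ × ℝ × ℝ → ℝ}

lemma slab_ge (hf : TC f) (x s z1 z2 : ℝ) (hs : 0 ≤ s) (hs1 : s ≤ 1) :
    f (x, (1 - s) * a + s * b, (1 - s) * z1 + s * z2) ≤
      (1 - s) * f (x, a, z1) + s * f (x, b, z2) :=
  hf.yz x a z1 b z2 (1 - s) s (by linarith) hs (by ring)

lemma slabEnv_eq (v : ℝ × ℝ × ℝ) (h : ¬ (a < v.2.1 ∧ v.2.1 < b)) : slabEnv a b f v = f v := by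
  simp only [slabEnv, if_neg h]

lemma slab_term_ge (hab : a < b) (hf : TC f) (x y z t : ℝ) (h : a < y ∧ y < b) :
    f (x, y, z) ≤ (1 - (y - a) / (b - a)) * f (x, a, z - (y - a) / (b - a) * t) +
      (y - a) / (b - a) * f (x, b, z + (1 - (y - a) / (b - a)) * t) := by
  have hd : 0 < b - a := by linarith
  have h0 : 0 ≤ (y - a) / (b - a) := div_nonneg (by linarith) hd.le
  have h1 : (y - a) / (b - a) ≤ 1 := by rw [div_le_one hd]; linarith
  have := slab_ge (a := a) (b := b) hf x ((y - a) / (b - a)) (z - (y - a) / (b - a) * t)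
    (z + (1 - (y - a) / (b - a)) * t) h0 h1
  have e1 : (1 - (y - a) / (b - a)) * a + (y - a) / (b - a) * b = y := by
    field_simp; ring
  rw [e1] at this
  convert this using 4
  ring

lemma le_slabEnv (hab : a < b) (hf : TC f) (v : ℝ × ℝ × ℝ) : f v ≤ slabEnv a b f v := by
  obtain ⟨x, y, z⟩ := v
  by_cases h : a < y ∧ y < b
  · simp only [slabEnv, if_pos h]
    exact le_ciInf fun t => slab_term_ge hab hf x y z t h
  · rw [slabEnv_eq _ h]

lemma slabEnv_le (hab : a < b) (hf : TC f) (x s z1 z2 : ℝ) (hs : 0 < s) (hs1 : s < 1) :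
    slabEnv a b f (x, (1 - s) * a + s * b, (1 - s) * z1 + s * z2) ≤
      (1 - s) * f (x, a, z1) + s * f (x, b, z2) := by
  have hd : 0 < b - a := by linarith
  have h : a < (1 - s) * a + s * b ∧ (1 - s) * a + s * b < b := by
    constructor <;> nlinarith
  have e : ((1 - s) * a + s * b - a) / (b - a) = s := by field_simp; ring
  simp only [slabEnv, if_pos h]
  refine (ciInf_le ⟨f (x, (1 - s) * a + s * b, (1 - s) * z1 + s * z2), ?_⟩ (z2 - z1)).trans ?_
  · rintro _ ⟨t, rfl⟩
    exact slab_term_ge hab hf x _ _ t h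
  · rw [e]
    apply le_of_eq
    exact congrArg₂ _ (congrArg₂ _ rfl (pt_congr f rfl rfl (by ring)))
      (congrArg₂ _ rfl (pt_congr f rfl rfl (by ring)))

lemma slabEnv_repr (hab : a < b) (x y z e : ℝ) (he : 0 < e) (hy : a ≤ y)
    (hy' : y ≤ b) : ∃ s z1 z2 : ℝ, 0 ≤ s ∧ s ≤ 1 ∧ y = (1 - s) * a + s * b ∧
      z = (1 - s) * z1 + s * z2 ∧
      (1 - s) * f (x, a, z1) + s * f (x, b, z2) ≤ slabEnv a b f (x, y, z) + e := by
  have hd : 0 < b - a := by linarith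
  by_cases h : a < y ∧ y < b
  · have : slabEnv a b f (x, y, z) < slabEnv a b f (x, y, z) + e := by linarith
    conv_lhs at this => simp only [slabEnv, if_pos h]
    obtain ⟨t, ht⟩ := exists_lt_of_ciInf_lt this
    refine ⟨(y - a) / (b - a), _, _, div_nonneg (by linarith) hd.le, ?_, ?_, ?_, ht.le⟩
    · rw [div_le_one hd]; linarith
    · field_simp; ring
    · ring
  · rw [slabEnv_eq _ h]
    by_cases h1 : y = a
    · subst h1
      exact ⟨0, z, z, le_rfl, zero_le_one, by simp, by simp, by simp; linarith⟩
    · have h2 : y = b := by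
        by_contra h2
        exact h ⟨lt_of_le_of_ne hy (Ne.symm h1), lt_of_le_of_ne hy' h2⟩
      subst h2
      exact ⟨1, z, z, zero_le_one, le_rfl, by simp, by simp, by simp; linarith⟩

lemma slabEnv_tc (hab : a < b) (hf : TC f) : TC (slabEnv a b f) := by
  have hd : 0 < b - a := by linarith
  constructor
  · intro x
    apply glue (a := a) (b := b) (φ := fun y z => f (x, y, z))
      (G := fun y z => slabEnv a b f (x, y, z)) (hf.yz x)
    · exact fun y z => le_slabEnv hab hf _
    · exact fun y z h => slabEnv_eq _ h
    · intro y z y' z' l m hya hyb hya' hyb' hl hm hlm h1 h2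
      apply le_of_forall_pos_le_add
      intro e he
      obtain ⟨s, z1, z2, hs0, hs1, rfl, rfl, hv⟩ := slabEnv_repr (f := f) hab x y z e he hya hyb
      obtain ⟨s', z1', z2', hs0', hs1', rfl, rfl, hv'⟩ :=
        slabEnv_repr (f := f) hab x y' z' e he hya' hyb'
      have hl' : l = 1 - m := by linarith
      set S := l * s + m * s' with hS
      have ey : l * ((1 - s) * a + s * b) + m * ((1 - s') * a + s' * b) =
          (1 - S) * a + S * b := by rw [hS, hl']; ring
      rw [ey] at h1 h2 ⊢
      have hS0 : 0 < S := by nlinarith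
      have hS1 : 0 < 1 - S := by nlinarith
      have wa : 0 ≤ l * (1 - s) / (1 - S) := by
        apply div_nonneg (mul_nonneg hl (by linarith)) hS1.le
      have wa' : 0 ≤ m * (1 - s') / (1 - S) := by
        apply div_nonneg (mul_nonneg hm (by linarith)) hS1.le
      have wb : 0 ≤ l * s / S := by positivity
      have wb' : 0 ≤ m * s' / S := by positivity
      have ha := hf.yz x a z1 a z1' _ _ wa wa' (by
        rw [← add_div, div_eq_one_iff_eq hS1.ne', hS, hl']; ring)
      have hb := hf.yz x b z2 b z2' _ _ wb wb' (by
        rw [← add_div, div_eq_one_iff_eq hS0.ne', hS])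
      rw [← add_mul, show l * (1 - s) / (1 - S) + m * (1 - s') / (1 - S) = 1 by
        rw [← add_div, div_eq_one_iff_eq hS1.ne', hS, hl']; ring, one_mul] at ha
      rw [← add_mul, show l * s / S + m * s' / S = 1 by
        rw [← add_div, div_eq_one_iff_eq hS0.ne', hS], one_mul] at hb
      have key := slabEnv_le hab hf x S (l * (1 - s) / (1 - S) * z1 + m * (1 - s') / (1 - S) * z1')
        (l * s / S * z2 + m * s' / S * z2') hS0 (by linarith)
      have ez : ∀ u1 u1' u2 u2' : ℝ,
          (1 - S) * (l * (1 - s) / (1 - S) * u1 + m * (1 - s') / (1 - S) * u1') +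
          S * (l * s / S * u2 + m * s' / S * u2') =
          l * ((1 - s) * u1 + s * u2) + m * ((1 - s') * u1' + s' * u2') := by
        intro u1 u1' u2 u2'
        clear_value S
        have := hS1.ne'
        field_simp
        ring
      rw [ez] at key
      refine key.trans ?_
      refine (add_le_add (mul_le_mul_of_nonneg_left ha hS1.le)
        (mul_le_mul_of_nonneg_left hb hS0.le)).trans ?_
      rw [ez]
      refine (add_le_add (mul_le_mul_of_nonneg_left hv hl)
        (mul_le_mul_of_nonneg_left hv' hm)).trans ?_
      apply le_of_eq
      have : e = l * e + m * e := by rw [← add_mul, hlm, one_mul]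
      linarith
  · intro y x z x' z' l m hl hm hlm
    by_cases h : a < y ∧ y < b
    swap
    · rw [slabEnv_eq _ h, slabEnv_eq _ h, slabEnv_eq _ h]
      exact hf.xz y x z x' z' l m hl hm hlm
    apply le_of_forall_pos_le_add
    intro e he
    obtain ⟨s, z1, z2, hs0, hs1, hy, rfl, hv⟩ :=
      slabEnv_repr (f := f) hab x y z e he h.1.le h.2.le
    obtain ⟨s', z1', z2', hs0', hs1', hy', rfl, hv'⟩ :=
      slabEnv_repr (f := f) hab x' y z' e he h.1.le h.2.le
    have hss : s' = s := by
      have : (s' - s) * (b - a) = 0 := by linarith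
      rcases mul_eq_zero.1 this with h | h <;> linarith
    subst hss
    have hS0 : 0 < s' := by
      refine lt_of_le_of_ne hs0 ?_
      rintro rfl
      linarith [h.1]
    have hS1 : s' < 1 := by
      refine lt_of_le_of_ne hs1 ?_
      rintro rfl
      linarith [h.2]
    have key := slabEnv_le hab hf (l * x + m * x') s' (l * z1 + m * z1') (l * z2 + m * z2') hS0 hS1
    rw [← hy] at key
    have ha := hf.xz a x z1 x' z1' l m hl hm hlm
    have hb := hf.xz b x z2 x' z2' l m hl hm hlm
    have ez : l * ((1 - s') * z1 + s' * z2) + m * ((1 - s') * z1' + s' * z2') =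
      (1 - s') * (l * z1 + m * z1') + s' * (l * z2 + m * z2') := by ring
    rw [ez] at *
    refine key.trans ?_
    refine (add_le_add (mul_le_mul_of_nonneg_left ha (by linarith))
        (mul_le_mul_of_nonneg_left hb hS0.le)).trans ?_
    have h3 := add_le_add (mul_le_mul_of_nonneg_left hv hl) (mul_le_mul_of_nonneg_left hv' hm)
    have : e = l * e + m * e := by rw [← add_mul, hlm, one_mul]
    linarith
end

lemma core {K : Set (ℝ × ℝ × ℝ)} (hK : K.Finite) (hne : K.Nonempty) {a b : ℝ} (hab : a < b)
    (hslab : ∀ v ∈ K, ¬ (a < v.2.1 ∧ v.2.1 < b)) (c s z : ℝ) (hs : 0 < s) (hs1 : s < 1)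
    (hA : (c, (1 - s) * a + s * b, z) ∈ DConvexHull D3 K) :
    ∃ z1 z2, (c, a, z1) ∈ DConvexHull D3 K ∧ (c, b, z2) ∈ DConvexHull D3 K ∧
      z = (1 - s) * z1 + s * z2 := by
  obtain ⟨R, hR⟩ := (hK.image (fun v => |v.2.2|)).bddAbove
  have hR' : ∀ v ∈ K, |v.2.2| - R ≤ 0 := fun v hv => by
    have : |v.2.2| ≤ R := hR (Set.mem_image_of_mem _ hv)
    linarith
  have hs1' : 0 < 1 - s := by linarith
  rw [mem_hull_iff hK hne] at hA
  -- the set of good parameters for a function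
  let F := {f : ℝ × ℝ × ℝ → ℝ // TC f ∧ ∀ v ∈ K, f v ≤ 0}
  let f0 : ℝ × ℝ × ℝ → ℝ := fun v => max (|v.2.2| - R) 0
  have hf0 : TC f0 := (tc_abs R).max tc_zero
  have hf0K : ∀ v ∈ K, f0 v ≤ 0 := fun v hv => max_le (hR' v hv) le_rfl
  let C : F → Set ℝ := fun f => {t | max (f.1 (c, a, z - s * t)) (f0 (c, a, z - s * t)) ≤ 0 ∧
    max (f.1 (c, b, z + (1 - s) * t)) (f0 (c, b, z + (1 - s) * t)) ≤ 0}
  have hcl : ∀ f, IsClosed (C f) := by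
    intro f
    have h1 := ((f.2.1.max hf0).cont c a).comp (show Continuous fun t : ℝ => z - s * t by fun_prop)
    have h2 := ((f.2.1.max hf0).cont c b).comp
      (show Continuous fun t : ℝ => z + (1 - s) * t by fun_prop)
    exact (isClosed_le h1 continuous_const).inter (isClosed_le h2 continuous_const)
  have hcpt : ∀ f, IsCompact (C f) := by
    intro f
    refine (isCompact_Icc (a := (z - R) / s) (b := (z + R) / s)).of_isClosed_subset (hcl f) ?_
    intro t ht
    have h1 := (le_max_right _ _).trans ht.1
    have h2 : |z - s * t| - R ≤ 0 := (le_max_left _ _).trans h1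
    have h3 := abs_le.1 (show |z - s * t| ≤ R by linarith)
    constructor
    · rw [div_le_iff₀ hs]; linarith [h3.2]
    · rw [le_div_iff₀ hs]; linarith [h3.1]
  have hnon : ∀ f, (C f).Nonempty := by
    intro f
    let g : ℝ × ℝ × ℝ → ℝ := fun v => max (f.1 v) (f0 v)
    have hg : TC g := f.2.1.max hf0
    have hg0 : ∀ v, 0 ≤ g v := fun v => (le_max_right _ _).trans (le_max_right _ _)
    have hgR : ∀ v, |v.2.2| - R ≤ g v := fun v => (le_max_left _ _).trans (le_max_right _ _)
    have hgK : ∀ v ∈ K, g v ≤ 0 := fun v hv => max_le (f.2.2 v hv) (hf0K v hv)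
    let h : ℝ → ℝ := fun t => (1 - s) * g (c, a, z - s * t) + s * g (c, b, z + (1 - s) * t)
    have hcont : Continuous h := by
      have h1 := (hg.cont c a).comp (show Continuous fun t : ℝ => z - s * t by fun_prop)
      have h2 := (hg.cont c b).comp (show Continuous fun t : ℝ => z + (1 - s) * t by fun_prop)
      exact (continuous_const.mul h1).add (continuous_const.mul h2)
    have hlim : Filter.Tendsto h (Filter.cocompact ℝ) Filter.atTop := by
      have hn := tendsto_norm_cocompact_atTop (E := ℝ)
      have h2 : Filter.Tendsto (fun t : ℝ => (1 - s) * s * ‖t‖ + (-(1 - s) * (|z| + R)))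
          (Filter.cocompact ℝ) Filter.atTop :=
        Filter.tendsto_atTop_add_const_right _ _ (hn.const_mul_atTop (mul_pos hs1' hs))
      refine Filter.tendsto_atTop_mono (fun t => ?_) h2
      have e1 := hgR (c, a, z - s * t)
      have e2 := hg0 (c, b, z + (1 - s) * t)
      have e3 : s * |t| - |z| ≤ |z - s * t| := by
        have := abs_sub_abs_le_abs_sub (s * t) z
        rw [abs_mul, abs_of_pos hs, abs_sub_comm] at this
        exact this
      have e4 : s * |t| - |z| - R ≤ g (c, a, z - s * t) := by
        simp only at e1
        linarith
      have e5 := mul_le_mul_of_nonneg_left e4 hs1'.le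
      have e6 := mul_nonneg hs.le e2
      simp only [h, Real.norm_eq_abs]
      linarith
    obtain ⟨t, ht⟩ := hcont.exists_forall_le hlim
    have h0 := hA (slabEnv a b g) (slabEnv_tc hab hg) (by
      intro v hv
      rw [slabEnv_eq _ (hslab v hv)]
      exact hgK v hv)
    have hle : h t ≤ 0 := by
      apply le_of_forall_pos_le_add
      intro e he
      obtain ⟨s', z1, z2, _, _, hy, hz, hv⟩ := slabEnv_repr (f := g) hab c
        ((1 - s) * a + s * b) z e he (by nlinarith) (by nlinarith)
      have hss : s' = s := by
        have : (s' - s) * (b - a) = 0 := by linarith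
        rcases mul_eq_zero.1 this with h | h <;> linarith
      subst hss
      have h3 := ht (z2 - z1)
      have e1 : z - s' * (z2 - z1) = z1 := by rw [hz]; ring
      have e2 : z + (1 - s') * (z2 - z1) = z2 := by rw [hz]; ring
      have h4 : h (z2 - z1) = (1 - s') * g (c, a, z1) + s' * g (c, b, z2) := by
        simp only [h, e1, e2]
      linarith
    have q1 := hg0 (c, a, z - s * t)
    have q2 := hg0 (c, b, z + (1 - s) * t)
    have hle' : (1 - s) * g (c, a, z - s * t) + s * g (c, b, z + (1 - s) * t) ≤ 0 := hle
    refine ⟨t, ?_, ?_⟩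
    · change g (c, a, z - s * t) ≤ 0
      have := mul_nonneg hs.le q2
      by_contra hcon
      have := mul_pos hs1' (not_le.1 hcon)
      linarith
    · change g (c, b, z + (1 - s) * t) ≤ 0
      have := mul_nonneg hs1'.le q1
      by_contra hcon
      have := mul_pos hs (not_le.1 hcon)
      linarith
  have hdir : Directed (· ⊇ ·) C := by
    intro f g
    refine ⟨⟨fun v => max (f.1 v) (g.1 v), f.2.1.max g.2.1,
      fun v hv => max_le (f.2.2 v hv) (g.2.2 v hv)⟩, ?_, ?_⟩
    · rintro t ⟨h1, h2⟩
      simp only [max_le_iff] at h1 h2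
      exact ⟨max_le h1.1.1 h1.2,
        max_le h2.1.1 h2.2⟩
    · rintro t ⟨h1, h2⟩
      simp only [max_le_iff] at h1 h2
      exact ⟨max_le h1.1.2 h1.2,
        max_le h2.1.2 h2.2⟩
  have : Nonempty F := ⟨⟨f0, hf0, hf0K⟩⟩
  obtain ⟨t, ht⟩ := IsCompact.nonempty_iInter_of_directed_nonempty_isCompact_isClosed
    C hdir hnon hcpt hcl
  rw [Set.mem_iInter] at ht
  refine ⟨z - s * t, z + (1 - s) * t, ?_, ?_, by ring⟩
  · rw [mem_hull_iff hK hne]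
    intro f hf hfK
    exact (le_max_left _ _).trans (ht ⟨f, hf, hfK⟩).1
  · rw [mem_hull_iff hK hne]
    intro f hf hfK
    exact (le_max_left _ _).trans (ht ⟨f, hf, hfK⟩).2

lemma core' {K : Set (ℝ × ℝ × ℝ)} (hK : K.Finite) (hne : K.Nonempty) {a b : ℝ} (hab : a ≠ b)
    (c s z : ℝ) (hs : 0 < s) (hs1 : s < 1)
    (hslab : ∀ v ∈ K, ∀ r : ℝ, 0 < r → r < 1 → v.2.1 ≠ (1 - r) * a + r * b)
    (hA : (c, (1 - s) * a + s * b, z) ∈ DConvexHull D3 K) :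
    ∃ z1 z2, (c, a, z1) ∈ DConvexHull D3 K ∧ (c, b, z2) ∈ DConvexHull D3 K ∧
      z = (1 - s) * z1 + s * z2 := by
  rcases lt_or_gt_of_ne hab with h | h
  · refine core hK hne h ?_ c s z hs hs1 hA
    rintro v hv ⟨h1, h2⟩
    have hd : 0 < b - a := by linarith
    refine hslab v hv ((v.2.1 - a) / (b - a)) (div_pos (by linarith) hd)
      (by rw [div_lt_one hd]; linarith) ?_
    field_simp; ring
  · obtain ⟨z1, z2, h1, h2, h3⟩ := core hK hne h (by
      rintro v hv ⟨h1, h2⟩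
      have hd : 0 < a - b := by linarith
      refine hslab v hv ((a - v.2.1) / (a - b)) (div_pos (by linarith) hd)
        (by rw [div_lt_one hd]; linarith) ?_
      field_simp; ring) c (1 - s) z (by linarith) (by linarith)
      (by convert hA using 3; ring)
    exact ⟨z2, z1, h2, h1, by rw [h3]; ring⟩

lemma hull_swap {K : Set (ℝ × ℝ × ℝ)} (hK : K.Finite) (hne : K.Nonempty) {x y z : ℝ}
    (h : (x, y, z) ∈ DConvexHull D3 K) :
    (y, x, z) ∈ DConvexHull D3 ((fun v : ℝ × ℝ × ℝ => (v.2.1, v.1, v.2.2)) '' K) := by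
  rw [mem_hull_iff (hK.image _) (hne.image _)]
  rw [mem_hull_iff hK hne] at h
  intro f hf hfK
  exact h _ hf.swap (fun v hv => hfK _ (Set.mem_image_of_mem _ hv))

lemma hull_swap' {K : Set (ℝ × ℝ × ℝ)} (hK : K.Finite) (hne : K.Nonempty) {x y z : ℝ}
    (h : (y, x, z) ∈ DConvexHull D3 ((fun v : ℝ × ℝ × ℝ => (v.2.1, v.1, v.2.2)) '' K)) :
    (x, y, z) ∈ DConvexHull D3 K := by
  have := hull_swap (hK.image _) (hne.image _) h
  rw [Set.image_image] at this
  simpa using this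

lemma decomp {K : Set (ℝ × ℝ × ℝ)} (hK : K.Finite) (hKne : K.Nonempty)
    (P₁ P₂ : ℝ × ℝ) (hne : P₁ ≠ P₂)
    (hline : (P₁.1 = P₂.1 ∧ ∃ q ∈ pr '' K, P₁.1 = q.1) ∨
             (P₁.2 = P₂.2 ∧ ∃ q ∈ pr '' K, P₁.2 = q.2))
    (hint : ∀ p ∈ openSegment ℝ P₁ P₂, ¬ GridVertex (pr '' K) p)
    (s z : ℝ) (hs : 0 < s) (hs1 : s < 1)
    (hA : ((1 - s) * P₁.1 + s * P₂.1, (1 - s) * P₁.2 + s * P₂.2, z) ∈ DConvexHull D3 K) :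
    ∃ z1 z2, (P₁.1, P₁.2, z1) ∈ DConvexHull D3 K ∧ (P₂.1, P₂.2, z2) ∈ DConvexHull D3 K ∧
      z = (1 - s) * z1 + s * z2 := by
  obtain ⟨x1, y1⟩ := P₁
  obtain ⟨x2, y2⟩ := P₂
  simp only at *
  have hseg : ∀ r : ℝ, 0 < r → r < 1 → ((1 - r) * x1 + r * x2, (1 - r) * y1 + r * y2) ∈
      openSegment ℝ (x1, y1) (x2, y2) := fun r h0 h1 =>
    ⟨1 - r, r, by linarith, h0, by ring, by simp⟩
  rcases hline with ⟨rfl, hq⟩ | ⟨rfl, hq⟩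
  · have e : ∀ r : ℝ, (1 - r) * x1 + r * x1 = x1 := fun r => by ring
    simp only [e] at hA hseg
    refine core' hK hKne (fun h => hne (by rw [h])) x1 s z hs hs1 ?_ hA
    intro v hv r h0 h1 he
    exact hint _ (hseg r h0 h1) ⟨hq, pr v, Set.mem_image_of_mem _ hv, he.symm⟩
  · have e : ∀ r : ℝ, (1 - r) * y1 + r * y1 = y1 := fun r => by ring
    simp only [e] at hA hseg
    obtain ⟨z1, z2, h1, h2, h3⟩ := core' (hK.image _) (hKne.image _)
      (fun h => hne (by rw [h])) y1 s z hs hs1 (by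
        rintro _ ⟨v, hv, rfl⟩ r h0 h1 he
        exact hint _ (hseg r h0 h1) ⟨⟨pr v, Set.mem_image_of_mem _ hv, he.symm⟩, hq⟩)
      (hull_swap hK hKne hA)
    exact ⟨z1, z2, hull_swap' hK hKne h1, hull_swap' hK hKne h2, h3⟩

lemma hull_convex_seg {K : Set (ℝ × ℝ × ℝ)} (hK : K.Finite) (hKne : K.Nonempty)
    (P₁ P₂ : ℝ × ℝ) (M : ℝ) (hline : P₁.1 = P₂.1 ∨ P₁.2 = P₂.2) :
    Convex ℝ (DConvexHull D3 K ∩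
        {v : ℝ × ℝ × ℝ | pr v ∈ segment ℝ P₁ P₂ ∧ v.2.2 ∈ Set.Icc (-M) M}) := by
  rintro ⟨x, y, z⟩ ⟨h1, h2, h3⟩ ⟨x', y', z'⟩ ⟨h1', h2', h3'⟩ l m hl hm hlm
  refine ⟨?_, ?_, ?_⟩
  · rw [mem_hull_iff hK hKne] at *
    intro f hf hfK
    have a1 := h1 f hf hfK
    have a2 := h1' f hf hfK
    have a3 : l * f (x, y, z) + m * f (x', y', z') ≤ 0 := by nlinarith
    obtain ⟨α, β, _, _, hab, he⟩ := h2
    obtain ⟨α', β', _, _, hab', he'⟩ := h2'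
    have ex := congrArg Prod.fst he
    have ey := congrArg Prod.snd he
    have ex' := congrArg Prod.fst he'
    have ey' := congrArg Prod.snd he'
    simp only [pr, Prod.fst_add, Prod.snd_add, Prod.smul_fst, Prod.smul_snd, smul_eq_mul] at *
    simp only [Prod.smul_mk, Prod.mk_add_mk, smul_eq_mul]
    rcases hline with h | h
    · rw [← h, ← add_mul, hab, one_mul] at ex
      rw [← h, ← add_mul, hab', one_mul] at ex'
      subst ex; subst ex'
      rw [← add_mul, hlm, one_mul]
      exact (hf.yz _ _ _ _ _ l m hl hm hlm).trans a3
    · rw [← h, ← add_mul, hab, one_mul] at ey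
      rw [← h, ← add_mul, hab', one_mul] at ey'
      subst ey; subst ey'
      rw [← add_mul, hlm, one_mul]
      exact (hf.xz _ _ _ _ _ l m hl hm hlm).trans a3
  · exact convex_segment P₁ P₂ h2 h2' hl hm hlm
  · exact convex_Icc (-M) M h3 h3' hl hm hlm

/-- Localization of the triangular hull to a vertical square over a grid segment:
if `[P₁,P₂]` is a horizontal or vertical segment contained in a line of the grid of
`π(K)` with no grid vertex in its relative interior, and
`■ = [P₁,P₂] × [−M,M]`, then
`conv_D K ∩ ■ = conv ( conv_D K ∩ ∂_rel ■ )`. -/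
theorem rc_hull_in_vertical_square (K : Set (ℝ × ℝ × ℝ)) (hK : K.Finite)
    (M : ℝ) (hM : 0 < M)
    (hbound : ∀ v ∈ DConvexHull D3 K, v.2.2 ∈ Set.Ioo (-M) M)
    (P₁ P₂ : ℝ × ℝ) (hne : P₁ ≠ P₂)
    (hP₁ : GridPoint (pr '' K) P₁) (hP₂ : GridPoint (pr '' K) P₂)
    (hline : (P₁.1 = P₂.1 ∧ ∃ q ∈ pr '' K, P₁.1 = q.1) ∨
             (P₁.2 = P₂.2 ∧ ∃ q ∈ pr '' K, P₁.2 = q.2))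
    (hint : ∀ p ∈ openSegment ℝ P₁ P₂, ¬ GridVertex (pr '' K) p) :
    DConvexHull D3 K ∩
        {v : ℝ × ℝ × ℝ | pr v ∈ segment ℝ P₁ P₂ ∧ v.2.2 ∈ Set.Icc (-M) M} =
      convexHull ℝ (DConvexHull D3 K ∩
        ({v : ℝ × ℝ × ℝ | (pr v = P₁ ∨ pr v = P₂) ∧ v.2.2 ∈ Set.Icc (-M) M} ∪
         {v : ℝ × ℝ × ℝ | pr v ∈ segment ℝ P₁ P₂ ∧ (v.2.2 = -M ∨ v.2.2 = M)})) := by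
  
  have hKne : K.Nonempty := by
    rcases hline with ⟨_, q, ⟨v, hv, _⟩, _⟩ | ⟨_, q, ⟨v, hv, _⟩, _⟩ <;> exact ⟨v, hv⟩
  apply Set.Subset.antisymm
  · rintro ⟨x, y, z⟩ ⟨hH, ⟨α, s, hα, hs, hsum, he⟩, hz⟩
    have hα' : α = 1 - s := by linarith
    subst hα'
    have hbase : ∀ u w r, (u, w, r) ∈ DConvexHull D3 K → ((u, w) = P₁ ∨ (u, w) = P₂) →
        (u, w, r) ∈ convexHull ℝ (DConvexHull D3 K ∩
        ({v : ℝ × ℝ × ℝ | (pr v = P₁ ∨ pr v = P₂) ∧ v.2.2 ∈ Set.Icc (-M) M} ∪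
         {v : ℝ × ℝ × ℝ | pr v ∈ segment ℝ P₁ P₂ ∧ (v.2.2 = -M ∨ v.2.2 = M)})) := by
      intro u w r h h'
      exact subset_convexHull ℝ _ ⟨h, Or.inl ⟨h', Set.Ioo_subset_Icc_self (hbound _ h)⟩⟩
    have he' : (1 - s) • P₁ + s • P₂ = (x, y) := he
    rcases hs.eq_or_lt with rfl | hs0
    · exact hbase _ _ _ hH (Or.inl (by rw [← he']; simp))
    rcases hα.eq_or_lt with hα | hs1
    · have : s = 1 := by linarith
      subst this
      exact hbase _ _ _ hH (Or.inr (by rw [← he']; simp))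
    have ex : (1 - s) * P₁.1 + s * P₂.1 = x := congrArg Prod.fst he'
    have ey : (1 - s) * P₁.2 + s * P₂.2 = y := congrArg Prod.snd he'
    subst ex; subst ey
    obtain ⟨z1, z2, h1, h2, h3⟩ := decomp hK hKne P₁ P₂ hne hline hint s z hs0 (by linarith) hH
    have := convex_convexHull ℝ _ (hbase _ _ _ h1 (Or.inl rfl)) (hbase _ _ _ h2 (Or.inr rfl))
      hα hs hsum
    rw [h3]
    exact this
  · refine convexHull_min ?_ (hull_convex_seg hK hKne P₁ P₂ M
      (hline.imp (fun h => h.1) (fun h => h.1)))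
    rintro v ⟨hv, h⟩
    refine ⟨hv, ?_, Set.Ioo_subset_Icc_self (hbound v hv)⟩
    rcases h with ⟨h | h, _⟩ | ⟨h, _⟩
    · rw [h]; exact left_mem_segment ℝ _ _
    · rw [h]; exact right_mem_segment ℝ _ _
    · exact h
end

section
/- Let D = {(x,y,z) ∈ ℝ³ : x·y = 0}, let D₂ = {(x,y) ∈ ℝ² : x·y = 0}, and let π : ℝ³ → ℝ² be the projection (x,y,z) ↦ (x,y). For every compact set K ⊆ ℝ³, one has π(conv_D K) ⊆ conv_{D₂}(π(K)). -/
/-- The cone of rank-one directions for diagonal `2×2` matrices, identified with `ℝ²`. -/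
def D2 : Set (ℝ × ℝ) := {v | v.1 * v.2 = 0}

/-- The projection of the triangular hull is contained in the separately convex hull of
the projection: `π(conv_D K) ⊆ conv_{D₂}(π(K))` for every compact `K ⊆ ℝ³`. -/
theorem proj_rc_hull_subset (K : Set (ℝ × ℝ × ℝ)) (hK : IsCompact K) :
    pr '' DConvexHull D3 K ⊆ DConvexHull D2 (pr '' K) := by
  rintro _ ⟨A, hA, rfl⟩ f hf
  have h : DConvex D3 (fun v => f (pr v)) := by
    intro A B hB
    exact hf (pr A) (pr B) hB
  have h2 := hA _ h
  rw [Set.image_image]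
  exact h2
end

section
/- Let D = {(x,y,z) ∈ ℝ³ : x·y = 0} and let K = {K₁,…,K₅} ⊆ ℝ³ with K₁ = (3,1,0), K₂ = (1,−3,0), K₃ = (−3,−1,−1), K₄ = (−1,3,0), K₅ = (2,2,2). Define f_ℓ : ℝ³ → ℝ by f_ℓ(x,y,z) = −(45z − 29xy + 26x − 35y + 44) if x ≥ −1 and y ≥ 1, and f_ℓ(x,y,z) = −(3/4)·(60z + 5xy − 9x − 3y + 15) otherwise. Then f_ℓ is continuous, f_ℓ is D-convex, f_ℓ(K_i) = 0 for every i = 1,…,5, and consequently conv_D K ⊆ {v ∈ ℝ³ : f_ℓ(v) ≤ 0}. -/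
/-- The five-point configuration of triangular `2×2` matrices. -/
def K5 : Set (ℝ × ℝ × ℝ) :=
  {(3, 1, 0), (1, -3, 0), (-3, -1, -1), (-1, 3, 0), (2, 2, 2)}

/-- The piecewise-quadratic function `f_ℓ`, glued from `−q₂` on `{x ≥ −1, y ≥ 1}`
and `−(3/4)q₁` elsewhere. -/
noncomputable def fl (v : ℝ × ℝ × ℝ) : ℝ :=
  if -1 ≤ v.1 ∧ 1 ≤ v.2.1 then
    -(45 * v.2.2 - 29 * v.1 * v.2.1 + 26 * v.1 - 35 * v.2.1 + 44)
  else
    -(3 / 4) * (60 * v.2.2 + 5 * v.1 * v.2.1 - 9 * v.1 - 3 * v.2.1 + 15)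

/-- `fl` as a quadratic plus a product of positive parts. -/
lemma fl_eq (v : ℝ × ℝ × ℝ) : fl v =
    -(3 / 4) * (60 * v.2.2 + 5 * v.1 * v.2.1 - 9 * v.1 - 3 * v.2.1 + 15)
      + 131 / 4 * (max (v.1 + 1) 0 * max (v.2.1 - 1) 0) := by
  unfold fl
  split_ifs with h
  · rw [max_eq_left (by linarith [h.1]), max_eq_left (by linarith [h.2])]
    ring
  · by_cases h1 : -1 ≤ v.1
    · have h2 : v.2.1 - 1 ≤ 0 := by
        by_contra h3
        exact h ⟨h1, by linarith⟩
      rw [max_eq_right h2]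
      ring
    · rw [max_eq_right (a := v.1 + 1) (by linarith)]
      ring

lemma pos_part_convex (p q s t a b : ℝ) (ha : 0 ≤ a) (hb : 0 ≤ b) (hab : a + b = 1) :
    max (p + (a * s + b * t) * q) 0 ≤ a * max (p + s * q) 0 + b * max (p + t * q) 0 := by
  have h1 := mul_le_mul_of_nonneg_left (le_max_left (p + s * q) 0) ha
  have h2 := mul_le_mul_of_nonneg_left (le_max_left (p + t * q) 0) hb
  have h3 := mul_nonneg ha (le_max_right (p + s * q) 0)
  have h4 := mul_nonneg hb (le_max_right (p + t * q) 0)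
  refine max_le ?_ (by linarith)
  have : p + (a * s + b * t) * q = a * (p + s * q) + b * (p + t * q) := by
    linear_combination (-p) * hab
  linarith

lemma fl_dconvex : DConvex D3 fl := by
  rintro ⟨x, y, z⟩ ⟨u, v, w⟩ hB
  have hB : u * v = 0 := hB
  refine ⟨convex_univ, ?_⟩
  intro s _ t _ a b ha hb hab
  simp only [fl_eq, Prod.mk_add_mk, Prod.smul_mk, smul_eq_mul]
  obtain rfl : b = 1 - a := by linarith
  rcases mul_eq_zero.mp hB with rfl | rfl
  · have h := mul_le_mul_of_nonneg_left
      (pos_part_convex (y - 1) v s t a (1 - a) ha hb hab) (le_max_right (x + 1) 0)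
    simp only [mul_zero, add_zero, add_sub_right_comm y _ 1]
    linarith
  · have h := mul_le_mul_of_nonneg_right
      (pos_part_convex (x + 1) u s t a (1 - a) ha hb hab) (le_max_right (y - 1) 0)
    simp only [mul_zero, add_zero, add_right_comm x _ 1]
    linarith

/-- `f_ℓ` is continuous, `D`-convex (rank-one convex), vanishes on the five-point set
`K5`, and hence the triangular hull of `K5` is contained in `{f_ℓ ≤ 0}`. -/
theorem fl_rank_one_convex_cuts_hull :
    Continuous fl ∧ DConvex D3 fl ∧ (∀ v ∈ K5, fl v = 0) ∧
    DConvexHull D3 K5 ⊆ {v : ℝ × ℝ × ℝ | fl v ≤ 0} := by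
  have hK : ∀ v ∈ K5, fl v = 0 := by
    intro v hv
    simp only [K5, Set.mem_insert_iff, Set.mem_singleton_iff] at hv
    rcases hv with rfl | rfl | rfl | rfl | rfl <;> norm_num [fl]
  refine ⟨?_, fl_dconvex, hK, ?_⟩
  · rw [funext fl_eq]
    fun_prop
  · intro v hv
    refine (hv fl fl_dconvex).trans (Real.sSup_le ?_ le_rfl)
    rintro _ ⟨k, hk, rfl⟩
    exact (hK k hk).le
end

section
/- Let D = {(x,y,z) ∈ ℝ³ : x·y = 0} and let K = {K₁,…,K₅} ⊆ ℝ³ with K₁ = (3,1,0), K₂ = (1,−3,0), K₃ = (−3,−1,−1), K₄ = (−1,3,0), K₅ = (2,2,2). Then conv_D K ⊆ {(x,y,z) ∈ ℝ³ : 60z + 5xy − 9x − 3y + 15 ≥ 0} and conv_D K ⊆ {(x,y,z) ∈ ℝ³ : 118z − 12xy − 57x − 19y − 36 ≤ 0}. -/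
/-- Polynomials `a z + b x y + c x + d y + e` are affine along directions in `D3`. -/
theorem dconvex_quadric (a b c d e : ℝ) :
    DConvex D3 (fun v : ℝ × ℝ × ℝ =>
      a * v.2.2 + b * (v.1 * v.2.1) + c * v.1 + d * v.2.1 + e) := by
  rintro ⟨x, y, z⟩ ⟨p, q, r⟩ hB
  have hpq : p * q = 0 := hB
  refine ⟨convex_univ, ?_⟩
  intro s _ t _ m n _ _ hmn
  obtain rfl : n = 1 - m := by linarith
  apply le_of_eq
  simp only [Prod.fst_add, Prod.snd_add, Prod.smul_fst, Prod.smul_snd, smul_eq_mul]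
  linear_combination (b * (m * s + (1 - m) * t) ^ 2 - b * m * s ^ 2 - b * (1 - m) * t ^ 2) * hpq

/-- A `D3`-convex function that is nonpositive on `K5` is nonpositive on the hull. -/
theorem hull_nonpos (f : ℝ × ℝ × ℝ → ℝ) (hf : DConvex D3 f) (h : ∀ v ∈ K5, f v ≤ 0)
    (v : ℝ × ℝ × ℝ) (hv : v ∈ DConvexHull D3 K5) : f v ≤ 0 := by
  refine (hv f hf).trans (Real.sSup_nonpos ?_)
  rintro _ ⟨w, hw, rfl⟩
  exact h w hw

/-- The triangular hull of the five-point set `K5` lies above the quadric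
`q₁ = 60z + 5xy − 9x − 3y + 15` and below the quadric
`q₃ = 118z − 12xy − 57x − 19y − 36`. -/
theorem rc_hull_between_quadrics :
    DConvexHull D3 K5 ⊆
      {v : ℝ × ℝ × ℝ | 60 * v.2.2 + 5 * v.1 * v.2.1 - 9 * v.1 - 3 * v.2.1 + 15 ≥ 0} ∧
    DConvexHull D3 K5 ⊆
      {v : ℝ × ℝ × ℝ | 118 * v.2.2 - 12 * v.1 * v.2.1 - 57 * v.1 - 19 * v.2.1 - 36 ≤ 0} := by
  constructor
  · intro v hv
    have := hull_nonpos _ (dconvex_quadric (-60) (-5) 9 3 (-15)) (by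
      intro w hw
      rcases hw with rfl | rfl | rfl | rfl | rfl <;> norm_num) v hv
    simp only [Set.mem_setOf_eq]
    linarith
  · intro v hv
    have := hull_nonpos _ (dconvex_quadric 118 (-12) (-57) (-19) (-36)) (by
      intro w hw
      rcases hw with rfl | rfl | rfl | rfl | rfl <;> norm_num) v hv
    simp only [Set.mem_setOf_eq]
    linarith
end

section
/- Let D₂ = {(x,y) ∈ ℝ² : x·y = 0} and let K = {(3,1), (1,−3), (−3,−1), (−1,3)} ⊆ ℝ² (the Tartar square). Then conv_{D₂} K = ([−1,1] × [−1,1]) ∪ ([1,3] × {1}) ∪ ({1} × [−3,−1]) ∪ ([−3,−1] × {−1}) ∪ ({−1} × [1,3]), i.e., the separately convex hull of K is the union of the square [−1,1]² and the four axis-parallel segments joining the vertices (1,1), (1,−1), (−1,−1), (−1,1) of that square to the points (3,1), (1,−3), (−3,−1), (−1,3), respectively. -/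
theorem ts_aff (g : ℝ → ℝ) (hg : ConvexOn ℝ Set.univ g) (a b : ℝ) :
    ConvexOn ℝ Set.univ (fun t : ℝ => g (a + t * b)) := by
  refine ⟨convex_univ, fun x _ y _ s t hs ht hst => ?_⟩
  have h := hg.2 (Set.mem_univ (a + x * b)) (Set.mem_univ (a + y * b)) hs ht hst
  simp only [smul_eq_mul] at h ⊢
  convert h using 2
  linear_combination (-a) * hst

theorem ts_prod (g h : ℝ → ℝ) (hg : ConvexOn ℝ Set.univ g) (hh : ConvexOn ℝ Set.univ h)
    (g0 : ∀ x, 0 ≤ g x) (h0 : ∀ x, 0 ≤ h x) :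
    DConvex D2 (fun p : ℝ × ℝ => g p.1 * h p.2) := by
  rintro ⟨a1, a2⟩ ⟨b1, b2⟩ hB
  rcases mul_eq_zero.1 (show b1 * b2 = 0 from hB) with h1 | h1
  · subst h1
    simpa using (ts_aff h hh a2 b2).smul (g0 a1)
  · subst h1
    simpa [mul_comm] using (ts_aff g hg a1 b1).smul (h0 a2)

theorem ts_pos (a b : ℝ) : ConvexOn ℝ Set.univ (fun x : ℝ => max 0 (a + x * b)) := by
  have h : ConvexOn ℝ Set.univ (fun x : ℝ => max 0 x) :=
    (convexOn_const 0 convex_univ).sup (convexOn_id convex_univ)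
  exact ts_aff _ h a b

/-- test function -/
noncomputable def tsF (a b c d : ℝ) (p : ℝ × ℝ) : ℝ := max 0 (a + p.1 * b) * max 0 (c + p.2 * d)

theorem ts_sep {A : ℝ × ℝ}
    (hA : A ∈ DConvexHull D2 {((3 : ℝ), (1 : ℝ)), (1, -3), (-3, -1), (-1, 3)}) (a b c d : ℝ)
    (h1 : a + 3 * b ≤ 0 ∨ c + d ≤ 0) (h2 : a + b ≤ 0 ∨ c - 3 * d ≤ 0)
    (h3 : a - 3 * b ≤ 0 ∨ c - d ≤ 0) (h4 : a - b ≤ 0 ∨ c + 3 * d ≤ 0) :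
    a + A.1 * b ≤ 0 ∨ c + A.2 * d ≤ 0 := by
  have key : ∀ x y : ℝ, (x ≤ 0 ∨ y ≤ 0) → max 0 x * max 0 y ≤ 0 := by
    rintro x y (h | h) <;> simp [max_eq_left h]
  have h := hA (tsF a b c d) (ts_prod _ _ (ts_pos a b) (ts_pos c d)
    (fun _ => le_max_left _ _) (fun _ => le_max_left _ _))
  have hs : sSup (tsF a b c d '' {((3 : ℝ), (1 : ℝ)), (1, -3), (-3, -1), (-1, 3)}) ≤ 0 := by
    apply csSup_le (Set.Nonempty.image _ ⟨_, Set.mem_insert _ _⟩)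
    rintro _ ⟨p, hp, rfl⟩
    simp only [Set.mem_insert_iff, Set.mem_singleton_iff] at hp
    rcases hp with rfl | rfl | rfl | rfl <;> apply key
    · exact h1.imp (fun h => by linarith) (fun h => by linarith)
    · exact h2.imp (fun h => by linarith) (fun h => by linarith)
    · exact h3.imp (fun h => by linarith) (fun h => by linarith)
    · exact h4.imp (fun h => by linarith) (fun h => by linarith)
  by_contra! hc
  have : 0 < tsF a b c d A :=
    mul_pos (lt_max_of_lt_right hc.1) (lt_max_of_lt_right hc.2)
  linarith

theorem ts_conv (g : ℝ → ℝ) (hg : ConvexOn ℝ Set.univ g) {u v x M : ℝ} (hu : g u ≤ M)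
    (hv : g v ≤ M) (h1 : u ≤ x) (h2 : x ≤ v) : g x ≤ M :=
  (hg.le_max_of_mem_Icc (Set.mem_univ u) (Set.mem_univ v) ⟨h1, h2⟩).trans (max_le hu hv)

theorem ts_mid (g : ℝ → ℝ) (hg : ConvexOn ℝ Set.univ g) (u v : ℝ) :
    2 * g ((u + v) / 2) ≤ g u + g v := by
  have h := hg.2 (Set.mem_univ u) (Set.mem_univ v) (by norm_num : (0:ℝ) ≤ 1/2)
    (by norm_num : (0:ℝ) ≤ 1/2) (by norm_num)
  simp only [smul_eq_mul] at h
  rw [show (u + v) / 2 = 1 / 2 * u + 1 / 2 * v by ring]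
  linarith

/-- The separately convex hull of the Tartar square
`K = {(3,1), (1,−3), (−3,−1), (−1,3)}` is the union of the square `[−1,1]²` and the
four axis-parallel segments joining the vertices of that square to the points of `K`. -/
theorem tartar_square_hull :
    DConvexHull D2 {((3 : ℝ), (1 : ℝ)), (1, -3), (-3, -1), (-1, 3)} =
      (Set.Icc (-1 : ℝ) 1 ×ˢ Set.Icc (-1 : ℝ) 1) ∪
      (Set.Icc (1 : ℝ) 3 ×ˢ ({1} : Set ℝ)) ∪
      (({1} : Set ℝ) ×ˢ Set.Icc (-3 : ℝ) (-1)) ∪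
      (Set.Icc (-3 : ℝ) (-1) ×ˢ ({-1} : Set ℝ)) ∪
      (({-1} : Set ℝ) ×ˢ Set.Icc (1 : ℝ) 3) := by
  ext ⟨x, y⟩
  simp only [Set.mem_union, Set.mem_prod, Set.mem_Icc, Set.mem_singleton_iff]
  constructor
  · intro hA
    have e1 := ts_sep hA (-3) 1 1 0 (by norm_num) (by norm_num) (by norm_num) (by norm_num)
    have e2 := ts_sep hA (-3) (-1) 1 0 (by norm_num) (by norm_num) (by norm_num) (by norm_num)
    have e3 := ts_sep hA 1 0 (-3) 1 (by norm_num) (by norm_num) (by norm_num) (by norm_num)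
    have e4 := ts_sep hA 1 0 (-3) (-1) (by norm_num) (by norm_num) (by norm_num) (by norm_num)
    have f1 := ts_sep hA (-1) 1 (-1) 1 (by norm_num) (by norm_num) (by norm_num) (by norm_num)
    have f2 := ts_sep hA (-1) 1 1 (-1) (by norm_num) (by norm_num) (by norm_num) (by norm_num)
    have f3 := ts_sep hA (-1) (-1) (-1) (-1)
      (by norm_num) (by norm_num) (by norm_num) (by norm_num)
    have f4 := ts_sep hA (-1) (-1) 1 1 (by norm_num) (by norm_num) (by norm_num) (by norm_num)
    have f5 := ts_sep hA 1 1 (-1) 1 (by norm_num) (by norm_num) (by norm_num) (by norm_num)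
    have f6 := ts_sep hA (-1) (-1) (-1) 1
      (by norm_num) (by norm_num) (by norm_num) (by norm_num)
    have f7 := ts_sep hA 1 (-1) (-1) (-1)
      (by norm_num) (by norm_num) (by norm_num) (by norm_num)
    have f8 := ts_sep hA (-1) 1 (-1) (-1)
      (by norm_num) (by norm_num) (by norm_num) (by norm_num)
    simp only at e1 e2 e3 e4 f1 f2 f3 f4 f5 f6 f7 f8
    grind
  · intro hA f hf
    set K : Set (ℝ × ℝ) := {((3 : ℝ), (1 : ℝ)), (1, -3), (-3, -1), (-1, 3)} with hK
    have hfin : (f '' K).Finite := by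
      apply Set.Finite.image
      simp [hK]
    have hle : ∀ p ∈ K, f p ≤ sSup (f '' K) := fun p hp =>
      le_csSup hfin.bddAbove (Set.mem_image_of_mem f hp)
    have k1 := hle (3, 1) (by simp [hK])
    have k2 := hle (1, -3) (by simp [hK])
    have k3 := hle (-3, -1) (by simp [hK])
    have k4 := hle (-1, 3) (by simp [hK])
    generalize sSup (f '' K) = M at *
    have cx : ∀ y, ConvexOn ℝ Set.univ (fun t => f (t, y)) := by
      intro y
      simpa using hf (0, y) (1, 0) (by simp [D2])
    have cy : ∀ x, ConvexOn ℝ Set.univ (fun t => f (x, t)) := by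
      intro x
      simpa using hf (x, 0) (0, 1) (by simp [D2])
    have m1 := ts_mid _ (cx 1) (-1) 3
    have m2 := ts_mid _ (cy (-1)) (-1) 3
    have m3 := ts_mid _ (cx (-1)) (-3) 1
    have m4 := ts_mid _ (cy 1) (-3) 1
    norm_num at m1 m2 m3 m4
    have v1 : f (1, 1) ≤ M := by linarith
    have v2 : f (-1, 1) ≤ M := by linarith
    have v3 : f (-1, -1) ≤ M := by linarith
    have v4 : f (1, -1) ≤ M := by linarith
    rcases hA with (((⟨⟨a, b⟩, c, d⟩ | ⟨⟨a, b⟩, rfl⟩) | ⟨rfl, a, b⟩) | ⟨⟨a, b⟩, rfl⟩) | ⟨rfl, a, b⟩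
    · exact ts_conv _ (cy x) (ts_conv _ (cx (-1)) v3 v4 a b) (ts_conv _ (cx 1) v2 v1 a b) c d
    · exact ts_conv _ (cx 1) v1 k1 a b
    · exact ts_conv _ (cy 1) k2 v4 a b
    · exact ts_conv _ (cx (-1)) k3 v3 a b
    · exact ts_conv _ (cy (-1)) v2 k4 a b
end

section
/- Let D = {(x,y,z) ∈ ℝ³ : x·y = 0}. For every finite set K ⊆ ℝ³, the D-convex hull conv_D K is a compact subset of ℝ³, and for every (x₀, y₀) ∈ ℝ² the vertical fiber {z ∈ ℝ : (x₀, y₀, z) ∈ conv_D K} is a (possibly empty) closed bounded interval of ℝ. -/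
/-- The convexity inequality along a direction of the cone. -/
theorem DConvex.comb {f : ℝ × ℝ × ℝ → ℝ} (hf : DConvex D3 f) (q B : ℝ × ℝ × ℝ) (hB : B ∈ D3)
    (t : ℝ) (h0 : 0 ≤ t) (h1 : t ≤ 1) :
    f (q + t • B) ≤ (1 - t) * f q + t * f (q + B) := by
  have h := (hf q B hB).2 (Set.mem_univ (0 : ℝ)) (Set.mem_univ (1 : ℝ))
    (by linarith : (0 : ℝ) ≤ 1 - t) h0 (by ring)
  simpa using h

/-- A bound at both ends of a segment in a cone direction holds on the segment. -/
theorem DConvex.seg {f : ℝ × ℝ × ℝ → ℝ} (hf : DConvex D3 f) (q B : ℝ × ℝ × ℝ) (hB : B ∈ D3)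
    (M a b s : ℝ) (hs : s ∈ Set.Icc a b)
    (ha : f (q + a • B) ≤ M) (hb : f (q + b • B) ≤ M) : f (q + s • B) ≤ M := by
  have h := (hf q B hB).le_max_of_mem_Icc (Set.mem_univ a) (Set.mem_univ b) hs
  exact h.trans (max_le ha hb)

theorem segX {f : ℝ × ℝ × ℝ → ℝ} (hf : DConvex D3 f) (M a b x y z : ℝ) (hs : x ∈ Set.Icc a b)
    (ha : f (a, y, z) ≤ M) (hb : f (b, y, z) ≤ M) : f (x, y, z) ≤ M := by
  have := hf.seg (0, y, z) (1, 0, 0) (by simp [D3]) M a b x hs (by simpa using ha)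
    (by simpa using hb)
  simpa using this

theorem segY {f : ℝ × ℝ × ℝ → ℝ} (hf : DConvex D3 f) (M a b x y z : ℝ) (hs : y ∈ Set.Icc a b)
    (ha : f (x, a, z) ≤ M) (hb : f (x, b, z) ≤ M) : f (x, y, z) ≤ M := by
  have := hf.seg (x, 0, z) (0, 1, 0) (by simp [D3]) M a b y hs (by simpa using ha)
    (by simpa using hb)
  simpa using this

theorem segZ {f : ℝ × ℝ × ℝ → ℝ} (hf : DConvex D3 f) (M a b x y z : ℝ) (hs : z ∈ Set.Icc a b)
    (ha : f (x, y, a) ≤ M) (hb : f (x, y, b) ≤ M) : f (x, y, z) ≤ M := by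
  have := hf.seg (x, y, 0) (0, 0, 1) (by simp [D3]) M a b z hs (by simpa using ha)
    (by simpa using hb)
  simpa using this

/-- A `D3`-convex function is bounded above on boxes. -/
theorem box_bound {f : ℝ × ℝ × ℝ → ℝ} (hf : DConvex D3 f) (a b a₂ b₂ a₃ b₃ : ℝ) :
    ∃ M, ∀ x ∈ Set.Icc a b, ∀ y ∈ Set.Icc a₂ b₂, ∀ z ∈ Set.Icc a₃ b₃, f (x, y, z) ≤ M := by
  obtain ⟨M, hM⟩ := ((Set.toFinite ({a, b} ×ˢ {a₂, b₂} ×ˢ {a₃, b₃} :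
    Set (ℝ × ℝ × ℝ))).image f).bddAbove
  have key : ∀ x ∈ ({a, b} : Set ℝ), ∀ y ∈ ({a₂, b₂} : Set ℝ), ∀ z ∈ ({a₃, b₃} : Set ℝ),
      f (x, y, z) ≤ M := fun x hx y hy z hz => hM ⟨(x, y, z), ⟨hx, hy, hz⟩, rfl⟩
  refine ⟨M, fun x hx y hy z hz => ?_⟩
  refine segX hf M a b x y z hx ?_ ?_ <;> refine segY hf M a₂ b₂ _ y z hy ?_ ?_ <;>
    refine segZ hf M a₃ b₃ _ _ z hz ?_ ?_ <;> exact key _ (by simp) _ (by simp) _ (by simp)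

theorem near {a q t : ℝ} (ht : 0 < t) (ht1 : t ≤ 1) (h : |q - a| ≤ t) :
    q ∈ Set.Icc (a - 2) (a + 2) ∧ q + (a - q) / t ∈ Set.Icc (a - 2) (a + 2) := by
  have hh := abs_le.1 h
  have h1 : (a - q) / t ≤ 1 := by rw [div_le_one ht]; linarith
  have h2 : -1 ≤ (a - q) / t := by rw [le_div_iff₀ ht]; linarith
  constructor <;> constructor <;> linarith

/-- Sublevel sets of `D3`-convex functions are closed. -/
theorem sublevel_closed {f : ℝ × ℝ × ℝ → ℝ} (hf : DConvex D3 f) (c : ℝ) :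
    IsClosed {A | f A ≤ c} := by
  refine isClosed_of_closure_subset ?_
  rintro ⟨a, b, d⟩ hA
  obtain ⟨M₀, hM₀⟩ := box_bound hf (a - 2) (a + 2) (b - 2) (b + 2) (d - 2) (d + 2)
  obtain ⟨M, hM₀M, hcM⟩ : ∃ M, M₀ ≤ M ∧ c ≤ M := ⟨max M₀ c, le_max_left _ _, le_max_right _ _⟩
  have hM : ∀ x ∈ Set.Icc (a - 2) (a + 2), ∀ y ∈ Set.Icc (b - 2) (b + 2),
      ∀ z ∈ Set.Icc (d - 2) (d + 2), f (x, y, z) ≤ M :=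
    fun x hx y hy z hz => (hM₀ x hx y hy z hz).trans hM₀M
  have key : ∀ t : ℝ, 0 < t → t ≤ 1 → f (a, b, d) ≤ c + t * (3 * (M - c)) := by
    intro t ht ht1
    obtain ⟨⟨x, y, z⟩, hq, hd⟩ := Metric.mem_closure_iff.1 hA t ht
    have hq : f (x, y, z) ≤ c := hq
    rw [dist_comm, Prod.dist_eq, Prod.dist_eq, max_lt_iff, max_lt_iff] at hd
    simp only [Real.dist_eq] at hd
    obtain ⟨hx, hy, hz⟩ := hd
    obtain ⟨x1, x2⟩ := near ht ht1 hx.le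
    obtain ⟨y1, y2⟩ := near ht ht1 hy.le
    obtain ⟨z1, z2⟩ := near ht ht1 hz.le
    have aa : a ∈ Set.Icc (a - 2) (a + 2) := by constructor <;> linarith
    have bb : b ∈ Set.Icc (b - 2) (b + 2) := by constructor <;> linarith
    have ex : t * ((a - x) / t) = a - x := by field_simp
    have ey : t * ((b - y) / t) = b - y := by field_simp
    have ez : t * ((d - z) / t) = d - z := by field_simp
    have s1 := hf.comb (x, y, z) ((a - x) / t, 0, 0) (by simp [D3]) t ht.le ht1
    have s2 := hf.comb (a, y, z) (0, (b - y) / t, 0) (by simp [D3]) t ht.le ht1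
    have s3 := hf.comb (a, b, z) (0, 0, (d - z) / t) (by simp [D3]) t ht.le ht1
    simp only [Prod.smul_mk, smul_eq_mul, mul_zero, Prod.mk_add_mk, add_zero, ex, ey, ez,
      add_sub_cancel] at s1 s2 s3
    have m1 := mul_le_mul_of_nonneg_left (hM _ x2 _ y1 _ z1) ht.le
    have m2 := mul_le_mul_of_nonneg_left (hM _ aa _ y2 _ z1) ht.le
    have m3 := mul_le_mul_of_nonneg_left (hM _ aa _ bb _ z2) ht.le
    have h1t : 0 ≤ 1 - t := by linarith
    have tM : 0 ≤ t * (t * (M - c)) := mul_nonneg ht.le (mul_nonneg ht.le (by linarith))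
    have r1 : f (a, y, z) ≤ c + t * (M - c) := by
      have := mul_le_mul_of_nonneg_left hq h1t
      linarith
    have r2 : f (a, b, z) ≤ c + t * (2 * (M - c)) := by
      have := mul_le_mul_of_nonneg_left r1 h1t
      linarith
    have := mul_le_mul_of_nonneg_left r2 h1t
    linarith
  have hlim : Filter.Tendsto (fun t : ℝ => c + t * (3 * (M - c))) (nhdsWithin 0 (Set.Ioi 0))
      (nhds c) := by
    have : Continuous (fun t : ℝ => c + t * (3 * (M - c))) := by fun_prop
    have h := this.tendsto 0
    simp only [zero_mul, add_zero] at h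
    exact h.mono_left nhdsWithin_le_nhds
  refine ge_of_tendsto hlim ?_
  filter_upwards [Ioc_mem_nhdsGT (zero_lt_one : (0 : ℝ) < 1)] with t ht
  exact key t ht.1 ht.2

theorem linear_dconvex (l : (ℝ × ℝ × ℝ) →ₗ[ℝ] ℝ) : DConvex D3 l := by
  intro A B _
  refine ⟨convex_univ, fun s _ t _ p q _ _ hpq => le_of_eq ?_⟩
  simp only [map_add, map_smul, smul_eq_mul]
  linear_combination (-(l A)) * hpq

theorem hull_closed (K : Set (ℝ × ℝ × ℝ)) : IsClosed (DConvexHull D3 K) := by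
  have : DConvexHull D3 K = ⋂ f : ℝ × ℝ × ℝ → ℝ, ⋂ _ : DConvex D3 f,
      {A | f A ≤ sSup (f '' K)} := by
    ext A; simp [DConvexHull]
  rw [this]
  exact isClosed_iInter fun f => isClosed_iInter fun hf => sublevel_closed hf _

theorem hull_lin (K : Set (ℝ × ℝ × ℝ)) (l : (ℝ × ℝ × ℝ) →ₗ[ℝ] ℝ) :
    ∃ m M, ∀ A ∈ DConvexHull D3 K, m ≤ l A ∧ l A ≤ M := by
  refine ⟨-sSup ((-l : (ℝ × ℝ × ℝ) →ₗ[ℝ] ℝ) '' K), sSup (l '' K), fun A hA => ⟨?_, ?_⟩⟩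
  · have := hA _ (linear_dconvex (-l))
    rw [LinearMap.neg_apply] at this
    linarith
  · exact hA _ (linear_dconvex l)

theorem hull_compact (K : Set (ℝ × ℝ × ℝ)) : IsCompact (DConvexHull D3 K) := by
  obtain ⟨m1, M1, h1⟩ := hull_lin K (LinearMap.fst ℝ ℝ (ℝ × ℝ))
  obtain ⟨m2, M2, h2⟩ := hull_lin K (LinearMap.fst ℝ ℝ ℝ ∘ₗ LinearMap.snd ℝ ℝ (ℝ × ℝ))
  obtain ⟨m3, M3, h3⟩ := hull_lin K (LinearMap.snd ℝ ℝ ℝ ∘ₗ LinearMap.snd ℝ ℝ (ℝ × ℝ))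
  refine IsCompact.of_isClosed_subset
    ((isCompact_Icc (a := m1) (b := M1)).prod
      ((isCompact_Icc (a := m2) (b := M2)).prod (isCompact_Icc (a := m3) (b := M3))))
    (hull_closed K) ?_
  exact fun A hA => ⟨h1 A hA, h2 A hA, h3 A hA⟩

/-- The triangular hull of a finite set is compact, and each of its vertical fibers is a
(possibly empty) closed bounded interval `Icc a b`. -/
theorem rc_hull_compact_vertical_fibers (K : Set (ℝ × ℝ × ℝ)) (hK : K.Finite) :
    IsCompact (DConvexHull D3 K) ∧
    ∀ x₀ y₀ : ℝ, ∃ a b : ℝ,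
      {z : ℝ | (x₀, y₀, z) ∈ DConvexHull D3 K} = Set.Icc a b := by
  refine ⟨hull_compact K, fun x y => ?_⟩
  rcases Set.eq_empty_or_nonempty {z : ℝ | (x, y, z) ∈ DConvexHull D3 K} with h | h
  · exact ⟨1, 0, by rw [h]; simp⟩
  have hc : IsCompact {z : ℝ | (x, y, z) ∈ DConvexHull D3 K} := by
    obtain ⟨m3, M3, h3⟩ := hull_lin K (LinearMap.snd ℝ ℝ ℝ ∘ₗ LinearMap.snd ℝ ℝ (ℝ × ℝ))
    refine IsCompact.of_isClosed_subset (isCompact_Icc (a := m3) (b := M3)) ?_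
      (fun z hz => h3 _ hz)
    exact (hull_closed K).preimage (f := fun z : ℝ => (x, y, z)) (by fun_prop)
  have ho : Set.OrdConnected {z : ℝ | (x, y, z) ∈ DConvexHull D3 K} :=
    ⟨fun a ha b hb z hz f hf => segZ hf _ a b x y z hz (ha f hf) (hb f hf)⟩
  exact ⟨_, _, eq_Icc_of_connected_compact ⟨h, ho.isPreconnected⟩ hc⟩
end

section
/- Let u, w ∈ ℝ² be linearly independent vectors such that the angle between u and w is π/3 and the ratio ‖u‖/‖w‖ is irrational, and let P = {v + s·u + t·w : s, t ∈ [0,1]} for some v ∈ ℝ² be the associated parallelogram. Then there is no finite family T₁, …, T_m of equilateral triangles in ℝ² (each T_j being the convex hull of three non-collinear points that are pairwise at equal distance) with pairwise disjoint interiors such that P = T₁ ∪ … ∪ T_m. -/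
namespace EqTiling

open Filter Topology

def lexnn (a b c : ℝ) : Prop := 0 < a ∨ (a = 0 ∧ (0 < b ∨ (b = 0 ∧ 0 ≤ c)))

lemma ev_pos0 (a b c : ℝ) (ha : 0 < a) : ∀ᶠ ε : ℝ in 𝓝[>] 0, 0 < a + b * ε + c * ε ^ 2 := by
  have h : Tendsto (fun ε : ℝ => a + b * ε + c * ε ^ 2) (𝓝[>] 0) (𝓝 (a + b * 0 + c * 0 ^ 2)) :=
    (Continuous.tendsto (by fun_prop) 0).mono_left nhdsWithin_le_nhds
  exact h.eventually (lt_mem_nhds (by simpa using ha))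

lemma ev_pos1 (b c : ℝ) (hb : 0 < b) : ∀ᶠ ε : ℝ in 𝓝[>] 0, 0 < b * ε + c * ε ^ 2 := by
  filter_upwards [ev_pos0 b c 0 hb, self_mem_nhdsWithin] with ε h h0
  have h0 : 0 < ε := h0
  have := mul_pos h h0
  nlinarith

lemma ev_lex (a b c : ℝ) :
    ∀ᶠ ε : ℝ in 𝓝[>] 0, (0 ≤ a + b * ε + c * ε ^ 2 ↔ lexnn a b c) := by
  unfold lexnn
  rcases lt_trichotomy a 0 with ha | ha | ha
  · filter_upwards [ev_pos0 (-a) (-b) (-c) (by linarith)] with ε h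
    constructor
    · intro h'; linarith
    · rintro (h' | ⟨h', -⟩) <;> linarith
  · subst ha
    rcases lt_trichotomy b 0 with hb | hb | hb
    · filter_upwards [ev_pos1 (-b) (-c) (by linarith)] with ε h
      constructor
      · intro h'; linarith
      · rintro (h' | ⟨-, h' | ⟨h', -⟩⟩) <;> linarith
    · subst hb
      filter_upwards [self_mem_nhdsWithin] with ε h0
      have h0 : 0 < ε := h0
      have h2 : 0 < ε ^ 2 := by positivity
      simp [h2]
    · filter_upwards [ev_pos1 b c hb] with ε h
      simp [hb]; linarith
  · filter_upwards [ev_pos0 a b c ha] with ε h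
    simp [ha]; linarith

lemma ev_ne (a b c : ℝ) (h : b ≠ 0 ∨ c ≠ 0) :
    ∀ᶠ ε : ℝ in 𝓝[>] 0, a + b * ε + c * ε ^ 2 ≠ 0 := by
  rcases lt_trichotomy a 0 with ha | ha | ha
  · filter_upwards [ev_pos0 (-a) (-b) (-c) (by linarith)] with ε h h'
    linarith
  · subst ha
    rcases lt_trichotomy b 0 with hb | hb | hb
    · filter_upwards [ev_pos1 (-b) (-c) (by linarith)] with ε h h'
      linarith
    · subst hb
      filter_upwards [self_mem_nhdsWithin] with ε h0
      have h0 : 0 < ε := h0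
      simp at h
      simp [h, h0.ne']
    · filter_upwards [ev_pos1 b c hb] with ε h h'
      linarith
  · filter_upwards [ev_pos0 a b c ha] with ε h h'
    linarith

/-- value of an affine form -/
def ev (F : ℝ × ℝ × ℝ) (q : ℝ × ℝ) : ℝ := F.1 + F.2.1 * q.1 + F.2.2 * q.2

/-- linear part of an affine form -/
def lin (F : ℝ × ℝ × ℝ) (q : ℝ × ℝ) : ℝ := F.2.1 * q.1 + F.2.2 * q.2

def poly {ι : Type} (F : ι → ℝ × ℝ × ℝ) : Set (ℝ × ℝ) := {q | ∀ i, 0 ≤ ev (F i) q}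

def pt (p e n : ℝ × ℝ) (σ τ ε : ℝ) : ℝ × ℝ :=
  (p.1 + σ * ε * e.1 + τ * ε ^ 2 * n.1, p.2 + σ * ε * e.2 + τ * ε ^ 2 * n.2)

lemma ev_pt (F : ℝ × ℝ × ℝ) (p e n : ℝ × ℝ) (σ τ ε : ℝ) :
    ev F (pt p e n σ τ ε) = ev F p + (σ * lin F e) * ε + (τ * lin F n) * ε ^ 2 := by
  simp only [ev, pt, lin]; ring

lemma ev_mem {ι : Type} [Finite ι] (F : ι → ℝ × ℝ × ℝ) (p e n : ℝ × ℝ) (σ τ : ℝ) :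
    ∀ᶠ ε : ℝ in 𝓝[>] 0, (pt p e n σ τ ε ∈ poly F ↔
      ∀ i, lexnn (ev (F i) p) (σ * lin (F i) e) (τ * lin (F i) n)) := by
  have h : ∀ᶠ ε : ℝ in 𝓝[>] 0, ∀ i, (0 ≤ ev (F i) (pt p e n σ τ ε) ↔
      lexnn (ev (F i) p) (σ * lin (F i) e) (τ * lin (F i) n)) := by
    rw [eventually_all]
    intro i
    filter_upwards [ev_lex (ev (F i) p) (σ * lin (F i) e) (τ * lin (F i) n)] with ε h
    rw [ev_pt]; exact h
  filter_upwards [h] with ε h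
  exact forall_congr' h

open Classical in
noncomputable def ind (S : Set (ℝ × ℝ)) (p : ℝ × ℝ) : ℚ := if p ∈ S then 1 else 0

noncomputable def chi (S : Set (ℝ × ℝ)) (p e n : ℝ × ℝ) (ε : ℝ) : ℚ :=
  ind S (pt p e n 1 1 ε) - ind S (pt p e n 1 (-1) ε)
    - ind S (pt p e n (-1) 1 ε) + ind S (pt p e n (-1) (-1) ε)

def HasJump (S : Set (ℝ × ℝ)) (e n : ℝ × ℝ) (D : ℝ × ℝ →₀ ℚ) : Prop :=
  ∀ p, ∀ᶠ ε : ℝ in 𝓝[>] 0, chi S p e n ε = D p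

open Classical in
lemma ev_chi {ι : Type} [Finite ι] (F : ι → ℝ × ℝ × ℝ) (p e n : ℝ × ℝ) :
    ∀ᶠ ε : ℝ in 𝓝[>] 0, chi (poly F) p e n ε =
      (if ∀ i, lexnn (ev (F i) p) (lin (F i) e) (lin (F i) n) then 1 else 0)
      - (if ∀ i, lexnn (ev (F i) p) (lin (F i) e) (-lin (F i) n) then 1 else 0)
      - (if ∀ i, lexnn (ev (F i) p) (-lin (F i) e) (lin (F i) n) then 1 else 0)
      + (if ∀ i, lexnn (ev (F i) p) (-lin (F i) e) (-lin (F i) n) then 1 else 0) := by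
  filter_upwards [ev_mem F p e n 1 1, ev_mem F p e n 1 (-1), ev_mem F p e n (-1) 1,
    ev_mem F p e n (-1) (-1)] with ε h1 h2 h3 h4
  simp only [chi, ind, h1, h2, h3, h4, one_mul, neg_one_mul]

/-- positively oriented equilateral triangle in skew coordinates -/
def tri (A : ℝ × ℝ) (x y : ℝ) : Fin 3 → ℝ × ℝ × ℝ :=
  ![(y * A.1 - x * A.2, -y, x),
    (x ^ 2 + x * y + y ^ 2 + x * A.1 + (x + y) * A.2, -x, -(x + y)),
    (-((x + y) * A.1) - y * A.2, x + y, y)]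

lemma lexnn_indep (a b c c' : ℝ) (hb : b ≠ 0) : lexnn a b c ↔ lexnn a b c' := by
  simp [lexnn, hb]

lemma jump_zero {ι : Type} [Finite ι] (F : ι → ℝ × ℝ × ℝ) (e n : ℝ × ℝ)
    (h : ∀ i, lin (F i) e ≠ 0) : HasJump (poly F) e n 0 := by
  classical
  intro p
  filter_upwards [ev_chi F p e n] with ε hε
  rw [hε]
  have h1 : ∀ i, lexnn (ev (F i) p) (lin (F i) e) (-lin (F i) n) ↔
    lexnn (ev (F i) p) (lin (F i) e) (lin (F i) n) := fun i => lexnn_indep _ _ _ _ (h i)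
  have h2 : ∀ i, lexnn (ev (F i) p) (-lin (F i) e) (-lin (F i) n) ↔
    lexnn (ev (F i) p) (-lin (F i) e) (lin (F i) n) :=
      fun i => lexnn_indep _ _ _ _ (neg_ne_zero.2 (h i))
  simp only [h1, h2, Finsupp.coe_zero, Pi.zero_apply]
  ring

lemma single_ap (q p : ℝ × ℝ) (X Y : ℝ) (hX : p.1 = q.1 + X) (hY : p.2 = q.2 + Y) (c : ℚ) :
    Finsupp.single q c p = if X = 0 ∧ Y = 0 then c else 0 := by
  classical
  rw [Finsupp.single_apply]
  congr 1
  rw [Prod.ext_iff, hX, hY]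
  simp

lemma jump_rect1 (a b : ℝ) (ha : 0 < a) (hb : 0 < b) (F : Fin 4 → ℝ × ℝ × ℝ)
    (hF : F = ![(0, 1, 0), (a, -1, 0), (0, 0, 1), (b, 0, -1)]) :
    HasJump (poly F) (1, 0) (0, 1)
      (Finsupp.single (0, 0) 1 - Finsupp.single (a, 0) 1 - Finsupp.single (0, b) 1
        + Finsupp.single (a, b) 1) := by
  classical
  rintro ⟨X, Y⟩
  filter_upwards [ev_chi F (X, Y) (1, 0) (0, 1)] with ε hε
  rw [hε]
  subst hF
  simp only [Finsupp.add_apply, Finsupp.sub_apply, Finsupp.single_apply, Fin.forall_fin_succ,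
    Prod.mk.injEq, ev, lin, lexnn]
  simp
  rcases lt_trichotomy X 0 with hX | hX | hX <;> rcases lt_trichotomy X a with hX' | hX' | hX' <;>
  rcases lt_trichotomy Y 0 with hY | hY | hY <;> rcases lt_trichotomy Y b with hY' | hY' | hY' <;>
  first | (exfalso; linarith) | grind

lemma jump_rect2 (a b : ℝ) (ha : 0 < a) (hb : 0 < b) (F : Fin 4 → ℝ × ℝ × ℝ)
    (hF : F = ![(0, 1, 0), (a, -1, 0), (0, 0, 1), (b, 0, -1)]) :
    HasJump (poly F) (0, 1) (1, 0)
      (Finsupp.single (0, 0) 1 - Finsupp.single (a, 0) 1 - Finsupp.single (0, b) 1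
        + Finsupp.single (a, b) 1) := by
  classical
  rintro ⟨X, Y⟩
  filter_upwards [ev_chi F (X, Y) (0, 1) (1, 0)] with ε hε
  rw [hε]
  subst hF
  simp only [Finsupp.add_apply, Finsupp.sub_apply, Finsupp.single_apply, Fin.forall_fin_succ,
    Prod.mk.injEq, ev, lin, lexnn]
  simp
  rcases lt_trichotomy X 0 with hX | hX | hX <;> rcases lt_trichotomy X a with hX' | hX' | hX' <;>
  rcases lt_trichotomy Y 0 with hY | hY | hY <;> rcases lt_trichotomy Y b with hY' | hY' | hY' <;>
  first | (exfalso; linarith) | grind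

lemma lexnn_mul_pos (s a b c : ℝ) (hs : 0 < s) :
    lexnn (s * a) (s * b) (s * c) ↔ lexnn a b c := by
  simp [lexnn, hs, hs.ne']

lemma lexnn_mul_neg (s a b c : ℝ) (hs : s < 0) :
    lexnn (s * a) (s * b) (s * c) ↔ lexnn (-a) (-b) (-c) := by
  rw [← lexnn_mul_pos (-s) (-a) (-b) (-c) (by linarith)]
  simp

lemma jump_al1 (A : ℝ × ℝ) (s : ℝ) (hs : s ≠ 0) :
    HasJump (poly (tri A s 0)) (1, 0) (0, 1)
      (Finsupp.single A 1 - Finsupp.single (A.1 + s, A.2) 1) := by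
  classical
  intro p
  filter_upwards [ev_chi (tri A s 0) p (1, 0) (0, 1)] with ε hε
  rw [hε]
  obtain ⟨X, hX⟩ : ∃ X, p.1 = A.1 + X := ⟨p.1 - A.1, by ring⟩
  obtain ⟨Y, hY⟩ : ∃ Y, p.2 = A.2 + Y := ⟨p.2 - A.2, by ring⟩
  have e0 : ev (tri A s 0 0) p = s * Y := by simp [ev, tri, hX, hY]; ring
  have e1 : ev (tri A s 0 1) p = s * (s - X - Y) := by simp [ev, tri, hX, hY]; ring
  have e2 : ev (tri A s 0 2) p = s * X := by simp [ev, tri, hX, hY]; ring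
  have l0 : ∀ q, lin (tri A s 0 0) q = s * q.2 := by intro q; simp [lin, tri]
  have l1 : ∀ q, lin (tri A s 0 1) q = s * (- q.1 - q.2) := by intro q; simp [lin, tri]; ring
  have l2 : ∀ q, lin (tri A s 0 2) q = s * q.1 := by intro q; simp [lin, tri]
  rw [Finsupp.sub_apply, single_ap A p X Y hX hY,
    single_ap (A.1 + s, A.2) p (X - s) Y (by simp [hX]) (by simp [hY])]
  have f3 : ∀ Q : Fin 3 → Prop, (∀ i, Q i) ↔ (Q 0 ∧ Q 1 ∧ Q 2) := by
    intro Q; simp [Fin.forall_fin_succ]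
  simp only [f3, e0, e1, e2, l0, l1, l2]
  rcases lt_or_gt_of_ne hs with hs' | hs'
  · simp only [lexnn_mul_neg _ _ _ _ hs', ← mul_neg]
    simp only [lexnn]
    simp
    rcases lt_trichotomy X 0 with hX | hX | hX <;> rcases lt_trichotomy Y 0 with hY | hY | hY <;>
    rcases lt_trichotomy (X + Y) s with hZ | hZ | hZ <;>
    first | (exfalso; linarith) | grind
  · simp only [lexnn_mul_pos _ _ _ _ hs', ← mul_neg]
    simp only [lexnn]
    simp
    rcases lt_trichotomy X 0 with hX | hX | hX <;> rcases lt_trichotomy Y 0 with hY | hY | hY <;>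
    rcases lt_trichotomy (X + Y) s with hZ | hZ | hZ <;>
    first | (exfalso; linarith) | grind

lemma jump_al2 (A : ℝ × ℝ) (s : ℝ) (hs : s ≠ 0) :
    HasJump (poly (tri A s 0)) (0, 1) (1, 0)
      (Finsupp.single A 1 - Finsupp.single (A.1, A.2 + s) 1) := by
  classical
  intro p
  filter_upwards [ev_chi (tri A s 0) p (0, 1) (1, 0)] with ε hε
  rw [hε]
  obtain ⟨X, hX⟩ : ∃ X, p.1 = A.1 + X := ⟨p.1 - A.1, by ring⟩
  obtain ⟨Y, hY⟩ : ∃ Y, p.2 = A.2 + Y := ⟨p.2 - A.2, by ring⟩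
  have e0 : ev (tri A s 0 0) p = s * Y := by simp [ev, tri, hX, hY]; ring
  have e1 : ev (tri A s 0 1) p = s * (s - X - Y) := by simp [ev, tri, hX, hY]; ring
  have e2 : ev (tri A s 0 2) p = s * X := by simp [ev, tri, hX, hY]; ring
  have l0 : ∀ q, lin (tri A s 0 0) q = s * q.2 := by intro q; simp [lin, tri]
  have l1 : ∀ q, lin (tri A s 0 1) q = s * (- q.1 - q.2) := by intro q; simp [lin, tri]; ring
  have l2 : ∀ q, lin (tri A s 0 2) q = s * q.1 := by intro q; simp [lin, tri]
  rw [Finsupp.sub_apply, single_ap A p X Y hX hY,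
    single_ap (A.1, A.2 + s) p X (Y - s) (by simp [hX]) (by simp [hY])]
  have f3 : ∀ Q : Fin 3 → Prop, (∀ i, Q i) ↔ (Q 0 ∧ Q 1 ∧ Q 2) := by
    intro Q; simp [Fin.forall_fin_succ]
  simp only [f3, e0, e1, e2, l0, l1, l2]
  rcases lt_or_gt_of_ne hs with hs' | hs'
  · simp only [lexnn_mul_neg _ _ _ _ hs', ← mul_neg]
    simp only [lexnn]
    simp
    rcases lt_trichotomy X 0 with hX | hX | hX <;> rcases lt_trichotomy Y 0 with hY | hY | hY <;>
    rcases lt_trichotomy (X + Y) s with hZ | hZ | hZ <;>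
    first | (exfalso; linarith) | grind
  · simp only [lexnn_mul_pos _ _ _ _ hs', ← mul_neg]
    simp only [lexnn]
    simp
    rcases lt_trichotomy X 0 with hX | hX | hX <;> rcases lt_trichotomy Y 0 with hY | hY | hY <;>
    rcases lt_trichotomy (X + Y) s with hZ | hZ | hZ <;>
    first | (exfalso; linarith) | grind

lemma jump_al3 (A : ℝ × ℝ) (s : ℝ) (hs : s ≠ 0) :
    HasJump (poly (tri A s 0)) (1, -1) (0, 1)
      (Finsupp.single (A.1 + s, A.2) 1 - Finsupp.single (A.1, A.2 + s) 1) := by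
  classical
  intro p
  filter_upwards [ev_chi (tri A s 0) p (1, -1) (0, 1)] with ε hε
  rw [hε]
  obtain ⟨X, hX⟩ : ∃ X, p.1 = A.1 + X := ⟨p.1 - A.1, by ring⟩
  obtain ⟨Y, hY⟩ : ∃ Y, p.2 = A.2 + Y := ⟨p.2 - A.2, by ring⟩
  have e0 : ev (tri A s 0 0) p = s * Y := by simp [ev, tri, hX, hY]; ring
  have e1 : ev (tri A s 0 1) p = s * (s - X - Y) := by simp [ev, tri, hX, hY]; ring
  have e2 : ev (tri A s 0 2) p = s * X := by simp [ev, tri, hX, hY]; ring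
  have l0 : ∀ q, lin (tri A s 0 0) q = s * q.2 := by intro q; simp [lin, tri]
  have l1 : ∀ q, lin (tri A s 0 1) q = s * (- q.1 - q.2) := by intro q; simp [lin, tri]; ring
  have l2 : ∀ q, lin (tri A s 0 2) q = s * q.1 := by intro q; simp [lin, tri]
  rw [Finsupp.sub_apply, single_ap (A.1, A.2 + s) p X (Y - s) (by simp [hX]) (by simp [hY]),
    single_ap (A.1 + s, A.2) p (X - s) Y (by simp [hX]) (by simp [hY])]
  have f3 : ∀ Q : Fin 3 → Prop, (∀ i, Q i) ↔ (Q 0 ∧ Q 1 ∧ Q 2) := by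
    intro Q; simp [Fin.forall_fin_succ]
  simp only [f3, e0, e1, e2, l0, l1, l2]
  rcases lt_or_gt_of_ne hs with hs' | hs'
  · simp only [lexnn_mul_neg _ _ _ _ hs', ← mul_neg]
    simp only [lexnn]
    simp
    rcases lt_trichotomy X 0 with hX | hX | hX <;> rcases lt_trichotomy Y 0 with hY | hY | hY <;>
    rcases lt_trichotomy (X + Y) s with hZ | hZ | hZ <;>
    first | (exfalso; linarith) | grind
  · simp only [lexnn_mul_pos _ _ _ _ hs', ← mul_neg]
    simp only [lexnn]
    simp
    rcases lt_trichotomy X 0 with hX | hX | hX <;> rcases lt_trichotomy Y 0 with hY | hY | hY <;>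
    rcases lt_trichotomy (X + Y) s with hZ | hZ | hZ <;>
    first | (exfalso; linarith) | grind

end EqTiling



namespace EqTiling

open Filter Topology

lemma tri_x0 (A : ℝ × ℝ) (y : ℝ) : poly (tri A 0 y) = poly (tri (A.1, A.2 + y) (-y) 0) := by
  ext p
  simp only [poly, Set.mem_ofPred_eq, Fin.forall_fin_succ, tri, ev]
  simp
  constructor
  · rintro ⟨h1, h2, h3⟩
    refine ⟨?_, ?_, ?_⟩ <;> linarith
  · rintro ⟨h1, h2, h3⟩
    refine ⟨?_, ?_, ?_⟩ <;> linarith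

lemma tri_xy0 (A : ℝ × ℝ) (x : ℝ) :
    poly (tri A x (-x)) = poly (tri (A.1 + x, A.2) (-x) 0) := by
  ext p
  simp only [poly, Set.mem_ofPred_eq, Fin.forall_fin_succ, tri, ev]
  simp
  constructor
  · rintro ⟨h1, h2, h3⟩
    refine ⟨?_, ?_, ?_⟩ <;> linarith
  · rintro ⟨h1, h2, h3⟩
    refine ⟨?_, ?_, ?_⟩ <;> linarith

def g1 (f : ℝ →+ ℚ) (p : ℝ × ℝ) : ℚ := f p.1 * f p.2
def g3 (f : ℝ →+ ℚ) (p : ℝ × ℝ) : ℚ := f p.1 * f (p.1 + p.2)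

noncomputable def tot (f : ℝ →+ ℚ) (D : Fin 3 → ℝ × ℝ →₀ ℚ) : ℚ :=
  Finsupp.linearCombination ℚ (g1 f) (D 0) + Finsupp.linearCombination ℚ (g1 f) (D 1)
    + Finsupp.linearCombination ℚ (g3 f) (D 2)

def dirE : Fin 3 → ℝ × ℝ := ![(1, 0), (0, 1), (1, -1)]
def dirN : Fin 3 → ℝ × ℝ := ![(0, 1), (1, 0), (0, 1)]

lemma tile_al (f : ℝ →+ ℚ) (A : ℝ × ℝ) (s : ℝ) (hs : s ≠ 0) :
    ∃ D : Fin 3 → ℝ × ℝ →₀ ℚ, (∀ k, HasJump (poly (tri A s 0)) (dirE k) (dirN k) (D k)) ∧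
      ∃ c : ℚ, tot f D = c ^ 2 := by
  refine ⟨![Finsupp.single A 1 - Finsupp.single (A.1 + s, A.2) 1,
    Finsupp.single A 1 - Finsupp.single (A.1, A.2 + s) 1,
    Finsupp.single (A.1 + s, A.2) 1 - Finsupp.single (A.1, A.2 + s) 1], ?_, f s, ?_⟩
  · intro k
    fin_cases k
    · exact jump_al1 A s hs
    · exact jump_al2 A s hs
    · exact jump_al3 A s hs
  · simp [tot, g1, g3, map_sub, Finsupp.linearCombination_single]
    ring

lemma tile_jump (f : ℝ →+ ℚ) (A : ℝ × ℝ) (x y : ℝ) (h : x ≠ 0 ∨ y ≠ 0) :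
    ∃ D : Fin 3 → ℝ × ℝ →₀ ℚ, (∀ k, HasJump (poly (tri A x y)) (dirE k) (dirN k) (D k)) ∧
      ∃ c : ℚ, tot f D = c ^ 2 := by
  by_cases hy : y = 0
  · subst hy
    exact tile_al f A x (by simpa using h)
  by_cases hx : x = 0
  · subst hx
    rw [tri_x0]
    exact tile_al f _ _ (by simpa using h)
  by_cases hxy : x + y = 0
  · obtain rfl : y = -x := by linarith
    rw [tri_xy0]
    exact tile_al f _ _ (by simpa using hx)
  refine ⟨fun _ => 0, ?_, 0, by simp [tot]⟩
  intro k
  apply jump_zero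
  have hxy' : y + x ≠ 0 := by rwa [add_comm]
  intro i
  fin_cases k <;> fin_cases i <;> simp [lin, tri, dirE] <;> grind

lemma rect_jump (f : ℝ →+ ℚ) (a b : ℝ) (ha : 0 < a) (hb : 0 < b) :
    ∃ D : Fin 3 → ℝ × ℝ →₀ ℚ,
      (∀ k, HasJump (poly ![(0, 1, 0), (a, -1, 0), (0, 0, 1), (b, 0, -1)])
        (dirE k) (dirN k) (D k)) ∧ tot f D = 2 * f a * f b := by
  refine ⟨![Finsupp.single (0, 0) 1 - Finsupp.single (a, 0) 1 - Finsupp.single (0, b) 1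
        + Finsupp.single (a, b) 1, Finsupp.single (0, 0) 1 - Finsupp.single (a, 0) 1
        - Finsupp.single (0, b) 1 + Finsupp.single (a, b) 1, 0], ?_, ?_⟩
  · intro k
    fin_cases k
    · exact jump_rect1 a b ha hb _ rfl
    · exact jump_rect2 a b ha hb _ rfl
    · apply jump_zero
      intro i
      fin_cases i <;> simp [lin, dirE]
  · simp [tot, g1, map_sub, Finsupp.linearCombination_single]
    ring

lemma ind_sum {m : ℕ} (P : Set (ℝ × ℝ)) (F : Fin m → Fin 3 → ℝ × ℝ × ℝ)
    (hF : ∀ j i, (F j i).2.1 ≠ 0 ∨ (F j i).2.2 ≠ 0)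
    (hcov : ∀ p, p ∈ P ↔ ∃ j, p ∈ poly (F j))
    (hdisj : ∀ i j, i ≠ j → ∀ p, (∀ k, 0 < ev (F i k) p) → ¬ (∀ k, 0 < ev (F j k) p))
    (p e n : ℝ × ℝ) (hen : e.1 * n.2 - e.2 * n.1 ≠ 0) (σ τ : ℝ) (hσ : σ ≠ 0) (hτ : τ ≠ 0) :
    ∀ᶠ ε : ℝ in 𝓝[>] 0, ind P (pt p e n σ τ ε) = ∑ j, ind (poly (F j)) (pt p e n σ τ ε) := by
  have h : ∀ᶠ ε : ℝ in 𝓝[>] 0, ∀ j i, ev (F j i) (pt p e n σ τ ε) ≠ 0 := by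
    rw [eventually_all]; intro j
    rw [eventually_all]; intro i
    have : σ * lin (F j i) e ≠ 0 ∨ τ * lin (F j i) n ≠ 0 := by
      by_contra! hc
      obtain ⟨h1, h2⟩ := hc
      have h1 : lin (F j i) e = 0 := by simpa [hσ] using h1
      have h2 : lin (F j i) n = 0 := by simpa [hτ] using h2
      simp only [lin] at h1 h2
      rcases hF j i with h | h <;> apply h
      · have : (F j i).2.1 * (e.1 * n.2 - e.2 * n.1) = 0 := by
          linear_combination n.2 * h1 - e.2 * h2
        simpa [hen] using this
      · have : (F j i).2.2 * (e.1 * n.2 - e.2 * n.1) = 0 := by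
          linear_combination -n.1 * h1 + e.1 * h2
        simpa [hen] using this
    filter_upwards [ev_ne (ev (F j i) p) _ _ this] with ε hε
    rw [ev_pt]; exact hε
  filter_upwards [h] with ε h
  set q := pt p e n σ τ ε
  have hs : ∀ j, q ∈ poly (F j) → ∀ k, 0 < ev (F j k) q :=
    fun j hj k => lt_of_le_of_ne (hj k) (h j k).symm
  by_cases hq : q ∈ P
  · obtain ⟨j, hj⟩ := (hcov q).1 hq
    rw [Finset.sum_eq_single j]
    · simp [ind, hq, hj]
    · intro i _ hij
      have : q ∉ poly (F i) := fun hi => hdisj i j hij q (hs i hi) (hs j hj)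
      simp [ind, this]
    · simp
  · have : ∀ j, q ∉ poly (F j) := fun j hj => hq ((hcov q).2 ⟨j, hj⟩)
    simp [ind, hq, this]

lemma core {m : ℕ} (a b : ℝ) (ha : 0 < a) (hb : 0 < b) (A : Fin m → ℝ × ℝ) (x y : Fin m → ℝ)
    (hxy : ∀ j, x j ≠ 0 ∨ y j ≠ 0)
    (hcov : ∀ p : ℝ × ℝ, (0 ≤ p.1 ∧ p.1 ≤ a ∧ 0 ≤ p.2 ∧ p.2 ≤ b) ↔
      ∃ j, p ∈ poly (tri (A j) (x j) (y j)))
    (hdisj : ∀ i j, i ≠ j → ∀ p, (∀ k, 0 < ev (tri (A i) (x i) (y i) k) p) →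
      ¬ (∀ k, 0 < ev (tri (A j) (x j) (y j) k) p)) (f : ℝ →+ ℚ) :
    0 ≤ f a * f b := by
  choose D hD c hc using fun j => tile_jump f (A j) (x j) (y j) (hxy j)
  obtain ⟨DP, hDP, hPt⟩ := rect_jump f a b ha hb
  have key : ∀ k, DP k = ∑ j, D j k := by
    intro k
    have hen : (dirE k).1 * (dirN k).2 - (dirE k).2 * (dirN k).1 ≠ 0 := by
      fin_cases k <;> simp [dirE, dirN]
    ext p
    have hs := fun σ τ hσ hτ => ind_sum (poly ![(0, 1, 0), (a, -1, 0), (0, 0, 1), (b, 0, -1)])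
      (fun j => tri (A j) (x j) (y j)) (by
        intro j i
        have := hxy j
        fin_cases i <;> simp [tri] <;> grind) (by
        intro p
        rw [← hcov]
        simp [poly, Fin.forall_fin_succ, ev]
        ) hdisj p (dirE k) (dirN k)
        hen σ τ hσ hτ
    have hall : ∀ᶠ ε : ℝ in 𝓝[>] 0, ∀ j,
        chi (poly (tri (A j) (x j) (y j))) p (dirE k) (dirN k) ε = D j k p := by
      rw [eventually_all]
      exact fun j => hD j k p
    have : ∀ᶠ ε : ℝ in 𝓝[>] 0, DP k p = (∑ j, D j k) p := by
      filter_upwards [hs 1 1 (by simp) (by simp), hs 1 (-1) (by simp) (by simp),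
        hs (-1) 1 (by simp) (by simp), hs (-1) (-1) (by simp) (by simp), hall, hDP k p]
        with ε h1 h2 h3 h4 h5 h6
      rw [← h6, Finsupp.finsetSum_apply]
      simp only [← h5, chi, h1, h2, h3, h4, Finset.sum_add_distrib, Finset.sum_sub_distrib]
    exact this.exists.choose_spec
  have : tot f DP = ∑ j, c j ^ 2 := by
    simp only [← hc, tot, key, map_sum, Finset.sum_add_distrib]
  have h0 : 0 ≤ ∑ j, c j ^ 2 := Finset.sum_nonneg fun j _ => sq_nonneg _
  linarith

lemma no_f (a b : ℝ) (hb : 0 < b) (h : Irrational (a / b)) :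
    ∃ f : ℝ →+ ℚ, f a * f b < 0 := by
  have hli : LinearIndependent ℚ ![a, b] := by
    rw [LinearIndependent.pair_iff]
    intro s t hst
    have hs : s = 0 := by
      by_contra hs
      apply h
      refine ⟨-t / s, ?_⟩
      have hs' : (s : ℝ) ≠ 0 := by exact_mod_cast hs
      simp only [Rat.smul_def] at hst
      push_cast
      field_simp
      linarith
    subst hs
    simpa [Rat.smul_def, hb.ne'] using hst
  obtain ⟨g, hg⟩ := (Finsupp.linearCombination ℚ ![a, b]).exists_leftInverse_of_injective
    (LinearMap.ker_eq_bot.2 hli)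
  have h0 : g a = Finsupp.single 0 1 := by
    have := LinearMap.congr_fun hg (Finsupp.single 0 1)
    simpa [Finsupp.linearCombination_single] using this
  have h1 : g b = Finsupp.single 1 1 := by
    have := LinearMap.congr_fun hg (Finsupp.single 1 1)
    simpa [Finsupp.linearCombination_single] using this
  refine ⟨((Finsupp.lapply 0 - Finsupp.lapply 1 : (Fin 2 →₀ ℚ) →ₗ[ℚ] ℚ) ∘ₗ g).toAddMonoidHom, ?_⟩
  simp [h0, h1]

end EqTiling

namespace EqTiling

open Filter Topology

lemma lin_open (F : ℝ × ℝ × ℝ) : Continuous (ev F) := by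
  unfold ev; fun_prop

lemma ev_comb (F : ℝ × ℝ × ℝ) (p q : ℝ × ℝ) (s t : ℝ) (h : s + t = 1) :
    ev F (s • p + t • q) = s * ev F p + t * ev F q := by
  simp [ev]
  linear_combination (-F.1) * h

lemma poly_convex {ι : Type} (F : ι → ℝ × ℝ × ℝ) : Convex ℝ (poly F) := by
  intro p hp q hq s t hs ht hst i
  rw [ev_comb _ _ _ _ _ hst]
  have := mul_nonneg hs (hp i)
  have := mul_nonneg ht (hq i)
  linarith

/-- the quadratic form of the skew coordinates -/
def Q (p : ℝ × ℝ) : ℝ := p.1 ^ 2 + p.1 * p.2 + p.2 ^ 2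

lemma Q_pos (x y : ℝ) (h : x ≠ 0 ∨ y ≠ 0) : 0 < x ^ 2 + x * y + y ^ 2 := by
  rcases h with h | h
  · have := pow_pos (abs_pos.2 h) 2
    rw [sq_abs] at this
    nlinarith [sq_nonneg (x + 2 * y)]
  · have := pow_pos (abs_pos.2 h) 2
    rw [sq_abs] at this
    nlinarith [sq_nonneg (2 * x + y)]

lemma hull_tri (A : ℝ × ℝ) (x y : ℝ) (h : x ≠ 0 ∨ y ≠ 0) :
    convexHull ℝ {A, (A.1 + x, A.2 + y), (A.1 - y, A.2 + (x + y))} = poly (tri A x y) := by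
  have hq := Q_pos x y h
  set q := x ^ 2 + x * y + y ^ 2 with hqd
  apply Set.Subset.antisymm
  · apply convexHull_min _ (poly_convex _)
    rintro p (rfl | rfl | rfl) i <;> fin_cases i <;> simp [ev, tri] <;> nlinarith
  · intro p hp
    have h0 := hp 0
    have h1 := hp 1
    have h2 := hp 2
    have hs : ev (tri A x y 0) p + ev (tri A x y 1) p + ev (tri A x y 2) p = q := by
      simp [ev, tri, hqd]; ring
    have hc := (convex_convexHull ℝ {A, (A.1 + x, A.2 + y), (A.1 - y, A.2 + (x + y))}).sum_mem
      (t := Finset.univ) (w := ![ev (tri A x y 1) p / q, ev (tri A x y 2) p / q,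
        ev (tri A x y 0) p / q]) (z := ![A, (A.1 + x, A.2 + y), (A.1 - y, A.2 + (x + y))])
      (by intro i _; fin_cases i <;> simp <;> positivity)
      (by simp [Fin.sum_univ_succ]; field_simp; linarith)
      (by intro i _; apply subset_convexHull; fin_cases i <;> simp)
    convert hc using 1
    ext
    · simp [Fin.sum_univ_succ, ev, tri]
      field_simp
      rw [hqd]; ring
    · simp [Fin.sum_univ_succ, ev, tri]
      field_simp
      rw [hqd]; ring

/-- an equilateral triangle in skew coordinates is a rotated one -/
lemma equi (x y z t : ℝ) (h0 : 0 < x * t - y * z)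
    (h1 : x ^ 2 + x * y + y ^ 2 = z ^ 2 + z * t + t ^ 2)
    (h2 : x ^ 2 + x * y + y ^ 2 = (z - x) ^ 2 + (z - x) * (t - y) + (t - y) ^ 2) :
    z = -y ∧ t = x + y := by
  have hne : x ≠ 0 ∨ y ≠ 0 := by
    by_contra! hc
    rw [hc.1, hc.2] at h0; simp at h0
  have hq := Q_pos x y hne
  have hB : 2 * x * z + x * t + y * z + 2 * y * t = x ^ 2 + x * y + y ^ 2 := by linarith
  have hsq : (x * t - y * z) ^ 2 = (x ^ 2 + x * y + y ^ 2) ^ 2 := by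
    linear_combination (-4/3 : ℝ) * (x ^ 2 + x * y + y ^ 2) * h1
      - (1/3 : ℝ) * (2 * x * z + x * t + y * z + 2 * y * t + (x ^ 2 + x * y + y ^ 2)) * hB
  have hd : x * t - y * z = x ^ 2 + x * y + y ^ 2 := by
    rcases sq_eq_sq_iff_eq_or_eq_neg.1 hsq with h | h
    · exact h
    · linarith
  constructor
  · have : (x ^ 2 + x * y + y ^ 2) * (z + y) = 0 := by
      linear_combination (x / 2) * hB - (x / 2 + y) * hd
    have := (mul_eq_zero.1 this).resolve_left hq.ne'
    linarith
  · have : (x ^ 2 + x * y + y ^ 2) * (t - (x + y)) = 0 := by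
      linear_combination (y / 2) * hB + (x + y / 2) * hd
    have := (mul_eq_zero.1 this).resolve_left hq.ne'
    linarith

lemma det_ne (x y z t : ℝ) (hne : ¬ (x = 0 ∧ y = 0))
    (h1 : x ^ 2 + x * y + y ^ 2 = z ^ 2 + z * t + t ^ 2)
    (h2 : x ^ 2 + x * y + y ^ 2 = (z - x) ^ 2 + (z - x) * (t - y) + (t - y) ^ 2) :
    x * t - y * z ≠ 0 := by
  intro hc
  have hne : x ≠ 0 ∨ y ≠ 0 := by tauto
  have hq := Q_pos x y hne
  have hB : 2 * x * z + x * t + y * z + 2 * y * t = x ^ 2 + x * y + y ^ 2 := by linarith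
  have hsq : (x * t - y * z) ^ 2 = (x ^ 2 + x * y + y ^ 2) ^ 2 := by
    linear_combination (-4/3 : ℝ) * (x ^ 2 + x * y + y ^ 2) * h1
      - (1/3 : ℝ) * (2 * x * z + x * t + y * z + 2 * y * t + (x ^ 2 + x * y + y ^ 2)) * hB
  rw [hc] at hsq
  have := pow_pos hq 2
  linarith

lemma hull_pos (A B C : ℝ × ℝ) (hpos : 0 < (B.1 - A.1) * (C.2 - A.2) - (B.2 - A.2) * (C.1 - A.1))
    (h1 : Q (B - A) = Q (C - A)) (h2 : Q (B - A) = Q (C - B)) :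
    ∃ x y, (x ≠ 0 ∨ y ≠ 0) ∧ convexHull ℝ {A, B, C} = poly (tri A x y) := by
  obtain ⟨hz, ht⟩ := equi (B.1 - A.1) (B.2 - A.2) (C.1 - A.1) (C.2 - A.2) hpos
    (by simpa [Q] using h1) (by simpa [Q] using h2)
  have hne : B.1 - A.1 ≠ 0 ∨ B.2 - A.2 ≠ 0 := by
    by_contra! hc
    rw [hc.1, hc.2] at hpos; simp at hpos
  refine ⟨B.1 - A.1, B.2 - A.2, hne, ?_⟩
  rw [← hull_tri _ _ _ hne]
  congr 3
  · ext <;> simp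
  · congr 1
    ext <;> simp <;> linarith

lemma hull_equi (A B C : ℝ × ℝ) (hne : ¬ (B = A ∧ C = A))
    (h1 : Q (B - A) = Q (C - A)) (h2 : Q (B - A) = Q (C - B)) :
    ∃ x y, (x ≠ 0 ∨ y ≠ 0) ∧ convexHull ℝ {A, B, C} = poly (tri A x y) := by
  have hBA : ¬ (B.1 - A.1 = 0 ∧ B.2 - A.2 = 0) := by
    rintro ⟨h3, h4⟩
    have hB : B = A := by ext <;> linarith
    refine hne ⟨hB, ?_⟩
    subst hB
    by_contra hc
    have : C.1 - B.1 ≠ 0 ∨ C.2 - B.2 ≠ 0 := by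
      by_contra! h
      exact hc (by ext <;> linarith [h.1, h.2])
    have := Q_pos _ _ this
    simp [Q] at h1
    linarith
  have hd := det_ne (B.1 - A.1) (B.2 - A.2) (C.1 - A.1) (C.2 - A.2) hBA
    (by simpa [Q] using h1) (by simpa [Q] using h2)
  rcases lt_or_gt_of_ne hd with hd | hd
  · have := hull_pos A C B (by linarith) h1.symm (by
      rw [← h1, h2]; simp [Q]; ring)
    rwa [Set.pair_comm C B] at this
  · exact hull_pos A B C hd h1 h2

end EqTiling
open EqTiling

/-- A parallelogram with an angle of `π/3` whose edge-length ratio is irrational cannot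
be tiled by finitely many equilateral triangles with pairwise disjoint interiors. -/
theorem no_equilateral_tiling_of_irrational_parallelogram
    (u w v : EuclideanSpace ℝ (Fin 2))
    (hind : LinearIndependent ℝ ![u, w])
    (hangle : InnerProductGeometry.angle u w = Real.pi / 3)
    (hirr : Irrational (‖u‖ / ‖w‖))
    (P : Set (EuclideanSpace ℝ (Fin 2)))
    (hP : P = (fun st : ℝ × ℝ => v + st.1 • u + st.2 • w) ''
      (Set.Icc (0 : ℝ) 1 ×ˢ Set.Icc (0 : ℝ) 1)) :
    ¬ ∃ (m : ℕ) (T : Fin m → Set (EuclideanSpace ℝ (Fin 2))),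
        (∀ j, ∃ a b c : EuclideanSpace ℝ (Fin 2),
          ¬ Collinear ℝ ({a, b, c} : Set (EuclideanSpace ℝ (Fin 2))) ∧
          dist a b = dist b c ∧ dist b c = dist c a ∧
          T j = convexHull ℝ {a, b, c}) ∧
        (∀ i j, i ≠ j → interior (T i) ∩ interior (T j) = ∅) ∧
        P = ⋃ j, T j := by
  rintro ⟨m, T, hT, hdisj, hU⟩
  have hu0 : u ≠ 0 := hind.ne_zero 0
  have hw0 : w ≠ 0 := hind.ne_zero 1
  have ha : 0 < ‖u‖ := norm_pos_iff.2 hu0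
  have hb : 0 < ‖w‖ := norm_pos_iff.2 hw0
  have hin : inner ℝ u w = ‖u‖ * ‖w‖ / 2 := by
    rw [← InnerProductGeometry.cos_angle_mul_norm_mul_norm, hangle, Real.cos_pi_div_three]; ring
  -- the linear coordinate map
  let L0 : ℝ × ℝ →ₗ[ℝ] EuclideanSpace ℝ (Fin 2) :=
    (LinearMap.fst ℝ ℝ ℝ).smulRight (‖u‖⁻¹ • u) + (LinearMap.snd ℝ ℝ ℝ).smulRight (‖w‖⁻¹ • w)
  have hL0 : ∀ p, L0 p = p.1 • (‖u‖⁻¹ • u) + p.2 • (‖w‖⁻¹ • w) := fun p => rfl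
  have hQ : ∀ p, ‖L0 p‖ ^ 2 = Q p := by
    intro p
    rw [hL0, norm_add_sq_real]
    simp only [norm_smul, inner_smul_left, inner_smul_right, hin, Q, norm_inv, norm_norm,
      mul_pow, Real.norm_eq_abs, sq_abs]
    simp
    field_simp
  have hinj : Function.Injective L0 := by
    rw [injective_iff_map_eq_zero]
    intro p hp
    have h := hQ p
    rw [hp] at h
    by_contra hc
    have : p.1 ≠ 0 ∨ p.2 ≠ 0 := by
      by_contra! h
      exact hc (Prod.ext h.1 h.2)
    have := Q_pos _ _ this
    simp [Q] at h
    linarith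
  let L : (ℝ × ℝ) ≃ₗ[ℝ] EuclideanSpace ℝ (Fin 2) :=
    LinearEquiv.ofInjectiveOfFinrankEq L0 hinj (by simp)
  have hL : ∀ p, L p = L0 p := fun p => rfl
  let ψ : (ℝ × ℝ) ≃ᵃ[ℝ] EuclideanSpace ℝ (Fin 2) :=
    L.toAffineEquiv.trans (AffineEquiv.constVAdd ℝ _ v)
  have hψ : ∀ p, ψ p = v + L0 p := fun p => rfl
  have hψo : ∀ U, IsOpen U → IsOpen (ψ '' U) := by
    intro U hU
    exact ψ.toHomeomorphOfFiniteDimensional.isOpenMap U hU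
  have hdist : ∀ p q, dist (ψ p) (ψ q) ^ 2 = Q (p - q) := by
    intro p q
    rw [dist_eq_norm, hψ, hψ, add_sub_add_left_eq_sub, ← map_sub, hQ]
  have tile : ∀ j, ∃ (A : ℝ × ℝ) (x y : ℝ), (x ≠ 0 ∨ y ≠ 0) ∧ T j = ψ '' poly (tri A x y) := by
    intro j
    obtain ⟨a, b, c, hcol, h1, h2, hTj⟩ := hT j
    obtain ⟨A, rfl⟩ := ψ.surjective a
    obtain ⟨B, rfl⟩ := ψ.surjective b
    obtain ⟨C, rfl⟩ := ψ.surjective c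
    obtain ⟨x, y, hxy, hh⟩ := hull_equi A B C (by
      rintro ⟨rfl, rfl⟩
      apply hcol
      simp [collinear_singleton])
      (by rw [← hdist, ← hdist, dist_comm (ψ B), h1, h2])
      (by rw [← hdist, ← hdist, dist_comm (ψ B), h1, dist_comm])
    refine ⟨A, x, y, hxy, ?_⟩
    rw [hTj, ← hh]
    have := ψ.toAffineMap.image_convexHull ({A, B, C} : Set (ℝ × ℝ))
    simp only [Set.image_insert_eq, Set.image_singleton, AffineEquiv.coe_toAffineMap] at this
    exact this.symm
  choose A x y hxy hTS using tile
  obtain ⟨f, hf⟩ := no_f ‖u‖ ‖w‖ hb hirr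
  refine absurd (core ‖u‖ ‖w‖ ha hb A x y hxy ?_ ?_ f) (not_le.2 hf)
  · intro p
    have hp : ψ p ∈ P ↔ ∃ j, p ∈ poly (tri (A j) (x j) (y j)) := by
      rw [hU, Set.mem_iUnion]
      refine exists_congr fun j => ?_
      rw [hTS, ψ.injective.mem_set_image]
    rw [← hp, hP]
    have hst : ∀ s t : ℝ, v + s • u + t • w = ψ (s * ‖u‖, t * ‖w‖) := by
      intro s t
      rw [hψ, hL0]
      simp only [smul_smul, mul_assoc, mul_inv_cancel₀ ha.ne', mul_inv_cancel₀ hb.ne', mul_one,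
        add_assoc]
    constructor
    · rintro ⟨h1, h2, h3, h4⟩
      refine ⟨(p.1 / ‖u‖, p.2 / ‖w‖), ⟨⟨by positivity, ?_⟩, ⟨by positivity, ?_⟩⟩, ?_⟩
      · exact (div_le_one ha).2 h2
      · exact (div_le_one hb).2 h4
      · simp only [hst]
        congr 1
        ext <;> simp <;> field_simp
    · rintro ⟨⟨s, t⟩, ⟨⟨h1, h2⟩, ⟨h3, h4⟩⟩, h⟩
      simp only [hst] at h h1 h2 h3 h4
      rw [← ψ.injective h]
      refine ⟨by positivity, ?_, by positivity, ?_⟩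
      · simp only; nlinarith
      · simp only; nlinarith
  · intro i j hij p hi hj
    have hmemInt : ∀ j, (∀ k, 0 < ev (tri (A j) (x j) (y j) k) p) → ψ p ∈ interior (T j) := by
      intro j hj
      rw [mem_interior]
      refine ⟨ψ '' {p | ∀ k, 0 < ev (tri (A j) (x j) (y j) k) p}, ?_, ?_, p, hj, rfl⟩
      · rw [hTS]
        exact Set.image_mono fun q hq k => (hq k).le
      · apply hψo
        rw [Set.setOf_forall]
        exact isOpen_iInter_of_finite fun k => isOpen_lt continuous_const (lin_open _)
    have : ψ p ∈ interior (T i) ∩ interior (T j) := ⟨hmemInt i hi, hmemInt j hj⟩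
    rw [hdisj i j hij] at this
    exact this
end
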